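/- arXiv:0906.2848 — 4 statements merged into one kernel-verified Lean document; each statement's English description precedes it below -/
import Mathlib

section
/- As formal power series in ℤ⟦q⟧: ψ(q)·φ(q)² = ψ(q)·φ(q³)² + 4q·ψ(q³)·ψ(q⁶)·φ(q). -/
open PowerSeries

/-- `phi k` is the theta series `φ(q^k) = ∑_{m ∈ ℤ} q^(k·m²)`, i.e. the formal power
series whose coefficient of `qⁿ` is `#{m ∈ ℤ : n = k·m²}`. -/
noncomputable def phi (k : ℕ) : PowerSeries ℤ :=
  PowerSeries.mk fun n => ({m : ℤ | (n : ℤ) = k * m ^ 2}.ncard : ℤ)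

/-- `psi k` is the theta series `ψ(q^k) = ∑_{m ≥ 0} q^(k·m(m+1)/2)`, i.e. the formal
power series whose coefficient of `qⁿ` is `#{m ∈ ℤ, m ≥ 0 : n = k·m(m+1)/2}`. -/
noncomputable def psi (k : ℕ) : PowerSeries ℤ :=
  PowerSeries.mk fun n => ({m : ℤ | 0 ≤ m ∧ (n : ℤ) = k * (m * (m + 1) / 2)}.ncard : ℤ)

theorem cc2 : constantCoeff (2 : PowerSeries ℤ) = 2 := map_ofNat _ 2
theorem cc4 : constantCoeff (4 : PowerSeries ℤ) = 4 := map_ofNat _ 4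
theorem four_ne : (4 : PowerSeries ℤ) ≠ 0 := by
  intro h
  have := congrArg constantCoeff h
  rw [cc4] at this
  simp at this
theorem ex2 (k : ℕ) (hk : k ≠ 0) : expand k hk (2 : PowerSeries ℤ) = 2 := map_ofNat _ 2
theorem ex4 (k : ℕ) (hk : k ≠ 0) : expand k hk (4 : PowerSeries ℤ) = 4 := map_ofNat _ 4


/-- generating series of an exponent function -/
noncomputable def gen {ι : Type} (e : ι → ℤ) : PowerSeries ℤ :=
  PowerSeries.mk fun n => (Nat.card {i // e i = (n : ℤ)} : ℤ)

structure Good {ι : Type} (e : ι → ℤ) : Prop where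
  nn : ∀ i, 0 ≤ e i
  fin : ∀ n : ℕ, Finite {i // e i = (n : ℤ)}

def prodEquiv {ι κ : Type} (e : ι → ℤ) (f : κ → ℤ) (he : ∀ i, 0 ≤ e i) (hf : ∀ i, 0 ≤ f i)
    (n : ℕ) : {p : ι × κ // e p.1 + f p.2 = (n : ℤ)} ≃
      Σ x : Finset.HasAntidiagonal.antidiagonal n, {i // e i = ((x.1.1 : ℕ) : ℤ)} × {j // f j = ((x.1.2 : ℕ) : ℤ)} where
  toFun p := ⟨⟨((e p.1.1).toNat, (f p.1.2).toNat), by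
      have := he p.1.1; have := hf p.1.2; have := p.2
      rw [Finset.HasAntidiagonal.mem_antidiagonal]; simp only; omega⟩,
      ⟨p.1.1, by have := he p.1.1; simp only; omega⟩, ⟨p.1.2, by have := hf p.1.2; simp only; omega⟩⟩
  invFun y := ⟨(y.2.1.1, y.2.2.1), by
      have h := y.1.2
      rw [Finset.HasAntidiagonal.mem_antidiagonal] at h
      have h1 := y.2.1.2; have h2 := y.2.2.2
      simp only; omega⟩
  left_inv p := by simp
  right_inv := by
    rintro ⟨⟨⟨a, b⟩, h⟩, ⟨i, hi⟩, ⟨j, hj⟩⟩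
    simp only at hi hj
    have h1 : (e i).toNat = a := by omega
    have h2 : (f j).toNat = b := by omega
    subst h1 h2
    rfl

theorem Good.prod {ι κ : Type} {e : ι → ℤ} {f : κ → ℤ} (he : Good e) (hf : Good f) :
    Good (fun p : ι × κ => e p.1 + f p.2) where
  nn p := add_nonneg (he.nn _) (hf.nn _)
  fin n := by
    have := he.fin
    have := hf.fin
    exact Finite.of_equiv _ (prodEquiv e f he.nn hf.nn n).symm

theorem gen_mul {ι κ : Type} {e : ι → ℤ} {f : κ → ℤ} (he : Good e) (hf : Good f) :
    gen e * gen f = gen (fun p : ι × κ => e p.1 + f p.2) := by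
  ext n
  have := he.fin
  have := hf.fin
  rw [coeff_mul]
  simp only [gen, coeff_mk]
  rw [Nat.card_congr (prodEquiv e f he.nn hf.nn n), Nat.card_sigma]
  simp only [Nat.card_prod]
  push_cast
  exact (Finset.sum_coe_sort (Finset.HasAntidiagonal.antidiagonal n) (fun x =>
    (Nat.card {i // e i = ((x.1 : ℕ) : ℤ)} : ℤ) * (Nat.card {j // f j = ((x.2 : ℕ) : ℤ)} : ℤ))).symm

theorem gen_congr {ι κ : Type} {e : ι → ℤ} {f : κ → ℤ} (s : ι ≃ κ) (h : ∀ i, e i = f (s i)) :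
    gen e = gen f := by
  ext n
  simp only [gen, coeff_mk]
  congr 1
  exact Nat.card_congr (s.subtypeEquiv (fun i => by rw [h i]))

theorem Good.shift {ι : Type} {e : ι → ℤ} (he : Good e) : Good (fun i => 1 + e i) where
  nn i := by have := he.nn i; omega
  fin n := by
    rcases n with _ | n
    · refine @Finite.of_subsingleton _ ⟨fun a => ?_⟩
      have := he.nn a.1; have := a.2; push_cast at this; omega
    · have := he.fin n
      refine Finite.of_injective (β := {i // e i = (n : ℤ)})
        (fun i => ⟨i.1, by have := i.2; push_cast at this; omega⟩) ?_
      intro a b h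
      simpa [Subtype.ext_iff] using h

theorem gen_shift {ι : Type} {e : ι → ℤ} (he : Good e) :
    X * gen e = gen (fun i => 1 + e i) := by
  ext n
  rcases n with _ | n
  · simp only [gen, coeff_zero_X_mul, coeff_mk]
    have : IsEmpty {i // 1 + e i = ((0 : ℕ) : ℤ)} := ⟨fun a => by
      have := he.nn a.1; have := a.2; push_cast at this; omega⟩
    simp
  · simp only [gen, coeff_succ_X_mul, coeff_mk]
    congr 1
    refine Nat.card_congr (Equiv.subtypeEquivRight fun i => ?_)
    push_cast
    omega

/-- splitting along a pair of maps covering everything disjointly -/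
theorem gen_split {ι κ μ : Type} {e : ι → ℤ} {f : κ → ℤ} {g : μ → ℤ} (he : Good e)
    (s : κ → ι) (t : μ → ι) (hs : Function.Injective s) (ht : Function.Injective t)
    (hst : ∀ a b, s a ≠ t b) (hc : ∀ i, (∃ a, s a = i) ∨ ∃ b, t b = i)
    (hf : ∀ a, e (s a) = f a) (hg : ∀ b, e (t b) = g b) : gen e = gen f + gen g := by
  ext n
  have hF := he.fin n
  have : Finite {a // f a = (n : ℤ)} := by
    refine Finite.of_injective (β := {i // e i = (n : ℤ)}) (fun a => ⟨s a.1, by rw [hf, a.2]⟩) ?_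
    intro a b h
    exact Subtype.ext (hs (by simpa using h))
  have : Finite {a // g a = (n : ℤ)} := by
    refine Finite.of_injective (β := {i // e i = (n : ℤ)}) (fun a => ⟨t a.1, by rw [hg, a.2]⟩) ?_
    intro a b h
    exact Subtype.ext (ht (by simpa using h))
  simp only [gen, coeff_mk, map_add]
  rw [← Nat.cast_add, ← Nat.card_sum]
  congr 1
  symm
  refine Nat.card_congr (Equiv.ofBijective (Sum.elim (fun a => ⟨s a.1, by rw [hf, a.2]⟩)
    (fun a => ⟨t a.1, by rw [hg, a.2]⟩)) ⟨?_, ?_⟩)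
  · rintro (a | a) (b | b) h
    · simp only [Sum.elim_inl, Subtype.mk.injEq] at h
      exact congrArg _ (Subtype.ext (hs h))
    · simp only [Sum.elim_inl, Sum.elim_inr, Subtype.mk.injEq] at h
      exact absurd h (hst _ _)
    · simp only [Sum.elim_inl, Sum.elim_inr, Subtype.mk.injEq] at h
      exact absurd h.symm (hst _ _)
    · simp only [Sum.elim_inr, Subtype.mk.injEq] at h
      exact congrArg _ (Subtype.ext (ht h))
  · rintro ⟨i, hi⟩
    rcases hc i with ⟨a, rfl⟩ | ⟨b, rfl⟩
    · exact ⟨Sum.inl ⟨a, by rw [← hf, hi]⟩, rfl⟩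
    · exact ⟨Sum.inr ⟨b, by rw [← hg, hi]⟩, rfl⟩

/-- square exponents -/
def sqe (k : ℕ) (m : ℤ) : ℤ := k * m ^ 2
/-- triangular exponents -/
def tr (k : ℕ) (m : ℤ) : ℤ := k * (m * (m + 1) / 2)

theorem two_tr (k : ℕ) (m : ℤ) : 2 * tr k m = k * (m * (m + 1)) := by
  have : 2 * (m * (m + 1) / 2) = m * (m + 1) :=
    Int.mul_ediv_cancel' (Int.even_mul_succ_self m).two_dvd
  rw [tr]
  linear_combination (k : ℤ) * this

theorem good_sq (k : ℕ) (hk : 0 < k) : Good (sqe k) where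
  nn m := by unfold sqe; positivity
  fin n := by
    refine Set.Finite.subset (Set.finite_Icc (-(n : ℤ)) n) ?_
    intro m hm
    have hm : sqe k m = n := hm
    unfold sqe at hm
    have hk' : (1 : ℤ) ≤ k := by exact_mod_cast hk
    have : m ^ 2 ≤ n := by nlinarith [sq_nonneg m]
    constructor <;> nlinarith

theorem good_tr (k : ℕ) (hk : 0 < k) : Good (tr k) where
  nn m := by
    have := two_tr k m
    have h : 0 ≤ m * (m + 1) := by
      rcases le_or_gt 0 m with h | h <;> nlinarith
    have : 0 ≤ (k : ℤ) * (m * (m + 1)) := by positivity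
    omega
  fin n := by
    refine Set.Finite.subset (Set.finite_Icc (-(2 * n + 1 : ℤ)) (2 * n + 1)) ?_
    intro m hm
    have hm : tr k m = n := hm
    have h2 := two_tr k m
    have hk' : (1 : ℤ) ≤ k := by exact_mod_cast hk
    have h : 0 ≤ m * (m + 1) := by
      rcases le_or_gt 0 m with h | h <;> nlinarith
    have : m * (m + 1) ≤ 2 * n := by nlinarith
    constructor <;> nlinarith

theorem phi_eq (k : ℕ) : phi k = gen (sqe k) := by
  ext n
  simp only [phi, gen, coeff_mk, ← Nat.card_coe_set_eq]
  congr 1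
  refine Nat.card_congr (Equiv.subtypeEquivRight fun i => ?_)
  simp only [Set.mem_ofPred_eq, sqe]
  exact eq_comm

theorem tr_neg (k : ℕ) (m : ℤ) : tr k (-1 - m) = tr k m := by
  have h1 := two_tr k m
  have h2 := two_tr k (-1 - m)
  have : 2 * tr k (-1 - m) = 2 * tr k m := by rw [h1, h2]; ring
  omega

theorem psi_eq (k : ℕ) (hk : 0 < k) : gen (tr k) = 2 * psi k := by
  have h0 : psi k = gen (fun m : {m : ℤ // 0 ≤ m} => tr k m.1) := by
    ext n
    simp only [psi, gen, coeff_mk, ← Nat.card_coe_set_eq]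
    congr 1
    refine Nat.card_congr ⟨fun a => ⟨⟨a.1, a.2.1⟩, a.2.2.symm⟩, fun a => ⟨a.1.1, a.1.2, a.2.symm⟩,
      fun _ => rfl, fun _ => rfl⟩
  rw [two_mul, h0]
  refine gen_split (good_tr k hk) (fun a => a.1) (fun a => -1 - a.1) ?_ ?_ ?_ ?_ ?_ ?_
  · exact Subtype.val_injective
  · intro a b h
    apply Subtype.ext
    simp only at h
    omega
  · intro a b h
    have := a.2; have := b.2
    omega
  · intro i
    rcases le_or_gt 0 i with h | h
    · exact Or.inl ⟨⟨i, h⟩, rfl⟩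
    · exact Or.inr ⟨⟨-1 - i, by omega⟩, by simp⟩
  · intro a; rfl
  · intro a; exact tr_neg k a.1

/-- (i) -/
theorem id1 : phi 1 = phi 4 + 2 * X * psi 8 := by
  have h : gen (sqe 1) = gen (sqe 4) + gen (fun i => 1 + tr 8 i) := by
    refine gen_split (good_sq 1 (by norm_num)) (fun a => 2 * a) (fun a => 2 * a + 1) ?_ ?_ ?_ ?_ ?_ ?_
    · intro a b h; simp only at h; omega
    · intro a b h; simp only at h; omega
    · intro a b h; omega
    · intro i
      rcases Int.even_or_odd' i with ⟨a, h | h⟩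
      · exact Or.inl ⟨a, h.symm⟩
      · exact Or.inr ⟨a, h.symm⟩
    · intro a; simp only [sqe]; push_cast; ring
    · intro a
      have := two_tr 8 a
      simp only [sqe]; push_cast at *; linarith
  rw [← gen_shift (good_tr 8 (by norm_num)), psi_eq 8 (by norm_num), ← phi_eq, ← phi_eq] at h
  rw [h]; ring

/-- (ii) -/
theorem id2 : phi 1 ^ 2 = phi 2 ^ 2 + 4 * X * psi 4 ^ 2 := by
  have g1 := good_sq 1 (by norm_num)
  have g2 := good_sq 2 (by norm_num)
  have g4 := good_tr 4 (by norm_num)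
  have h : gen (fun p : ℤ × ℤ => sqe 1 p.1 + sqe 1 p.2) =
      gen (fun p : ℤ × ℤ => sqe 2 p.1 + sqe 2 p.2) +
      gen (fun p : ℤ × ℤ => 1 + (tr 4 p.1 + tr 4 p.2)) := by
    refine gen_split (g1.prod g1) (fun p => (p.1 + p.2, p.1 - p.2))
      (fun p => (p.1 + p.2 + 1, p.1 - p.2)) ?_ ?_ ?_ ?_ ?_ ?_
    · intro a b h; simp only [Prod.mk.injEq] at h; ext <;> omega
    · intro a b h; simp only [Prod.mk.injEq] at h; ext <;> omega
    · intro a b h; simp only [Prod.mk.injEq] at h; omega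
    · rintro ⟨x, y⟩
      rcases Int.even_or_odd' (x - y) with ⟨a, h | h⟩
      · exact Or.inl ⟨(y + a, a), by ext <;> simp only <;> omega⟩
      · exact Or.inr ⟨(y + a, a), by ext <;> simp only <;> omega⟩
    · intro a; simp only [sqe]; push_cast; ring
    · intro a
      have := two_tr 4 a.1
      have := two_tr 4 a.2
      simp only [sqe]; push_cast at *; linarith
  rw [← gen_shift (g4.prod g4), ← gen_mul g1 g1, ← gen_mul g2 g2, ← gen_mul g4 g4,
    psi_eq 4 (by norm_num), ← phi_eq, ← phi_eq] at h
  linear_combination h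

/-- (iii) -/
theorem id3 : psi 1 ^ 2 = phi 1 * psi 2 := by
  have g1 := good_sq 1 (by norm_num)
  have t1 := good_tr 1 (by norm_num)
  have t2 := good_tr 2 (by norm_num)
  have h : gen (fun p : ℤ × ℤ => tr 1 p.1 + tr 1 p.2) =
      gen (fun p : ℤ × ℤ => sqe 1 p.1 + tr 2 p.2) +
      gen (fun p : ℤ × ℤ => sqe 1 p.1 + tr 2 p.2) := by
    refine gen_split (t1.prod t1) (fun p => (p.2 + p.1, p.2 - p.1))
      (fun p => (p.2 + p.1, -1 - (p.2 - p.1))) ?_ ?_ ?_ ?_ ?_ ?_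
    · intro a b h; simp only [Prod.mk.injEq] at h; ext <;> omega
    · intro a b h; simp only [Prod.mk.injEq] at h; ext <;> omega
    · intro a b h; simp only [Prod.mk.injEq] at h; omega
    · rintro ⟨x, y⟩
      rcases Int.even_or_odd' (x - y) with ⟨a, h | h⟩
      · exact Or.inl ⟨(a, y + a), by ext <;> simp only <;> omega⟩
      · exact Or.inr ⟨(y + a + 1, a), by ext <;> simp only <;> omega⟩
    · intro a
      have h1 := two_tr 1 (a.2 + a.1)
      have h2 := two_tr 1 (a.2 - a.1)
      have h3 := two_tr 2 a.2
      simp only [sqe]; push_cast at *; linarith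
    · intro a
      simp only [tr_neg]
      have h1 := two_tr 1 (a.2 + a.1)
      have h2 := two_tr 1 (a.2 - a.1)
      have h3 := two_tr 2 a.2
      simp only [sqe]; push_cast at *; linarith
  rw [← gen_mul g1 t2, ← gen_mul t1 t1,
    psi_eq 1 (by norm_num), psi_eq 2 (by norm_num), ← phi_eq] at h
  have h4 : (4 : PowerSeries ℤ) * (psi 1 ^ 2) = 4 * (phi 1 * psi 2) := by linear_combination h
  exact mul_left_cancel₀ four_ne h4

/-- (iv) -/
theorem id4 : psi 1 * psi 3 = psi 4 * phi 6 + X * phi 2 * psi 12 := by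
  have g2 := good_sq 2 (by norm_num)
  have g6 := good_sq 6 (by norm_num)
  have t1 := good_tr 1 (by norm_num)
  have t3 := good_tr 3 (by norm_num)
  have t4 := good_tr 4 (by norm_num)
  have t12 := good_tr 12 (by norm_num)
  -- pairs of equal parity
  have h : gen (fun p : ℤ × ℤ => tr 1 p.1 + tr 3 p.2) =
      gen (fun p : ℤ × ℤ => tr 1 (p.1 + p.1 + p.2) + tr 3 p.2) +
      gen (fun p : ℤ × ℤ => tr 1 (p.1 + p.1 + p.2) + tr 3 p.2) := by
    refine gen_split (t1.prod t3) (fun p => (p.1 + p.1 + p.2, p.2))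
      (fun p => (p.1 + p.1 + p.2, -1 - p.2)) ?_ ?_ ?_ ?_ ?_ ?_
    · intro a b h; simp only [Prod.mk.injEq] at h; ext <;> omega
    · intro a b h; simp only [Prod.mk.injEq] at h; ext <;> omega
    · intro a b h; simp only [Prod.mk.injEq] at h; omega
    · rintro ⟨x, y⟩
      rcases Int.even_or_odd' (x - y) with ⟨a, h | h⟩
      · exact Or.inl ⟨(a, y), by ext <;> simp only <;> omega⟩
      · exact Or.inr ⟨(y + a + 1, -1 - y), by ext <;> simp only <;> omega⟩
    · intro a; rfl
    · intro a; simp only [tr_neg]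
  have hg : Good (fun p : ℤ × ℤ => tr 1 (p.1 + p.1 + p.2) + tr 3 p.2) := by
    refine ⟨fun p => add_nonneg (t1.nn _) (t3.nn _), fun n => ?_⟩
    have := (t1.prod t3).fin n
    refine Finite.of_injective (β := {p : ℤ × ℤ // tr 1 p.1 + tr 3 p.2 = (n : ℤ)})
      (fun p => ⟨(p.1.1 + p.1.1 + p.1.2, p.1.2), p.2⟩) ?_
    intro a b h
    simp only [Subtype.mk.injEq, Prod.mk.injEq] at h
    apply Subtype.ext
    ext <;> omega
  have h' : gen (fun p : ℤ × ℤ => tr 1 (p.1 + p.1 + p.2) + tr 3 p.2) =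
      gen (fun p : ℤ × ℤ => tr 4 p.1 + sqe 6 p.2) +
      gen (fun p : ℤ × ℤ => 1 + (sqe 2 p.1 + tr 12 p.2)) := by
    refine gen_split hg (fun p => (2 * p.2, p.1 - p.2))
      (fun p => (2 * p.2 + 1, p.1 - p.2 - 1)) ?_ ?_ ?_ ?_ ?_ ?_
    · intro a b h; simp only [Prod.mk.injEq] at h; ext <;> omega
    · intro a b h; simp only [Prod.mk.injEq] at h; ext <;> omega
    · intro a b h; simp only [Prod.mk.injEq] at h; omega
    · rintro ⟨x, y⟩
      rcases Int.even_or_odd' x with ⟨a, h | h⟩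
      · exact Or.inl ⟨(y + a, a), by ext <;> simp only <;> omega⟩
      · exact Or.inr ⟨(y + a + 1, a), by ext <;> simp only <;> omega⟩
    · intro a
      have h1 := two_tr 1 (2 * a.2 + 2 * a.2 + (a.1 - a.2))
      have h2 := two_tr 3 (a.1 - a.2)
      have h3 := two_tr 4 a.1
      simp only [sqe]; push_cast at *; linarith
    · intro a
      have h1 := two_tr 1 (2 * a.2 + 1 + (2 * a.2 + 1) + (a.1 - a.2 - 1))
      have h2 := two_tr 3 (a.1 - a.2 - 1)
      have h3 := two_tr 12 a.2
      simp only [sqe]; push_cast at *; linarith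
  rw [h', ← gen_shift (g2.prod t12), ← gen_mul t1 t3, ← gen_mul t4 g6, ← gen_mul g2 t12,
    psi_eq 1 (by norm_num), psi_eq 3 (by norm_num), psi_eq 4 (by norm_num),
    psi_eq 12 (by norm_num), ← phi_eq, ← phi_eq] at h
  have h4 : (4 : PowerSeries ℤ) * (psi 1 * psi 3) = 4 * (psi 4 * phi 6 + X * phi 2 * psi 12) := by
    linear_combination h
  exact mul_left_cancel₀ four_ne h4

theorem expand_phi (k j : ℕ) (hk : k ≠ 0) : expand k hk (phi j) = phi (k * j) := by
  ext n
  rw [coeff_expand]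
  split_ifs with h
  · obtain ⟨d, rfl⟩ := h
    rw [Nat.mul_div_cancel_left _ (Nat.pos_of_ne_zero hk)]
    simp only [phi, coeff_mk]
    congr 3
    ext m
    push_cast
    rw [mul_assoc]
    exact (mul_right_inj' (by exact_mod_cast hk)).symm
  · simp only [phi, coeff_mk]
    symm
    rw [Nat.cast_eq_zero]
    convert Set.ncard_empty ℤ
    ext m
    simp only [Set.mem_ofPred_eq, Set.mem_empty_iff_false, iff_false]
    intro hm
    apply h
    rw [← Int.natCast_dvd_natCast, hm]
    exact ⟨j * m ^ 2, by push_cast; ring⟩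

theorem expand_psi (k j : ℕ) (hk : k ≠ 0) : expand k hk (psi j) = psi (k * j) := by
  ext n
  rw [coeff_expand]
  split_ifs with h
  · obtain ⟨d, rfl⟩ := h
    rw [Nat.mul_div_cancel_left _ (Nat.pos_of_ne_zero hk)]
    simp only [psi, coeff_mk]
    congr 3
    ext m
    push_cast
    rw [mul_assoc]
    exact and_congr_right fun _ => (mul_right_inj' (by exact_mod_cast hk)).symm
  · simp only [psi, coeff_mk]
    symm
    rw [Nat.cast_eq_zero]
    convert Set.ncard_empty ℤ
    ext m
    simp only [Set.mem_ofPred_eq, Set.mem_empty_iff_false, iff_false]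
    rintro ⟨-, hm⟩
    apply h
    rw [← Int.natCast_dvd_natCast, hm]
    exact ⟨j * (m * (m + 1) / 2), by push_cast; ring⟩

theorem id1' (k : ℕ) (hk : k ≠ 0) : phi k = phi (k * 4) + 2 * X ^ k * psi (k * 8) := by
  have := congrArg (expand k hk) id1
  simpa [expand_phi, expand_psi, ex2, ex4] using this

theorem id2' (k : ℕ) (hk : k ≠ 0) : phi k ^ 2 = phi (k * 2) ^ 2 + 4 * X ^ k * psi (k * 4) ^ 2 := by
  have := congrArg (expand k hk) id2
  simpa [expand_phi, expand_psi, ex2, ex4] using this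

theorem id3' (k : ℕ) (hk : k ≠ 0) : psi k ^ 2 = phi k * psi (k * 2) := by
  have := congrArg (expand k hk) id3
  simpa [expand_phi, expand_psi, ex2, ex4] using this

theorem id4' (k : ℕ) (hk : k ≠ 0) :
    psi k * psi (k * 3) = psi (k * 4) * phi (k * 6) + X ^ k * phi (k * 2) * psi (k * 12) := by
  have := congrArg (expand k hk) id4
  simpa [expand_phi, expand_psi, ex2, ex4] using this

/-- `φ(-q^k)` -/
noncomputable def nphi (k : ℕ) : PowerSeries ℤ := phi (k * 4) - 2 * X ^ k * psi (k * 8)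

theorem expand_nphi (k j : ℕ) (hk : k ≠ 0) : expand k hk (nphi j) = nphi (k * j) := by
  simp [nphi, expand_phi, expand_psi, ex2, mul_assoc, pow_mul]

theorem h1 (k : ℕ) (hk : k ≠ 0) : phi k ^ 2 + nphi k ^ 2 = 2 * phi (k * 2) ^ 2 := by
  have e1 := id1' k hk
  have e2 := id2' (k * 2) (by omega)
  rw [mul_assoc, mul_assoc] at e2
  norm_num at e2
  rw [nphi, e1, e2]
  ring

theorem h2 (k : ℕ) (hk : k ≠ 0) : phi k * nphi k = nphi (k * 2) ^ 2 := by
  have e1 := id1' k hk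
  have e2 := id2' (k * 4) (by omega)
  have e3 := id3' (k * 8) (by omega)
  rw [nphi, nphi, e1]
  simp only [mul_assoc] at e2 e3 ⊢
  norm_num at e2 e3 ⊢
  simp only [pow_mul] at *
  linear_combination e2 - 4 * (X ^ k) ^ 2 * e3

theorem h5 (k : ℕ) (hk : k ≠ 0) :
    phi k * phi (k * 3) - nphi k * nphi (k * 3) = 4 * X ^ k * psi (k * 2) * psi (k * 6) := by
  have e1 := id1' k hk
  have e2 := id1' (k * 3) (by omega)
  have e4 := id4' (k * 2) (by omega)
  rw [nphi, nphi, e1, e2]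
  simp only [mul_assoc] at e4 ⊢
  norm_num at e4 ⊢
  simp only [pow_mul] at *
  linear_combination -4 * X ^ k * e4

theorem h3 (k : ℕ) (hk : k ≠ 0) :
    4 * (phi (k * 2) * nphi (k * 2) * phi (k * 6) * nphi (k * 6)) =
      (phi k * nphi (k * 3) + nphi k * phi (k * 3)) ^ 2 := by
  have e1 := id1' k hk
  have e2 := id1' (k * 3) (by omega)
  have e3 := h2 (k * 2) (by omega)
  have e4 := h2 (k * 6) (by omega)
  have e5 := h5 (k * 4) (by omega)
  have e6 : phi k * nphi (k * 3) + nphi k * phi (k * 3) = 2 * (nphi (k * 4) * nphi (k * 12)) := by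
    rw [nphi, nphi, e1, e2]
    simp only [mul_assoc] at e5 ⊢
    norm_num at e5 ⊢
    simp only [pow_mul] at *
    linear_combination 2 * e5
  rw [e6]
  simp only [mul_assoc] at e3 e4 ⊢
  norm_num at e3 e4 ⊢
  linear_combination 4 * phi (k * 6) * nphi (k * 6) * e3 + 4 * nphi (k * 4) ^ 2 * e4

theorem h6 (k : ℕ) (hk : k ≠ 0) :
    phi k ^ 4 - nphi k ^ 4 = 16 * X ^ k * psi (k * 2) ^ 4 := by
  have e0 := h1 k hk
  have e1 := id1' k hk
  have e2 := id3' (k * 4) (by omega)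
  have e3 := id3' (k * 2) (by omega)
  have e4 : phi k ^ 2 - nphi k ^ 2 = 8 * X ^ k * psi (k * 4) ^ 2 := by
    rw [e2, nphi, e1, mul_assoc k 4 2]
    norm_num
    ring
  have e3' : psi (k * 2) ^ 2 = phi (k * 2) * psi (k * 4) := by simpa [mul_assoc] using e3
  linear_combination (phi k ^ 2 - nphi k ^ 2) * e0 + 2 * phi (k * 2) ^ 2 * e4 -
    16 * X ^ k * (psi (k * 2) ^ 2 + phi (k * 2) * psi (k * 4)) * e3'

theorem phi_c0 (k : ℕ) (hk : k ≠ 0) : constantCoeff (phi k) = 1 := by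
  rw [← coeff_zero_eq_constantCoeff_apply]
  simp only [phi, coeff_mk]
  have : {m : ℤ | ((0 : ℕ) : ℤ) = k * m ^ 2} = {0} := by
    ext m
    simp [hk, eq_comm (a := (0 : ℤ))]
  rw [this]; simp

theorem psi_c0 (k : ℕ) (hk : k ≠ 0) : constantCoeff (psi k) = 1 := by
  rw [← coeff_zero_eq_constantCoeff_apply]
  simp only [psi, coeff_mk]
  have : {m : ℤ | 0 ≤ m ∧ ((0 : ℕ) : ℤ) = k * (m * (m + 1) / 2)} = {0} := by
    ext m
    simp only [Set.mem_ofPred_eq, Set.mem_singleton_iff]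
    constructor
    · rintro ⟨h0, h⟩
      have h2 := two_tr k m
      rw [tr, ← h] at h2
      have hk' : (k : ℤ) ≠ 0 := by exact_mod_cast hk
      have h3 : m * (m + 1) = 0 := by
        rcases mul_eq_zero.1 h2.symm with h | h
        · exact absurd h hk'
        · exact h
      rcases mul_eq_zero.1 h3 with h | h <;> omega
    · rintro rfl; simp
  rw [this]; simp

theorem phi_c1 (k : ℕ) (hk : 2 ≤ k) : coeff 1 (phi k) = 0 := by
  simp only [phi, coeff_mk]
  rw [Nat.cast_eq_zero]
  convert Set.ncard_empty ℤ
  ext m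
  simp only [Set.mem_ofPred_eq, Set.mem_empty_iff_false, iff_false]
  intro h
  have : (k : ℤ) ∣ 1 := ⟨m ^ 2, by exact_mod_cast h⟩
  have := Int.le_of_dvd one_pos this
  omega

theorem phi1_c1 : coeff 1 (phi 1) = 2 := by
  rw [id1]
  simp [mul_assoc, coeff_one_mul, phi_c1, psi_c0, cc2]

theorem nphi_c0 (k : ℕ) (hk : k ≠ 0) : constantCoeff (nphi k) = 1 := by
  simp [nphi, phi_c0, hk]

theorem nphi1_c1 : coeff 1 (nphi 1) = -2 := by
  simp [nphi, mul_assoc, coeff_one_mul, phi_c1, psi_c0, cc2]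

theorem nphi3_c1 : coeff 1 (nphi 3) = 0 := by
  simp [nphi, mul_assoc, coeff_one_mul, phi_c1, psi_c0, cc2, pow_succ]

/-- the auxiliary difference -/
noncomputable def FF (k : ℕ) : PowerSeries ℤ :=
  (phi k * nphi (k * 3) ^ 3 - nphi k * phi (k * 3) ^ 3) -
    phi k * nphi k * (phi k * phi (k * 3) - nphi k * nphi (k * 3))

theorem FF_expand : expand 2 two_ne_zero (FF 1) = FF 2 := by
  simp [FF, expand_phi, expand_nphi]

theorem rec_alg {R : Type*} [CommRing R] (A B C D a b c d : R)
    (e1 : A ^ 2 + B ^ 2 = 2 * a ^ 2) (e2 : A * B = b ^ 2)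
    (e3 : C ^ 2 + D ^ 2 = 2 * c ^ 2) (e4 : C * D = d ^ 2)
    (e5 : 4 * (a * b * c * d) = (A * D + B * C) ^ 2) :
    4 * (b * d * c * d) * ((a * d ^ 3 - b * c ^ 3) - a * b * (a * c - b * d)) =
    C * D * (A * C - B * D) * ((A * D ^ 3 - B * C ^ 3) - A * B * (A * C - B * D)) := by
  have s1 : 4 * (b * d * c * d) * (a * d ^ 3 - b * c ^ 3) =
      C * D * (A * C - B * D) * (A * D ^ 3 - B * C ^ 3) := by
    have : 4 * (b * d * c * d) * (a * d ^ 3 - b * c ^ 3) =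
      (4 * (a * b * c * d)) * (d ^ 2) ^ 2 - b ^ 2 * d ^ 2 * (2 * c ^ 2) ^ 2 := by ring
    rw [this, e5, ← e2, ← e3, ← e4]; ring
  have s2 : 4 * (b * d * c * d) * (a * b * (a * c - b * d)) =
      C * D * (A * C - B * D) * (A * B * (A * C - B * D)) := by
    have : 4 * (b * d * c * d) * (a * b * (a * c - b * d)) =
      b ^ 2 * d ^ 2 * ((2 * a ^ 2) * (2 * c ^ 2) - 4 * (a * b * c * d)) := by ring
    rw [this, e5, ← e1, ← e2, ← e3, ← e4]; ring
  linear_combination s1 - s2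

theorem FF_zero : FF 1 = 0 := by
  have hr := rec_alg (phi 1) (nphi 1) (phi 3) (nphi 3) (phi 2) (nphi 2) (phi 6) (nphi 6)
    (h1 1 one_ne_zero) (h2 1 one_ne_zero) (h1 3 (by norm_num)) (h2 3 (by norm_num))
    (h3 1 one_ne_zero)
  have hV : phi 1 * phi 3 - nphi 1 * nphi 3 = X * (4 * psi 2 * psi 6) := by
    have := h5 1 one_ne_zero
    norm_num at this
    rw [this]; ring
  have hr' : 4 * (nphi 2 * nphi 6 * phi 6 * nphi 6) * expand 2 two_ne_zero (FF 1) =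
      phi 3 * nphi 3 * (X * (4 * psi 2 * psi 6)) * FF 1 := by
    rw [FF_expand, ← hV]
    exact hr
  have c0 : constantCoeff (FF 1) = 0 := by
    simp [FF, phi_c0, nphi_c0]
  have c1 : coeff 1 (FF 1) = 0 := by
    simp [FF, coeff_one_mul, pow_succ, phi_c0, nphi_c0, phi1_c1, nphi1_c1, nphi3_c1, phi_c1]
  by_contra hne
  have z : ∀ f : PowerSeries ℤ, constantCoeff f ≠ 0 → f.order = 0 := fun f hf => by
    refine (order_eq_nat (n := 0)).2 ⟨by simpa using hf, by simp⟩
  have ho := congrArg order hr'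
  rw [order_mul, order_mul (phi 3 * nphi 3 * (X * (4 * psi 2 * psi 6))), order_mul (phi 3 * nphi 3),
    order_mul X, order_X, order_expand, z (4 * _) (by simp [phi_c0, nphi_c0, cc4]),
    z (phi 3 * nphi 3) (by simp [phi_c0, nphi_c0]), z (4 * psi 2 * psi 6) (by simp [psi_c0, cc4])] at ho
  have hge : ((2 : ℕ) : ℕ∞) ≤ (FF 1).order := by
    apply nat_le_order
    intro i hi
    interval_cases i
    · simpa using c0
    · exact c1
  have hfin : (FF 1).order ≠ ⊤ := by
    simpa [order_eq_top] using hne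
  obtain ⟨n, hn⟩ := ENat.ne_top_iff_exists.1 hfin
  rw [← hn] at ho hge
  simp only [nsmul_eq_mul, zero_add, add_zero] at ho
  norm_cast at ho hge
  omega

theorem fin_alg {R : Type*} [CommRing R] (A B C D : R)
    (hL : (A * D ^ 3 - B * C ^ 3) - A * B * (A * C - B * D) = 0)
    (hK : (A * D + B * C) ^ 4 = 4 * (A * B * (C * D)) * ((A ^ 2 + B ^ 2) * (C ^ 2 + D ^ 2))) :
    (B ^ 2 * (A * C - B * D)) * ((A ^ 2 - C ^ 2) ^ 2 * (A * C - B * D)) =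
    (B ^ 2 * (A * C - B * D)) * (4 * A * C * (C ^ 4 - D ^ 4)) := by
  have s : B * (A * C - B * D) * (A ^ 2 - C ^ 2) =
      A ^ 2 * D ^ 3 - 2 * A * B * C ^ 3 + B ^ 2 * C ^ 2 * D := by
    linear_combination -A * hL
  have s2 : (B ^ 2 * (A * C - B * D)) * ((A ^ 2 - C ^ 2) ^ 2 * (A * C - B * D)) =
      (B * (A * C - B * D) * (A ^ 2 - C ^ 2)) ^ 2 := by ring
  rw [s2, s]
  linear_combination D ^ 2 * hK

theorem theta_identity_2_10 :
    psi 1 * phi 1 ^ 2 = psi 1 * phi 3 ^ 2 + 4 * X * psi 3 * psi 6 * phi 1 := by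
  have ne : ∀ f : PowerSeries ℤ, constantCoeff f ≠ 0 → f ≠ 0 := by
    rintro f hf rfl
    simp at hf
  have hA := ne (phi 1) (by simp [phi_c0])
  have hB := ne (nphi 1) (by simp [nphi_c0])
  have hp2 := ne (psi 2) (by simp [psi_c0])
  have hp6 := ne (psi 6) (by simp [psi_c0])
  have hX : (X : PowerSeries ℤ) ≠ 0 := X_ne_zero
  have h4 : (4 : PowerSeries ℤ) ≠ 0 := four_ne
  have e5 : phi 1 * phi 3 - nphi 1 * nphi 3 = 4 * X * psi 2 * psi 6 := by
    simpa using h5 1 one_ne_zero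
  have hV : phi 1 * phi 3 - nphi 1 * nphi 3 ≠ 0 := by
    rw [e5]; exact mul_ne_zero (mul_ne_zero (mul_ne_zero h4 hX) hp2) hp6
  have hL : (phi 1 * nphi 3 ^ 3 - nphi 1 * phi 3 ^ 3) -
    phi 1 * nphi 1 * (phi 1 * phi 3 - nphi 1 * nphi 3) = 0 := FF_zero
  have hK : (phi 1 * nphi 3 + nphi 1 * phi 3) ^ 4 = 4 * (phi 1 * nphi 1 * (phi 3 * nphi 3)) *
      ((phi 1 ^ 2 + nphi 1 ^ 2) * (phi 3 ^ 2 + nphi 3 ^ 2)) := by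
    have a1 : phi 1 ^ 2 + nphi 1 ^ 2 = 2 * phi 2 ^ 2 := h1 1 one_ne_zero
    have a2 : phi 1 * nphi 1 = nphi 2 ^ 2 := h2 1 one_ne_zero
    have a3 : phi 3 ^ 2 + nphi 3 ^ 2 = 2 * phi 6 ^ 2 := h1 3 (by norm_num)
    have a4 : phi 3 * nphi 3 = nphi 6 ^ 2 := h2 3 (by norm_num)
    have a5 : 4 * (phi 2 * nphi 2 * phi 6 * nphi 6) =
      (phi 1 * nphi 3 + nphi 1 * phi 3) ^ 2 := h3 1 one_ne_zero
    rw [a1, a2, a3, a4]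
    calc _ = ((phi 1 * nphi 3 + nphi 1 * phi 3) ^ 2) ^ 2 := by ring
      _ = _ := by rw [← a5]; ring
  have hT := mul_left_cancel₀ (mul_ne_zero (pow_ne_zero 2 hB) hV) (fin_alg _ _ _ _ hL hK)
  have e6 : phi 3 ^ 4 - nphi 3 ^ 4 = 16 * X ^ 3 * psi 6 ^ 4 := h6 3 (by norm_num)
  have e7 : psi 1 ^ 2 = phi 1 * psi 2 := id3
  have e8 : psi 3 ^ 2 = phi 3 * psi 6 := id3' 3 (by norm_num)
  rw [e5, e6] at hT
  have hT' : (phi 1 ^ 2 - phi 3 ^ 2) ^ 2 * psi 2 = 16 * X ^ 2 * phi 1 * phi 3 * psi 6 ^ 3 := by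
    have h0 : 4 * X * psi 6 ≠ 0 := mul_ne_zero (mul_ne_zero h4 hX) hp6
    apply mul_left_cancel₀ h0
    linear_combination hT
  have hsq : ((phi 1 ^ 2 - phi 3 ^ 2) * psi 1) ^ 2 = (4 * X * psi 3 * psi 6 * phi 1) ^ 2 := by
    linear_combination (phi 1 ^ 2 - phi 3 ^ 2) ^ 2 * e7 + phi 1 * hT' -
      16 * X ^ 2 * psi 6 ^ 2 * phi 1 ^ 2 * e8
  rcases sq_eq_sq_iff_eq_or_eq_neg.1 hsq with h | h
  · linear_combination h
  · exfalso
    have := congrArg (coeff 1) h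
    simp [coeff_one_mul, pow_succ, phi_c0, psi_c0, phi1_c1, phi_c1, cc4, mul_assoc] at this
end

section
/- If M is a positive integer with M ≡ 1 (mod 8), then (1,8,8,0,0,0)(M) = (1,6,6,0,0,0)(M) + 2·(2,3,6,0,0,0)(M). -/
/-- The number of representations of `M` by the ternary quadratic form
`a x² + b y² + c z² + d y z + e z x + f x y`. -/
noncomputable def rep (a b c d e f M : ℤ) : ℕ :=
  {p : ℤ × ℤ × ℤ | M = a * p.1 ^ 2 + b * p.2.1 ^ 2 + c * p.2.2 ^ 2
      + d * p.2.1 * p.2.2 + e * p.2.2 * p.1 + f * p.1 * p.2.1}.ncard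


section
open PowerSeries PowerSeries.WithPiTopology Filter Topology

/-- q-binomial coefficients -/
noncomputable def qb (Q : ℤ⟦X⟧) : ℕ → ℕ → ℤ⟦X⟧
  | _, 0 => 1
  | 0, _ + 1 => 0
  | m + 1, k + 1 => qb Q m k + Q ^ (k + 1) * qb Q m (k + 1)

lemma qb_zero_right (Q : ℤ⟦X⟧) (m : ℕ) : qb Q m 0 = 1 := by cases m <;> rfl

lemma qb_succ (Q : ℤ⟦X⟧) (m k : ℕ) :
    qb Q (m + 1) (k + 1) = qb Q m k + Q ^ (k + 1) * qb Q m (k + 1) := rfl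

lemma qb_gt (Q : ℤ⟦X⟧) (m : ℕ) : ∀ k, m < k → qb Q m k = 0 := by
  induction m with
  | zero => intro k hk; obtain ⟨k, rfl⟩ := Nat.exists_eq_succ_of_ne_zero (by omega : k ≠ 0); rfl
  | succ m ih =>
    intro k hk
    obtain ⟨k, rfl⟩ := Nat.exists_eq_succ_of_ne_zero (by omega : k ≠ 0)
    rw [Nat.succ_eq_add_one, qb_succ, ih k (by omega), ih (k + 1) (by omega)]; ring

lemma qb_ratio (Q : ℤ⟦X⟧) (m : ℕ) : ∀ k, k ≤ m →
    (1 - Q ^ (m - k)) * qb Q m k = (1 - Q ^ (k + 1)) * qb Q m (k + 1) := by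
  induction m with
  | zero => intro k hk; obtain rfl : k = 0 := by omega
            rw [qb_gt Q 0 1 (by omega)]; simp
  | succ m ih =>
    intro k hk
    rcases k with _ | k
    · rw [qb_succ, qb_zero_right, qb_zero_right]
      have := ih 0 (by omega)
      rw [qb_zero_right] at this
      simp only [Nat.sub_zero, zero_add] at *
      linear_combination Q * this
    · rcases Nat.lt_or_ge k m with h | h
      · have h1 := ih k (by omega)
        have h2 := ih (k + 1) (by omega)
        obtain ⟨d, rfl⟩ : ∃ d, m = k + 1 + d := ⟨m - k - 1, by omega⟩
        rw [qb_succ, qb_succ]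
        rw [show k + 1 + d - k = d + 1 by omega] at h1
        rw [show k + 1 + d - (k + 1) = d by omega] at h2
        rw [show k + 1 + d + 1 - (k + 1) = d + 1 by omega]
        linear_combination h1 + Q ^ (k + 2) * h2
      · obtain rfl : k = m := by omega
        rw [qb_gt Q (k + 1) (k + 1 + 1) (by omega)]; simp

/-- finite Euler product -/
noncomputable def pq (Q : ℤ⟦X⟧) (n : ℕ) : ℤ⟦X⟧ := ∏ i ∈ Finset.range n, (1 - Q ^ (i + 1))

lemma qb_pq (Q : ℤ⟦X⟧) (m : ℕ) : ∀ k, k ≤ m → qb Q m k * pq Q k * pq Q (m - k) = pq Q m := by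
  intro k
  induction k with
  | zero => intro _; simp [qb_zero_right, pq]
  | succ k ih =>
    intro hk
    rw [← ih (by omega)]
    obtain ⟨d, rfl⟩ : ∃ d, m = k + 1 + d := ⟨m - k - 1, by omega⟩
    have := qb_ratio Q (k + 1 + d) k (by omega)
    rw [show k + 1 + d - k = d + 1 by omega] at *
    rw [show k + 1 + d - (k + 1) = d by omega]
    unfold pq at *
    rw [Finset.prod_range_succ _ k, Finset.prod_range_succ _ d]
    linear_combination (-(∏ i ∈ Finset.range k, (1 - Q ^ (i + 1))) *
      ∏ i ∈ Finset.range d, (1 - Q ^ (i + 1))) * this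

lemma choose2_succ (k : ℕ) : (k + 1) * k / 2 = k * (k - 1) / 2 + k := by
  have := Nat.triangle_succ k
  simpa using this

lemma qbinom (Q y : ℤ⟦X⟧) (m : ℕ) : ∀ x : ℤ⟦X⟧, ∏ j ∈ Finset.range m, (y + x * Q ^ j) =
    ∑ k ∈ Finset.range (m + 1), qb Q m k * Q ^ (k * (k - 1) / 2) * x ^ k * y ^ (m - k) := by
  induction m with
  | zero => intro x; simp [qb_zero_right]
  | succ m ih =>
    intro x
    rw [Finset.prod_range_succ']
    have h1 : ∏ j ∈ Finset.range m, (y + x * Q ^ (j + 1)) =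
      ∏ j ∈ Finset.range m, (y + (x * Q) * Q ^ j) :=
      Finset.prod_congr rfl fun j _ => by ring
    rw [h1, ih (x * Q), Finset.sum_range_succ' _ (m + 1), mul_add, pow_zero, mul_one, add_comm]
    have e1 : (∑ k ∈ Finset.range (m + 1), qb Q m k * Q ^ (k * (k - 1) / 2) * (x * Q) ^ k * y ^ (m - k)) * y
      = ∑ k ∈ Finset.range (m + 1), Q ^ (k + 1) * qb Q m (k + 1) * Q ^ ((k + 1) * k / 2) * x ^ (k + 1)
          * y ^ (m - k) + y ^ (m + 1) := by
      rw [Finset.sum_range_succ', Finset.sum_range_succ _ m, qb_gt Q m (m + 1) (by omega), add_mul, Finset.sum_mul]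
      simp only [qb_zero_right]
      simp only [mul_zero, zero_mul, add_zero]
      refine congrArg₂ (· + ·) ?_ ?_
      · refine Finset.sum_congr rfl fun k hk => ?_
        rw [Finset.mem_range] at hk
        obtain ⟨d, rfl⟩ : ∃ d, m = k + 1 + d := ⟨m - k - 1, by omega⟩
        rw [show k + 1 + d - k = d + 1 by omega, show k + 1 + d - (k + 1) = d by omega, Nat.add_sub_cancel]
        ring
      · simp; ring
    have e2 : (∑ k ∈ Finset.range (m + 1), qb Q m k * Q ^ (k * (k - 1) / 2) * (x * Q) ^ k * y ^ (m - k)) * x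
      = ∑ k ∈ Finset.range (m + 1), qb Q m k * Q ^ ((k + 1) * k / 2) * x ^ (k + 1)
          * y ^ (m - k) := by
      rw [Finset.sum_mul]
      refine Finset.sum_congr rfl fun k hk => ?_
      rw [choose2_succ]
      ring
    rw [e1, e2, qb_zero_right]
    have e3 : ∀ k, qb Q (m + 1) (k + 1) * Q ^ ((k + 1) * (k + 1 - 1) / 2) * x ^ (k + 1) * y ^ (m + 1 - (k + 1))
      = qb Q m k * Q ^ ((k + 1) * k / 2) * x ^ (k + 1) * y ^ (m - k)
        + Q ^ (k + 1) * qb Q m (k + 1) * Q ^ ((k + 1) * k / 2) * x ^ (k + 1)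
          * y ^ (m - k) := by
      intro k
      rw [qb_succ, Nat.add_sub_cancel, Nat.add_sub_add_right]; ring
    simp only [e3, Finset.sum_add_distrib]
    simp
    ring

/-- triangular numbers -/
def tri (n : ℤ) : ℕ := (n * (n + 1) / 2).toNat

lemma tri_spec (n : ℤ) : 2 * (tri n : ℤ) = n * (n + 1) := by
  unfold tri
  have h : Even (n * (n + 1)) := Int.even_mul_succ_self n
  have h0 : 0 ≤ n * (n + 1) := by
    rcases le_or_gt 0 n with h | h <;> nlinarith
  obtain ⟨c, hc⟩ := h
  rw [hc] at h0 ⊢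
  omega

/-- theta terms -/
noncomputable def tt (a b : ℤ⟦X⟧) (n : ℤ) : ℤ⟦X⟧ := a ^ tri n * b ^ tri (-n)

lemma jtp_fin (a b : ℤ⟦X⟧) (ha : a ≠ 0) (hb : b ≠ 0) (N : ℕ) :
    ∏ j ∈ Finset.range N, ((1 + a * (a * b) ^ j) * (1 + b * (a * b) ^ j)) =
      ∑ k ∈ Finset.range (2 * N + 1), qb (a * b) (2 * N) k * tt a b ((k : ℤ) - N) := by
  have key := qbinom (a * b) ((a * b) ^ N) (2 * N) a
  set Q := a * b with hQ
  have hQ0 : Q ≠ 0 := mul_ne_zero ha hb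
  have hL : ∏ j ∈ Finset.range (2 * N), (Q ^ N + a * Q ^ j) =
      (Q ^ (N * (N - 1) / 2 + N * N) * a ^ N) *
        ∏ j ∈ Finset.range N, ((1 + a * Q ^ j) * (1 + b * Q ^ j)) := by
    rw [two_mul, Finset.prod_range_add]
    have h1 : ∏ j ∈ Finset.range N, (Q ^ N + a * Q ^ j) =
       Q ^ (N * (N - 1) / 2) * a ^ N * ∏ j ∈ Finset.range N, (1 + b * Q ^ j) := by
      rw [← Finset.prod_range_reflect (fun j => 1 + b * Q ^ j), ← Finset.sum_range_id,
        ← Finset.prod_pow_eq_pow_sum]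
      have : a ^ N = ∏ j ∈ Finset.range N, a := by simp
      rw [this, ← Finset.prod_mul_distrib, ← Finset.prod_mul_distrib]
      refine Finset.prod_congr rfl fun j hj => ?_
      rw [Finset.mem_range] at hj
      obtain ⟨d, rfl⟩ : ∃ d, N = j + 1 + d := ⟨N - j - 1, by omega⟩
      rw [show j + 1 + d - 1 - j = d by omega]
      have : Q ^ (j + 1 + d) = Q ^ j * Q ^ d * (a * b) := by rw [← hQ]; ring
      rw [this]; ring
    have h2 : ∏ j ∈ Finset.range N, (Q ^ N + a * Q ^ (N + j)) =
       Q ^ (N * N) * ∏ j ∈ Finset.range N, (1 + a * Q ^ j) := by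
      have : Q ^ (N * N) = ∏ j ∈ Finset.range N, Q ^ N := by simp [pow_mul]
      rw [this, ← Finset.prod_mul_distrib]
      refine Finset.prod_congr rfl fun j hj => ?_
      ring
    rw [h1, h2, Finset.prod_mul_distrib]; ring
  have hne : Q ^ (N * (N - 1) / 2 + N * N) * a ^ N ≠ 0 :=
    mul_ne_zero (pow_ne_zero _ hQ0) (pow_ne_zero _ ha)
  apply mul_left_cancel₀ hne
  rw [← hL, key, Finset.mul_sum]
  refine Finset.sum_congr rfl fun k hk => ?_
  rw [Finset.mem_range] at hk
  have hc : ∀ k : ℕ, 2 * ((k * (k - 1) / 2 : ℕ) : ℤ) = k * (k - 1) := by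
    intro k
    have := Nat.div_mul_cancel (Nat.even_mul_pred_self k).two_dvd
    zify at this
    rcases k with _ | k
    · simp
    · simp at this ⊢; linarith
  unfold tt
  have t1 := tri_spec ((k : ℤ) - N)
  have t2 := tri_spec (-((k : ℤ) - N))
  have c1 := hc k
  have c2 := hc N
  generalize k * (k - 1) / 2 = c at *
  generalize N * (N - 1) / 2 = d at *
  generalize tri ((k : ℤ) - N) = u at *
  generalize tri (-((k : ℤ) - N)) = v at *
  have s : ((2 * N - k : ℕ) : ℤ) = 2 * N - k := by omega
  generalize 2 * N - k = w at *
  have x1 : c + N * w + k = d + N * N + N + u := by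
    zify; rw [s]; linarith
  have x2 : c + N * w = d + N * N + v := by
    zify; rw [s]; linarith
  rw [hQ]
  calc _ = qb (a * b) (2 * N) k * (a ^ (c + N * w + k) * b ^ (c + N * w)) := by
          rw [mul_pow, mul_pow]; ring
    _ = _ := by rw [x1, x2, mul_pow]; ring


lemma pq_cong (Q : ℤ⟦X⟧) (N M : ℕ) (h : N ≤ M) : ∃ c, pq Q M = pq Q N + Q ^ (N + 1) * c := by
  induction M, h using Nat.le_induction with
  | base => exact ⟨0, by simp⟩
  | succ M hM ih =>
    obtain ⟨c, hc⟩ := ih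
    obtain ⟨d, rfl⟩ := Nat.exists_eq_add_of_le hM
    refine ⟨c - Q ^ d * pq Q (N + d), ?_⟩
    have : pq Q (N + d + 1) = pq Q (N + d) * (1 - Q ^ (N + d + 1)) := by
      unfold pq; rw [Finset.prod_range_succ]
    rw [this]
    linear_combination hc

lemma pq_unit (Q : ℤ⟦X⟧) (hQ : X ∣ Q) (N : ℕ) : IsUnit (pq Q N) := by
  rw [PowerSeries.isUnit_iff_constantCoeff]
  have h0 : constantCoeff Q = 0 := X_dvd_iff.mp hQ
  simp [pq, map_prod, h0]

lemma qb_cong (Q : ℤ⟦X⟧) (hQ : X ∣ Q) (N k l : ℕ) (hk : k ≤ 2 * N) (h1 : l ≤ k) (h2 : l ≤ 2 * N - k)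
    (h3 : l ≤ N) : Q ^ (l + 1) ∣ qb Q (2 * N) k * pq Q N - 1 := by
  obtain ⟨c1, e1⟩ := pq_cong Q l k h1
  obtain ⟨c2, e2⟩ := pq_cong Q l (2 * N - k) h2
  obtain ⟨c3, e3⟩ := pq_cong Q l (2 * N) (by omega)
  obtain ⟨c4, e4⟩ := pq_cong Q l N h3
  have e := qb_pq Q (2 * N) k hk
  have hu := pq_unit Q hQ l
  rw [e1, e2, e3] at e
  rw [e4]
  generalize pq Q l = u at *
  generalize qb Q (2 * N) k = g at *
  generalize Q ^ (l + 1) = D at *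
  have : D ∣ u * (g * u - 1) :=
    ⟨c3 - g * (c1 * u + c2 * u + D * c1 * c2), by linear_combination e⟩
  rw [hu.dvd_mul_left] at this
  obtain ⟨t, ht⟩ := this
  exact ⟨t + g * c4, by linear_combination ht⟩

lemma tri_sq (n : ℤ) : ((tri n + tri (-n) : ℕ) : ℤ) = n ^ 2 := by
  have := tri_spec n
  have := tri_spec (-n)
  push_cast; nlinarith

lemma tt_dvd (a b : ℤ⟦X⟧) (ha : X ∣ a) (hb : X ∣ b) (n : ℤ) : X ^ n.natAbs ∣ tt a b n := by
  have h : X ^ (tri n + tri (-n)) ∣ tt a b n := by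
    rw [pow_add]; exact mul_dvd_mul (pow_dvd_pow_of_dvd ha _) (pow_dvd_pow_of_dvd hb _)
  refine (pow_dvd_pow _ ?_).trans h
  have := tri_sq n
  zify at *
  rw [this, ← sq_abs n]
  nlinarith [abs_nonneg n, Int.one_le_abs (z := n), sq_nonneg (|n| - 1), Int.le_self_sq |n|]

lemma jtp_cong (a b : ℤ⟦X⟧) (ha0 : a ≠ 0) (hb0 : b ≠ 0) (ha : X ∣ a) (hb : X ∣ b) (N : ℕ) :
    X ^ (N + 1) ∣ (∏ j ∈ Finset.range N, ((1 + a * (a * b) ^ j) * (1 + b * (a * b) ^ j))) * pq (a * b) N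
      - ∑ n ∈ Finset.Icc (-N : ℤ) N, tt a b n := by
  have hs : ∑ n ∈ Finset.Icc (-N : ℤ) N, tt a b n =
      ∑ k ∈ Finset.range (2 * N + 1), tt a b ((k : ℤ) - N) := by
    symm
    refine Finset.sum_bij (fun k _ => (k : ℤ) - N) ?_ ?_ ?_ ?_
    · intro k hk; simp at *; omega
    · intro k _ k' _ h; simpa using h
    · intro n hn; simp at hn; exact ⟨(n + N).toNat, by simp; omega, by simp; omega⟩
    · intros; rfl
  rw [jtp_fin a b ha0 hb0, hs, Finset.sum_mul, ← Finset.sum_sub_distrib]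
  refine Finset.dvd_sum fun k hk => ?_
  rw [Finset.mem_range] at hk
  have hQ : X ∣ a * b := ha.mul_right b
  have h1 := qb_cong (a * b) hQ N k (N - ((k : ℤ) - N).natAbs) (by omega) (by omega) (by omega) (by omega)
  have h2 := mul_dvd_mul ((pow_dvd_pow_of_dvd hQ _).trans h1) (tt_dvd a b ha hb ((k : ℤ) - N))
  rw [← pow_add] at h2
  have h3 := (pow_dvd_pow X (by omega : N + 1 ≤ (N - ((k : ℤ) - N).natAbs + 1) + ((k : ℤ) - N).natAbs)).trans h2
  convert h3 using 1
  ring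

lemma tt_summable (a b : ℤ⟦X⟧) (ha : X ∣ a) (hb : X ∣ b) : Summable (tt a b) := by
  rw [summable_iff_summable_coeff]
  intro d
  refine summable_of_hasFiniteSupport ((Set.finite_Icc (-(d:ℤ)) d).subset ?_)
  intro n hn
  by_contra hc
  apply hn
  have := X_pow_dvd_iff.mp (tt_dvd a b ha hb n) d
  apply this
  simp at hc; omega

lemma jtp_lim (a b W : ℤ⟦X⟧) (ha0 : a ≠ 0) (hb0 : b ≠ 0) (ha : X ∣ a) (hb : X ∣ b)
    (hW : Tendsto (fun N => (∏ j ∈ Finset.range N, ((1 + a * (a * b) ^ j) * (1 + b * (a * b) ^ j)))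
      * pq (a * b) N) atTop (𝓝 W)) : HasSum (tt a b) W := by
  obtain ⟨S, hS⟩ := tt_summable a b ha hb
  have hI : Tendsto (fun N : ℕ => Finset.Icc (-N : ℤ) N) atTop atTop := by
    apply tendsto_atTop_finset_of_monotone
    · intro m n h; apply Finset.Icc_subset_Icc <;> omega
    · intro x; exact ⟨x.natAbs, by rw [Finset.mem_Icc]; omega⟩
  have h1 : Tendsto (fun N : ℕ => ∑ n ∈ Finset.Icc (-N : ℤ) N, tt a b n) atTop (𝓝 S) := hS.comp hI
  have h2 := hW.sub h1
  have h3 : Tendsto (fun N : ℕ => (∏ j ∈ Finset.range N, ((1 + a * (a * b) ^ j) * (1 + b * (a * b) ^ j)))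
      * pq (a * b) N - ∑ n ∈ Finset.Icc (-N : ℤ) N, tt a b n) atTop (𝓝 0) := by
    rw [tendsto_iff_coeff_tendsto]
    intro d
    refine tendsto_atTop_of_eventually_const (i₀ := d) fun N hN => ?_
    rw [X_pow_dvd_iff.mp (jtp_cong a b ha0 hb0 ha hb N) d (by omega)]; simp
  have := tendsto_nhds_unique h2 h3
  rw [sub_eq_zero] at this
  rwa [this]

/-- infinite product -/
noncomputable def Pg (a Q : ℤ⟦X⟧) : ℤ⟦X⟧ := ∏' j : ℕ, (1 + a * Q ^ j)

lemma Pg_mult (a Q : ℤ⟦X⟧) (hQ : X ∣ Q) : Multipliable (fun j : ℕ => 1 + a * Q ^ j) := by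
  apply multipliable_one_add_of_tendsto_order_atTop_nhds_top
  refine ENat.tendsto_nhds_top_iff_natCast_lt.mpr (fun n ↦ Filter.eventually_atTop.mpr ⟨n + 1, ?_⟩)
  intro m hm
  have : (m : ℕ∞) ≤ (a * Q ^ m).order := by
    exact PowerSeries.nat_le_order _ _ (X_pow_dvd_iff.mp ((pow_dvd_pow_of_dvd hQ m).mul_left a))
  refine lt_of_lt_of_le ?_ this
  exact_mod_cast hm

lemma Pg_tendsto (a Q : ℤ⟦X⟧) (hQ : X ∣ Q) :
    Tendsto (fun N => ∏ j ∈ Finset.range N, (1 + a * Q ^ j)) atTop (𝓝 (Pg a Q)) :=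
  (Pg_mult a Q hQ).hasProd.tendsto_prod_nat

lemma Pg_ne (a Q : ℤ⟦X⟧) (hQ : X ∣ Q) (ha : X ∣ a) : Pg a Q ≠ 0 := by
  intro h
  have h1 := congrArg constantCoeff h
  unfold Pg at h1
  rw [(Pg_mult a Q hQ).map_tprod _ (continuous_constantCoeff ℤ)] at h1
  simp [X_dvd_iff.mp ha] at h1

lemma jtp (a b : ℤ⟦X⟧) (ha0 : a ≠ 0) (hb0 : b ≠ 0) (ha : X ∣ a) (hb : X ∣ b) :
    HasSum (tt a b) (Pg a (a * b) * Pg b (a * b) * Pg (-(a * b)) (a * b)) := by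
  have hQ : X ∣ a * b := ha.mul_right b
  apply jtp_lim a b _ ha0 hb0 ha hb
  refine (((Pg_tendsto a _ hQ).mul (Pg_tendsto b _ hQ)).mul (Pg_tendsto _ _ hQ)).congr fun N => ?_
  unfold pq
  rw [Finset.prod_mul_distrib]
  refine congrArg₂ (· * ·) rfl ?_
  refine Finset.prod_congr rfl fun j _ => by ring

lemma Pg_two (a Q : ℤ⟦X⟧) (hQ : X ∣ Q) : Pg a Q = Pg a (Q ^ 2) * Pg (a * Q) (Q ^ 2) := by
  have hQ2 : X ∣ Q ^ 2 := hQ.trans (dvd_pow_self _ (by norm_num))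
  have h1 := (Pg_tendsto a Q hQ).comp (tendsto_id.const_mul_atTop' (by norm_num : 0 < 2))
  refine tendsto_nhds_unique h1 (((Pg_tendsto a _ hQ2).mul (Pg_tendsto (a * Q) _ hQ2)).congr fun N => ?_)
  simp only [Function.comp, id]
  induction N with
  | zero => simp
  | succ N ih =>
    rw [mul_add, mul_one, Finset.prod_range_succ, Finset.prod_range_succ, Finset.prod_range_succ,
      Finset.prod_range_succ, ← ih]
    ring

lemma Pg_three (a Q : ℤ⟦X⟧) (hQ : X ∣ Q) :
    Pg a Q = Pg a (Q ^ 3) * Pg (a * Q) (Q ^ 3) * Pg (a * Q ^ 2) (Q ^ 3) := by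
  have hQ2 : X ∣ Q ^ 3 := hQ.trans (dvd_pow_self _ (by norm_num))
  have h1 := (Pg_tendsto a Q hQ).comp (tendsto_id.const_mul_atTop' (by norm_num : 0 < 3))
  refine tendsto_nhds_unique h1 ((((Pg_tendsto a _ hQ2).mul (Pg_tendsto (a * Q) _ hQ2)).mul
    (Pg_tendsto (a * Q ^ 2) _ hQ2)).congr fun N => ?_)
  simp only [Function.comp, id]
  induction N with
  | zero => simp
  | succ N ih =>
    rw [mul_add, mul_one, Finset.prod_range_succ, Finset.prod_range_succ, Finset.prod_range_succ,
      Finset.prod_range_succ, Finset.prod_range_succ, Finset.prod_range_succ, ← ih]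
    ring

lemma Pg_sq (a Q : ℤ⟦X⟧) (hQ : X ∣ Q) : Pg a Q * Pg (-a) Q = Pg (-a ^ 2) (Q ^ 2) := by
  have hQ2 : X ∣ Q ^ 2 := hQ.trans (dvd_pow_self _ (by norm_num))
  refine tendsto_nhds_unique ((Pg_tendsto a Q hQ).mul (Pg_tendsto (-a) Q hQ))
    ((Pg_tendsto _ _ hQ2).congr fun N => ?_)
  rw [← Finset.prod_mul_distrib]
  refine Finset.prod_congr rfl fun j _ => by ring


/-- Ramanujan theta function in product form -/
noncomputable def th (a b : ℤ⟦X⟧) : ℤ⟦X⟧ := Pg a (a * b) * Pg b (a * b) * Pg (-(a * b)) (a * b)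

lemma hX (n : ℕ) (h : n ≠ 0 := by norm_num) : (X : ℤ⟦X⟧) ∣ X ^ n := dvd_pow_self _ h

lemma hXn (n : ℕ) (h : n ≠ 0 := by norm_num) : (X : ℤ⟦X⟧) ∣ -X ^ n := (hX n h).neg_right

lemma Pg_sq' (r m : ℕ) (h : m ≠ 0 := by norm_num) :
    Pg (X ^ r) (X ^ m) * Pg (-X ^ r) (X ^ m) = Pg (-X ^ (r * 2)) (X ^ (m * 2)) := by
  rw [Pg_sq _ _ (hX m h), pow_mul, pow_mul]

lemma Pg_two' (r m : ℕ) (h : m ≠ 0 := by norm_num) :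
    Pg (X ^ r) (X ^ m) = Pg (X ^ r) (X ^ (m * 2)) * Pg (X ^ (r + m)) (X ^ (m * 2)) := by
  rw [Pg_two _ _ (hX m h), pow_mul, pow_add]

lemma Pg_two'' (r m : ℕ) (h : m ≠ 0 := by norm_num) :
    Pg (-X ^ r) (X ^ m) = Pg (-X ^ r) (X ^ (m * 2)) * Pg (-X ^ (r + m)) (X ^ (m * 2)) := by
  rw [Pg_two _ _ (hX m h), pow_mul, pow_add, neg_mul]

lemma Pg_three' (r m : ℕ) (h : m ≠ 0 := by norm_num) :
    Pg (X ^ r) (X ^ m) = Pg (X ^ r) (X ^ (m * 3)) * Pg (X ^ (r + m)) (X ^ (m * 3))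
      * Pg (X ^ (r + m * 2)) (X ^ (m * 3)) := by
  rw [Pg_three _ _ (hX m h), pow_mul, pow_add, pow_add, pow_mul]

lemma Pg_three'' (r m : ℕ) (h : m ≠ 0 := by norm_num) :
    Pg (-X ^ r) (X ^ m) = Pg (-X ^ r) (X ^ (m * 3)) * Pg (-X ^ (r + m)) (X ^ (m * 3))
      * Pg (-X ^ (r + m * 2)) (X ^ (m * 3)) := by
  rw [Pg_three _ _ (hX m h), pow_mul, pow_add, pow_add, pow_mul, neg_mul, neg_mul]

lemma Pg_alt (r m : ℕ) (h : m ≠ 0 := by norm_num) :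
    Pg (X ^ r) (-X ^ m) = Pg (X ^ r) (X ^ (m * 2)) * Pg (-X ^ (r + m)) (X ^ (m * 2)) := by
  rw [Pg_two _ _ (hXn m h), pow_mul, pow_add, mul_neg, neg_sq]

lemma Pg_alt' (r m : ℕ) (h : m ≠ 0 := by norm_num) :
    Pg (-X ^ r) (-X ^ m) = Pg (-X ^ r) (X ^ (m * 2)) * Pg (X ^ (r + m)) (X ^ (m * 2)) := by
  rw [Pg_two _ _ (hXn m h), pow_mul, pow_add, mul_neg, neg_mul, neg_neg, neg_sq]

lemma th_pp (r s : ℕ) : th (X ^ r) (X ^ s) =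
    Pg (X ^ r) (X ^ (r + s)) * Pg (X ^ s) (X ^ (r + s)) * Pg (-X ^ (r + s)) (X ^ (r + s)) := by
  rw [th, ← pow_add]

lemma th_nn (r s : ℕ) : th (-X ^ r) (-X ^ s) =
    Pg (-X ^ r) (X ^ (r + s)) * Pg (-X ^ s) (X ^ (r + s)) * Pg (-X ^ (r + s)) (X ^ (r + s)) := by
  rw [th, neg_mul_neg, ← pow_add]

lemma th_pn (r s : ℕ) : th (X ^ r) (-X ^ s) =
    Pg (X ^ r) (-X ^ (r + s)) * Pg (-X ^ s) (-X ^ (r + s)) * Pg (X ^ (r + s)) (-X ^ (r + s)) := by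
  rw [th, mul_neg, ← pow_add, neg_neg]

lemma th_np (r s : ℕ) : th (-X ^ r) (X ^ s) =
    Pg (-X ^ r) (-X ^ (r + s)) * Pg (X ^ s) (-X ^ (r + s)) * Pg (X ^ (r + s)) (-X ^ (r + s)) := by
  rw [th, neg_mul, ← pow_add, neg_neg]

lemma id1_s11 : th (X ^ 1) (X ^ 1) * th (-X ^ 1) (X ^ 2) = th (X ^ 3) (X ^ 3) * th (X ^ 1) (-X ^ 2) := by
  rw [th_pp, th_np, th_pp, th_pn]
  norm_num only
  have a1 := Pg_three' 1 2
  have a2 := Pg_three'' 2 2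
  have a3 := Pg_alt' 1 3
  have a4 := Pg_alt 2 3
  have a5 := Pg_alt 3 3
  have a6 := Pg_alt 1 3
  have a7 := Pg_alt' 2 3
  have b1 := Pg_sq' 1 6
  have b2 := Pg_sq' 2 6
  have b3 := Pg_sq' 4 6
  have b4 := Pg_sq' 5 6
  have c1 := Pg_two'' 2 6
  have c2 := Pg_two'' 4 6
  norm_num only at a1 a2 a3 a4 a5 a6 a7 b1 b2 b3 b4 c1 c2
  have hz4 : Pg (-X ^ 4) (X ^ 12) ≠ 0 := Pg_ne _ _ (hX 12) (hXn 4)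
  have hz8 : Pg (-X ^ 8) (X ^ 12) ≠ 0 := Pg_ne _ _ (hX 12) (hXn 8)
  rw [a1, a2, a3, a4, a5, a6, a7]
  clear a1 a2 a3 a4 a5 a6 a7
  generalize Pg (X ^ 1) (X ^ 6) = n1 at *
  generalize Pg (X ^ 2) (X ^ 6) = n2 at *
  generalize Pg (X ^ 3) (X ^ 6) = n3 at *
  generalize Pg (X ^ 4) (X ^ 6) = n4 at *
  generalize Pg (X ^ 5) (X ^ 6) = n5 at *
  generalize Pg (-X ^ 1) (X ^ 6) = q1 at *
  generalize Pg (-X ^ 2) (X ^ 6) = q2 at *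
  generalize Pg (-X ^ 4) (X ^ 6) = q4 at *
  generalize Pg (-X ^ 5) (X ^ 6) = q5 at *
  generalize Pg (-X ^ 6) (X ^ 6) = q6 at *
  generalize Pg (-X ^ 2) (X ^ 12) = z2 at *
  generalize Pg (-X ^ 4) (X ^ 12) = z4 at *
  generalize Pg (-X ^ 8) (X ^ 12) = z8 at *
  generalize Pg (-X ^ 10) (X ^ 12) = z10 at *
  have key : n1 * q1 * (n5 * q5) * (n2 * n4) = 1 := by
    apply mul_left_cancel₀ (mul_ne_zero hz4 hz8)
    rw [b1, b4]
    calc _ = (n2 * (z2 * z8)) * (n4 * (z4 * z10)) := by ring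
      _ = (n2 * q2) * (n4 * q4) := by rw [c1, c2]
      _ = _ := by rw [b2, b3]; ring
  linear_combination (n1 * n3 ^ 3 * n5 * q2 * q4 * q6 ^ 2) * key

lemma id2_s11 : th (X ^ 1) (X ^ 3) * th (X ^ 1) (X ^ 1) * (th (-X ^ 5) (-X ^ 7) * th (-X ^ 11) (-X ^ 1)) =
    th (X ^ 3) (X ^ 9) * th (X ^ 6) (X ^ 18) * th (X ^ 1) (-X ^ 2) ^ 2 := by
  simp only [th_pp, th_nn, th_pn]
  norm_num only
  have a1 := Pg_two' 1 2
  have a1' := Pg_three' 1 2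
  have a2 := Pg_three'' 2 2
  have a3 := Pg_three'' 4 4
  have a4 := Pg_two' 3 6
  have a5 := Pg_alt 3 3
  have a6 := Pg_alt 1 3
  have a7 := Pg_alt' 2 3
  have a8 := Pg_two' 6 12
  have b1 := Pg_sq' 1 6
  have b2 := Pg_sq' 5 6
  have b3 := Pg_sq' 6 12
  have c1 := Pg_two'' 2 6
  have c2 := Pg_two'' 4 6
  have c3 := Pg_two'' 1 6
  have c4 := Pg_two'' 5 6
  have c5 := Pg_two'' 6 6
  have c6 := Pg_two'' 12 12
  norm_num only at a1 a1' a2 a3 a4 a5 a6 a7 a8 b1 b2 b3 c1 c2 c3 c4 c5 c6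
  rw [← a1, a2, a3, a5, a6, a7, ← a4, ← a8, a1']
  clear a1 a1' a2 a3 a4 a5 a6 a7 a8
  generalize Pg (X ^ 1) (X ^ 6) = n1 at *
  generalize Pg (X ^ 3) (X ^ 6) = n3 at *
  generalize Pg (X ^ 5) (X ^ 6) = n5 at *
  generalize Pg (-X ^ 1) (X ^ 6) = q1 at *
  generalize Pg (-X ^ 2) (X ^ 6) = q2 at *
  generalize Pg (-X ^ 4) (X ^ 6) = q4 at *
  generalize Pg (-X ^ 5) (X ^ 6) = q5 at *
  generalize Pg (-X ^ 6) (X ^ 6) = q6 at *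
  generalize Pg (-X ^ 1) (X ^ 12) = z1 at *
  generalize Pg (-X ^ 2) (X ^ 12) = z2 at *
  generalize Pg (-X ^ 4) (X ^ 12) = z4 at *
  generalize Pg (-X ^ 5) (X ^ 12) = z5 at *
  generalize Pg (-X ^ 6) (X ^ 12) = z6 at *
  generalize Pg (-X ^ 7) (X ^ 12) = z7 at *
  generalize Pg (-X ^ 8) (X ^ 12) = z8 at *
  generalize Pg (-X ^ 10) (X ^ 12) = z10 at *
  generalize Pg (-X ^ 11) (X ^ 12) = z11 at *
  generalize Pg (-X ^ 12) (X ^ 12) = z12 at *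
  generalize Pg (X ^ 6) (X ^ 12) = m6 at *
  generalize Pg (-X ^ 12) (X ^ 24) = w12 at *
  generalize Pg (-X ^ 24) (X ^ 24) = w24 at *
  set K := n1 ^ 2 * n3 ^ 3 * n5 ^ 2 * q2 * q4 * q6 with hK
  calc _ = K * ((n1 * (z1 * z7)) * (n5 * (z5 * z11))) * z4 * z8 * z12 ^ 3 := by rw [hK]; ring
    _ = K * (z2 * z10) * z4 * z8 * z12 ^ 2 * (w12 * w24) := by rw [← c3, ← c4, b1, b2, ← c6]; ring
    _ = K * (z2 * z8) * (z4 * z10) * (z6 * z12) * z12 * (m6 * w24) := by rw [← b3]; ring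
    _ = _ := by rw [← c1, ← c2, ← c5, hK]; ring


lemma int_even_odd {f : ℤ → ℤ⟦X⟧} {m m' : ℤ⟦X⟧} (he : HasSum (fun k : ℤ ↦ f (2 * k)) m)
    (ho : HasSum (fun k : ℤ ↦ f (2 * k + 1)) m') : HasSum f (m + m') := by
  have := mul_right_injective₀ (two_ne_zero' ℤ)
  replace ho := ((add_left_injective 1).comp this).hasSum_range_iff.2 ho
  refine (this.hasSum_range_iff.2 he).add_isCompl ?_ ho
  simpa [Function.comp_def] using Int.isCompl_even_odd

lemma Xne (n : ℕ) : (X : ℤ⟦X⟧) ^ n ≠ 0 := pow_ne_zero _ X_ne_zero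

lemma th_sum (a b : ℤ⟦X⟧) (ha0 : a ≠ 0) (hb0 : b ≠ 0) (ha : X ∣ a) (hb : X ∣ b) :
    HasSum (tt a b) (th a b) := jtp a b ha0 hb0 ha hb

lemma th_sum_pp (r s : ℕ) (hr : r ≠ 0 := by norm_num) (hs : s ≠ 0 := by norm_num) :
    HasSum (fun n : ℤ => (X : ℤ⟦X⟧) ^ (r * tri n + s * tri (-n))) (th (X ^ r) (X ^ s)) := by
  refine (th_sum _ _ (Xne r) (Xne s) (hX r hr) (hX s hs)).congr_fun ?_
  intro n; rw [tt, ← pow_mul, ← pow_mul, pow_add]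

lemma th_sum_nn (r s : ℕ) (hr : r ≠ 0 := by norm_num) (hs : s ≠ 0 := by norm_num) :
    HasSum (fun n : ℤ => (-1) ^ (tri n + tri (-n)) * (X : ℤ⟦X⟧) ^ (r * tri n + s * tri (-n)))
      (th (-X ^ r) (-X ^ s)) := by
  refine (th_sum _ _ (neg_ne_zero.2 (Xne r)) (neg_ne_zero.2 (Xne s)) (hXn r hr) (hXn s hs)).congr_fun ?_
  intro n; rw [tt, neg_pow (X ^ r), neg_pow (X ^ s), ← pow_mul, ← pow_mul, pow_add, pow_add]; ring

lemma th_sum_pn (r s : ℕ) (hr : r ≠ 0 := by norm_num) (hs : s ≠ 0 := by norm_num) :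
    HasSum (fun n : ℤ => (-1) ^ (tri (-n)) * (X : ℤ⟦X⟧) ^ (r * tri n + s * tri (-n)))
      (th (X ^ r) (-X ^ s)) := by
  refine (th_sum _ _ (Xne r) (neg_ne_zero.2 (Xne s)) (hX r hr) (hXn s hs)).congr_fun ?_
  intro n; rw [tt, neg_pow (X ^ s), ← pow_mul, ← pow_mul, pow_add]; ring

lemma th_sum_np (r s : ℕ) (hr : r ≠ 0 := by norm_num) (hs : s ≠ 0 := by norm_num) :
    HasSum (fun n : ℤ => (-1) ^ (tri n) * (X : ℤ⟦X⟧) ^ (r * tri n + s * tri (-n)))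
      (th (-X ^ r) (X ^ s)) := by
  refine (th_sum _ _ (neg_ne_zero.2 (Xne r)) (Xne s) (hXn r hr) (hX s hs)).congr_fun ?_
  intro n; rw [tt, neg_pow (X ^ r), ← pow_mul, ← pow_mul, pow_add]; ring

lemma sgn {m n : ℕ} (k : ℤ) (h : (m : ℤ) = n + 2 * k) : (-1 : ℤ⟦X⟧) ^ m = (-1) ^ n := by
  rw [neg_one_pow_eq_pow_mod_two, neg_one_pow_eq_pow_mod_two (n := n)]
  congr 1; omega

lemma U_eq : th (X ^ 1) (-X ^ 2) = th (-X ^ 5) (-X ^ 7) + X * th (-X ^ 11) (-X ^ 1) := by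
  refine (th_sum_pn 1 2).unique (int_even_odd ?_ ?_)
  · refine (th_sum_nn 5 7).congr_fun fun k => ?_
    have h1 := tri_spec k
    have h2 := tri_spec (-k)
    have h3 := tri_spec (2 * k)
    have h4 := tri_spec (-(2 * k))
    refine congrArg₂ (· * ·) (sgn (k ^ 2 - tri k) ?_) (congrArg _ ?_)
    · push_cast; nlinarith
    · zify; nlinarith
  · refine ((th_sum_nn 11 1).mul_left X).congr_fun fun k => ?_
    have h1 := tri_spec k
    have h2 := tri_spec (-k)
    have h3 := tri_spec (2 * k + 1)
    have h4 := tri_spec (-(2 * k + 1))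
    rw [mul_left_comm, ← pow_succ']
    refine congrArg₂ (· * ·) (sgn (tri k) ?_) (congrArg _ ?_)
    · push_cast; nlinarith
    · zify; nlinarith

lemma V_eq : th (-X ^ 1) (X ^ 2) = th (-X ^ 5) (-X ^ 7) - X * th (-X ^ 11) (-X ^ 1) := by
  rw [sub_eq_add_neg]
  refine (th_sum_np 1 2).unique (int_even_odd ?_ ?_)
  · refine (th_sum_nn 5 7).congr_fun fun k => ?_
    have h1 := tri_spec k
    have h2 := tri_spec (-k)
    have h3 := tri_spec (2 * k)
    have h4 := tri_spec (-(2 * k))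
    refine congrArg₂ (· * ·) (sgn (tri k) ?_) (congrArg _ ?_)
    · push_cast; nlinarith
    · zify; nlinarith
  · refine ((th_sum_nn 11 1).mul_left X).neg.congr_fun fun k => ?_
    have h1 := tri_spec k
    have h2 := tri_spec (-k)
    have h3 := tri_spec (2 * k + 1)
    have h4 := tri_spec (-(2 * k + 1))
    rw [mul_left_comm, ← pow_succ', ← neg_mul, ← neg_one_mul ((-1 : ℤ⟦X⟧) ^ _), ← pow_succ']
    refine congrArg₂ (· * ·) (sgn (tri k + k) ?_) (congrArg _ ?_)
    · push_cast; nlinarith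
    · zify; nlinarith

lemma main_ps : th (X ^ 1) (X ^ 3) * th (X ^ 1) (X ^ 1) ^ 2 = th (X ^ 1) (X ^ 3) * th (X ^ 3) (X ^ 3) ^ 2
    + 4 * X * th (X ^ 1) (X ^ 1) * th (X ^ 3) (X ^ 9) * th (X ^ 6) (X ^ 18) := by
  have h1 := id1_s11
  have h2 := id2_s11
  have hU : th (X ^ 1) (-X ^ 2) ≠ 0 := by
    have hq : (X : ℤ⟦X⟧) ∣ -X ^ (1 + 2) := hXn (1 + 2)
    rw [th_pn]
    exact mul_ne_zero (mul_ne_zero (Pg_ne _ _ hq (hX 1)) (Pg_ne _ _ hq (hXn 2))) (Pg_ne _ _ hq (hX (1 + 2)))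
  have hu := U_eq
  have hv := V_eq
  generalize th (X ^ 1) (-X ^ 2) = U at *
  generalize th (-X ^ 1) (X ^ 2) = V at *
  generalize th (-X ^ 5) (-X ^ 7) = S at *
  generalize th (-X ^ 11) (-X ^ 1) = T at *
  generalize th (X ^ 1) (X ^ 3) = a at *
  generalize th (X ^ 3) (X ^ 9) = b at *
  generalize th (X ^ 6) (X ^ 18) = d at *
  generalize th (X ^ 1) (X ^ 1) = A at *
  generalize th (X ^ 3) (X ^ 3) = B at *
  apply mul_left_cancel₀ (pow_ne_zero 2 hU)
  have h3 : U ^ 2 - V ^ 2 = 4 * X * (S * T) := by rw [hu, hv]; ring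
  linear_combination a * (A * V + B * U) * h1 + a * A ^ 2 * h3 + 4 * X * A * h2

lemma psi_sum (r : ℕ) (hr : r ≠ 0 := by norm_num) :
    HasSum (fun m : ℤ => (X : ℤ⟦X⟧) ^ (r * tri m)) (2 * th (X ^ r) (X ^ (r * 3))) := by
  have h := th_sum_pp r (r * 3) hr (by omega)
  rw [two_mul]
  apply int_even_odd
  · have h' := (Equiv.neg ℤ).hasSum_iff.2 h
    refine h'.congr_fun fun k => congrArg _ ?_
    have h1 := tri_spec k
    have h2 := tri_spec (-k)
    have h3 := tri_spec (2 * k)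
    simp only [Equiv.neg_apply, neg_neg]
    rw [mul_assoc, ← mul_add]; congr 1
    zify; nlinarith
  · have h' := (Equiv.addRight (1 : ℤ)).hasSum_iff.2 h
    refine h'.congr_fun fun k => congrArg _ ?_
    simp only [Equiv.coe_addRight]
    have h1 := tri_spec (k + 1)
    have h2 := tri_spec (-(k + 1))
    have h3 := tri_spec (2 * k + 1)
    rw [mul_assoc, ← mul_add]; congr 1
    zify; nlinarith

lemma phi_sum (r : ℕ) (hr : r ≠ 0 := by norm_num) :
    HasSum (fun m : ℤ => (X : ℤ⟦X⟧) ^ (r * m.natAbs ^ 2)) (th (X ^ r) (X ^ r)) := by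
  refine (th_sum_pp r r hr hr).congr_fun fun k => congrArg _ ?_
  have := tri_sq k
  rw [← mul_add]; congr 1
  zify; rw [sq_abs]; push_cast at this; exact this.symm

lemma fin_le {ι : Type*} (e : ι → ℕ) (h : Summable (fun i => (X : ℤ⟦X⟧) ^ e i)) (n : ℕ) :
    {i | e i ≤ n}.Finite := by
  rw [summable_iff_summable_coeff] at h
  have : {i | e i ≤ n} ⊆ ⋃ k ∈ Set.Iic n, {i | e i = k} := by
    intro i hi; simpa using hi
  refine Set.Finite.subset ((Set.finite_Iic n).biUnion fun k _ => ?_) this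
  refine Set.Finite.subset ((h k).hasFiniteSupport_of_discreteTopology) ?_
  intro i hi
  simp at hi
  simp [coeff_X_pow, hi]

lemma prod_sum {ι κ : Type*} (e : ι → ℕ) (e' : κ → ℕ) (F G : ℤ⟦X⟧)
    (hF : HasSum (fun i => (X : ℤ⟦X⟧) ^ e i) F) (hG : HasSum (fun i => (X : ℤ⟦X⟧) ^ e' i) G) :
    HasSum (fun p : ι × κ => (X : ℤ⟦X⟧) ^ (e p.1 + e' p.2)) (F * G) := by
  have hs : Summable (fun p : ι × κ => (X : ℤ⟦X⟧) ^ e p.1 * X ^ e' p.2) := by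
    rw [summable_iff_summable_coeff]
    intro n
    refine summable_of_hasFiniteSupport
      (((fin_le e hF.summable n).prod (fin_le e' hG.summable n)).subset ?_)
    intro p hp
    simp only [← pow_add, Function.mem_support, coeff_X_pow] at hp
    simp only [Set.mem_prod, Set.mem_ofPred_eq]
    split_ifs at hp
    · omega
    · simp at hp
  simpa only [pow_add] using hF.mul hG hs

lemma count {ι : Type*} (e : ι → ℕ) (F : ℤ⟦X⟧)
    (hF : HasSum (fun i => (X : ℤ⟦X⟧) ^ e i) F) (n : ℕ) : coeff n F = ({i | e i = n}.ncard : ℤ) := by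
  have hfin : {i | e i = n}.Finite := (fin_le e hF.summable n).subset fun i (hi : e i = n) => hi.le
  rw [hasSum_iff_hasSum_coeff] at hF
  have h := hF n
  have h2 : HasSum (fun i => coeff n ((X : ℤ⟦X⟧) ^ e i)) (∑ i ∈ hfin.toFinset, coeff n ((X : ℤ⟦X⟧) ^ e i)) := by
    apply hasSum_sum_of_ne_finset_zero
    intro i hi
    rw [Set.Finite.mem_toFinset] at hi
    rw [coeff_X_pow, if_neg]
    exact fun h => hi h.symm
  refine (h.unique h2).trans ?_
  rw [Set.ncard_eq_toFinset_card _ hfin, Finset.sum_congr rfl (g := fun _ => (1 : ℤ))]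
  · simp
  · intro i hi
    rw [Set.Finite.mem_toFinset] at hi
    rw [coeff_X_pow, if_pos (Eq.symm hi)]

lemma one_sum : HasSum (fun _ : Unit => (X : ℤ⟦X⟧) ^ 1) X := by
  simpa using hasSum_unique (fun _ : Unit => (X : ℤ⟦X⟧) ^ 1)

lemma odd_sq (x : ℤ) (hx : x % 2 = 1) : ∃ m, x = 2 * m + 1 := ⟨x / 2, by omega⟩

lemma rep1 (M N : ℤ) (n : ℕ) (hn : (n : ℤ) = N) (hM : M = 8 * N + 1) :
    (rep 1 8 8 0 0 0 M : ℤ) = coeff n (2 * th (X ^ 1) (X ^ 3) * (th (X ^ 1) (X ^ 1) * th (X ^ 1) (X ^ 1))) := by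
  rw [count _ _ (prod_sum _ _ _ _ (psi_sum 1) (prod_sum _ _ _ _ (phi_sum 1) (phi_sum 1))) n]
  norm_cast
  unfold rep
  symm
  refine Set.ncard_congr (fun p _ => (2 * p.1 + 1, p.2.1, p.2.2)) ?_ ?_ ?_
  · rintro ⟨m, y, z⟩ h
    simp only [Set.mem_ofPred_eq] at h ⊢
    have := tri_spec m
    zify at h
    simp only [sq_abs] at h
    subst hM; rw [← hn, ← h]; linarith
  · rintro ⟨m, y, z⟩ ⟨m', y', z'⟩ _ _ h
    simp only [Prod.mk.injEq] at h ⊢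
    omega
  · rintro ⟨x, y, z⟩ h
    simp only [Set.mem_ofPred_eq] at h
    have hx : x % 2 = 1 := by
      rcases Int.emod_two_eq_zero_or_one x with h0 | h0
      · exfalso
        obtain ⟨w, rfl⟩ : ∃ w, x = 2 * w := ⟨x / 2, by omega⟩
        ring_nf at h; omega
      · exact h0
    obtain ⟨m, rfl⟩ := odd_sq x hx
    refine ⟨(m, y, z), ?_, rfl⟩
    simp only [Set.mem_ofPred_eq]
    have := tri_spec m
    zify
    simp only [sq_abs]
    linarith

lemma rep2 (M N : ℤ) (n : ℕ) (hn : (n : ℤ) = N) (hM : M = 8 * N + 1) :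
    (rep 1 6 6 0 0 0 M : ℤ) = coeff n (2 * th (X ^ 1) (X ^ 3) * (th (X ^ 3) (X ^ 3) * th (X ^ 3) (X ^ 3))) := by
  rw [count _ _ (prod_sum _ _ _ _ (psi_sum 1) (prod_sum _ _ _ _ (phi_sum 3) (phi_sum 3))) n]
  norm_cast
  unfold rep
  symm
  refine Set.ncard_congr (fun p _ => (2 * p.1 + 1, 2 * p.2.1, 2 * p.2.2)) ?_ ?_ ?_
  · rintro ⟨m, y, z⟩ h
    simp only [Set.mem_ofPred_eq] at h ⊢
    have := tri_spec m
    zify at h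
    simp only [sq_abs] at h
    subst hM; rw [← hn, ← h]; linarith
  · rintro ⟨m, y, z⟩ ⟨m', y', z'⟩ _ _ h
    simp only [Prod.mk.injEq] at h ⊢
    omega
  · rintro ⟨x, y, z⟩ h
    simp only [Set.mem_ofPred_eq] at h
    have hx : x % 2 = 1 := by
      rcases Int.emod_two_eq_zero_or_one x with h0 | h0
      · exfalso
        obtain ⟨w, rfl⟩ : ∃ w, x = 2 * w := ⟨x / 2, by omega⟩
        ring_nf at h; omega
      · exact h0
    obtain ⟨m, rfl⟩ := odd_sq x hx
    have := tri_spec m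
    have h4 : (y ^ 2 + z ^ 2) % 4 = 0 := by
      have : 8 * N = 8 * (tri m : ℤ) + 6 * (y ^ 2 + z ^ 2) := by linarith
      omega
    have hyz : y % 2 = 0 ∧ z % 2 = 0 := by
      obtain ⟨u, hu⟩ : ∃ u, y = 2 * u + y % 2 := ⟨y / 2, by omega⟩
      obtain ⟨v, hv⟩ : ∃ v, z = 2 * v + z % 2 := ⟨z / 2, by omega⟩
      rcases Int.emod_two_eq_zero_or_one y with h0 | h0 <;>
      rcases Int.emod_two_eq_zero_or_one z with h1 | h1 <;> rw [h0] at hu <;> rw [h1] at hv <;>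
        (rw [hu, hv] at h4; ring_nf at h4; omega)
    obtain ⟨u, rfl⟩ : ∃ u, y = 2 * u := ⟨y / 2, by omega⟩
    obtain ⟨v, rfl⟩ : ∃ v, z = 2 * v := ⟨z / 2, by omega⟩
    refine ⟨(m, u, v), ?_, rfl⟩
    simp only [Set.mem_ofPred_eq]
    zify
    simp only [sq_abs]
    linarith

lemma rep3 (M N : ℤ) (n : ℕ) (hn : (n : ℤ) = N) (hM : M = 8 * N + 1) :
    (rep 2 3 6 0 0 0 M : ℤ) = coeff n (th (X ^ 1) (X ^ 1) *
      (2 * th (X ^ 3) (X ^ 9) * (2 * th (X ^ 6) (X ^ 18) * X))) := by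
  rw [count _ _ (prod_sum _ _ _ _ (phi_sum 1) (prod_sum _ _ _ _ (psi_sum 3)
    (prod_sum _ _ _ _ (psi_sum 6) one_sum))) n]
  norm_cast
  unfold rep
  symm
  refine Set.ncard_congr (fun p _ => (2 * p.1, 2 * p.2.1 + 1, 2 * p.2.2.1 + 1)) ?_ ?_ ?_
  · rintro ⟨x, y, z, _⟩ h
    simp only [Set.mem_ofPred_eq] at h ⊢
    have := tri_spec y
    have := tri_spec z
    zify at h
    simp only [sq_abs] at h
    subst hM; rw [← hn, ← h]; linarith
  · rintro ⟨m, y, z, _⟩ ⟨m', y', z', _⟩ _ _ h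
    simp only [Prod.mk.injEq] at h ⊢
    refine ⟨by omega, by omega, by omega, trivial⟩
  · rintro ⟨x, y, z⟩ h
    simp only [Set.mem_ofPred_eq] at h
    have hx : y % 2 = 1 := by
      rcases Int.emod_two_eq_zero_or_one y with h0 | h0
      · exfalso
        obtain ⟨w, rfl⟩ : ∃ w, y = 2 * w := ⟨y / 2, by omega⟩
        ring_nf at h; omega
      · exact h0
    obtain ⟨m, rfl⟩ := odd_sq y hx
    have := tri_spec m
    have h4 : (x ^ 2 + 3 * z ^ 2) % 4 = 3 := by
      have : 8 * N + 1 = 24 * (tri m : ℤ) + 3 + 2 * (x ^ 2 + 3 * z ^ 2) := by linarith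
      omega
    have hyz : x % 2 = 0 ∧ z % 2 = 1 := by
      obtain ⟨u, hu⟩ : ∃ u, x = 2 * u + x % 2 := ⟨x / 2, by omega⟩
      obtain ⟨v, hv⟩ : ∃ v, z = 2 * v + z % 2 := ⟨z / 2, by omega⟩
      rcases Int.emod_two_eq_zero_or_one x with h0 | h0 <;>
      rcases Int.emod_two_eq_zero_or_one z with h1 | h1 <;> rw [h0] at hu <;> rw [h1] at hv <;>
        (rw [hu, hv] at h4; ring_nf at h4; omega)
    obtain ⟨u, rfl⟩ : ∃ u, x = 2 * u := ⟨x / 2, by omega⟩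
    obtain ⟨v, rfl⟩ := odd_sq z hyz.2
    refine ⟨(u, m, v, ()), ?_, rfl⟩
    simp only [Set.mem_ofPred_eq]
    have := tri_spec v
    zify
    simp only [sq_abs]
    linarith

end

theorem disc144_identity (M : ℤ) (hM : 0 < M) (h8 : M % 8 = 1) :
    rep 1 8 8 0 0 0 M = rep 1 6 6 0 0 0 M + 2 * rep 2 3 6 0 0 0 M := by
  have hN : M = 8 * (M / 8) + 1 := by omega
  have hn : (((M / 8).toNat : ℕ) : ℤ) = M / 8 := by omega
  zify
  rw [rep1 M _ _ hn hN, rep2 M _ _ hn hN, rep3 M _ _ hn hN]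
  have h := main_ps
  have h2 : 2 * th (PowerSeries.X ^ 1) (PowerSeries.X ^ 3) * (th (PowerSeries.X ^ 1) (PowerSeries.X ^ 1) * th (PowerSeries.X ^ 1) (PowerSeries.X ^ 1)) =
      2 * th (PowerSeries.X ^ 1) (PowerSeries.X ^ 3) * (th (PowerSeries.X ^ 3) (PowerSeries.X ^ 3) * th (PowerSeries.X ^ 3) (PowerSeries.X ^ 3)) +
      (th (PowerSeries.X ^ 1) (PowerSeries.X ^ 1) * (2 * th (PowerSeries.X ^ 3) (PowerSeries.X ^ 9) * (2 * th (PowerSeries.X ^ 6) (PowerSeries.X ^ 18) * PowerSeries.X)) +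
       th (PowerSeries.X ^ 1) (PowerSeries.X ^ 1) * (2 * th (PowerSeries.X ^ 3) (PowerSeries.X ^ 9) * (2 * th (PowerSeries.X ^ 6) (PowerSeries.X ^ 18) * PowerSeries.X))) := by
    linear_combination 2 * h
  rw [h2, map_add, map_add]; ring
end

section
/- If M is a positive integer with M ≡ 1 (mod 4) or M ≡ 2 (mod 4), then (1,1,1,0,0,0)(M) = 3·(1,6,6,0,0,0)(M) + 6·(2,3,6,0,0,0)(M). -/
open scoped ENNReal

noncomputable def EE (t x : ℝ) : ℝ≥0∞ := ENNReal.ofReal (Real.exp (-(t * x)))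

lemma EE_add (t x y : ℝ) : EE t (x + y) = EE t x * EE t y := by
  unfold EE
  rw [← ENNReal.ofReal_mul (Real.exp_pos _).le, ← Real.exp_add]
  congr 2; ring

lemma EE_scale (t c x : ℝ) : EE (c * t) x = EE t (c * x) := by
  unfold EE; congr 3; ring

noncomputable def PH (t : ℝ) : ℝ≥0∞ := ∑' n : ℤ, EE t ((n : ℝ) ^ 2)
noncomputable def DD (t : ℝ) : ℝ≥0∞ := ∑' n : ℤ, EE t (((n : ℝ) ^ 2 + n) / 2)
noncomputable def WW (t : ℝ) : ℝ≥0∞ := ∑' n : ℤ, EE t (3 * (n : ℝ) ^ 2 + 2 * n)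
noncomputable def VV (t : ℝ) : ℝ≥0∞ := ∑' n : ℤ, EE t ((3 * (n : ℝ) ^ 2 + n) / 2)

/-- product of two theta series as a double sum -/
lemma dbl (f g : ℤ → ℝ≥0∞) : (∑' x, f x) * (∑' y, g y) = ∑' x, ∑' y, f x * g y := by
  rw [← ENNReal.tsum_mul_right]
  congr 1; ext x
  rw [ENNReal.tsum_mul_left]

lemma par1 (g : ℤ → ℝ≥0∞) : ∑' n, g n = (∑' n, g (2 * n)) + ∑' n, g (2 * n + 1) := by
  have h : ∀ n : ℤ, g n = (if n % 2 = 0 then g n else 0) + (if n % 2 = 1 then g n else 0) := by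
    intro n
    rcases Int.emod_two_eq_zero_or_one n with h | h <;> simp [h]
  rw [tsum_congr h, ENNReal.tsum_add]
  congr 1
  · have hi : Function.Injective (fun n : ℤ => 2 * n) := fun a b h => by simpa using h
    rw [← hi.tsum_eq (f := fun n => if n % 2 = 0 then g n else 0)]
    · simp
    · intro n hn
      have : n % 2 = 0 := by by_contra h; exact hn (if_neg h)
      exact ⟨n / 2, by simp only; omega⟩
  · have hi : Function.Injective (fun n : ℤ => 2 * n + 1) := fun a b h => by simpa using h
    rw [← hi.tsum_eq (f := fun n => if n % 2 = 1 then g n else 0)]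
    · apply tsum_congr; intro n
      have : (2 * n + 1) % 2 = 1 := by omega
      simp [this]
    · intro n hn
      have : n % 2 = 1 := by by_contra h; exact hn (if_neg h)
      exact ⟨n / 2, by simp only; omega⟩

lemma par3 (g : ℤ → ℝ≥0∞) :
    ∑' n, g n = (∑' n, g (3 * n)) + (∑' n, g (3 * n + 1)) + ∑' n, g (3 * n + 2) := by
  have h : ∀ n : ℤ, g n = ((if n % 3 = 0 then g n else 0) + (if n % 3 = 1 then g n else 0))
      + (if n % 3 = 2 then g n else 0) := by
    intro n
    have : n % 3 = 0 ∨ n % 3 = 1 ∨ n % 3 = 2 := by omega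
    rcases this with h | h | h <;> simp [h]
  rw [tsum_congr h, ENNReal.tsum_add, ENNReal.tsum_add]
  congr 1
  congr 1
  · have hi : Function.Injective (fun n : ℤ => 3 * n) := fun a b h => by simpa using h
    rw [← hi.tsum_eq (f := fun n => if n % 3 = 0 then g n else 0)]
    · simp
    · intro n hn
      have : n % 3 = 0 := by by_contra h; exact hn (if_neg h)
      exact ⟨n / 3, by simp only; omega⟩
  · have hi : Function.Injective (fun n : ℤ => 3 * n + 1) := fun a b h => by simpa using h
    rw [← hi.tsum_eq (f := fun n => if n % 3 = 1 then g n else 0)]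
    · apply tsum_congr; intro n
      have : (3 * n + 1) % 3 = 1 := by omega
      simp [this]
    · intro n hn
      have : n % 3 = 1 := by by_contra h; exact hn (if_neg h)
      exact ⟨n / 3, by simp only; omega⟩
  · have hi : Function.Injective (fun n : ℤ => 3 * n + 2) := fun a b h => by simpa using h
    rw [← hi.tsum_eq (f := fun n => if n % 3 = 2 then g n else 0)]
    · apply tsum_congr; intro n
      have : (3 * n + 2) % 3 = 2 := by omega
      simp [this]
    · intro n hn
      have : n % 3 = 2 := by by_contra h; exact hn (if_neg h)
      exact ⟨n / 3, by simp only; omega⟩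

lemma shift (g : ℤ → ℝ≥0∞) (c : ℤ) : ∑' n, g (n + c) = ∑' n, g n :=
  (Equiv.addRight c).tsum_eq g

lemma refl' (g : ℤ → ℝ≥0∞) (c : ℤ) : ∑' n, g (c - n) = ∑' n, g n :=
  (Equiv.subLeft c).tsum_eq g

/-- rotation splitting -/
lemma rot (g : ℤ → ℤ → ℝ≥0∞) : ∑' x, ∑' y, g x y
    = (∑' u, ∑' v, g (u + v) (u - v)) + ∑' u, ∑' v, g (u + v + 1) (u - v) := by
  -- substitute x = y + z, then split z
  have h1 : ∑' x, ∑' y, g x y = ∑' z, ∑' y, g (y + z) y := by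
    rw [ENNReal.tsum_comm]
    conv_rhs => rw [ENNReal.tsum_comm]
    apply tsum_congr; intro y
    rw [← shift (fun x => g x y) y]
    simp [add_comm]
  rw [h1, par1]
  congr 1
  · rw [ENNReal.tsum_comm (f := fun u v => g (u + v) (u - v))]
    apply tsum_congr; intro v
    rw [← shift (fun y => g (y + 2 * v) y) (-v)]
    apply tsum_congr; intro u
    congr 1; ring
  · rw [ENNReal.tsum_comm (f := fun u v => g (u + v + 1) (u - v))]
    apply tsum_congr; intro v
    rw [← shift (fun y => g (y + (2 * v + 1)) y) (-v)]
    apply tsum_congr; intro u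
    congr 1; ring

/-- factoring a double sum -/
lemma fac (t c : ℝ) (A B : ℤ → ℝ) (F : ℤ → ℤ → ℝ) (h : ∀ u v, F u v = c + A u + B v) :
    ∑' u, ∑' v, EE t (F u v) = EE t c * (∑' u, EE t (A u)) * (∑' v, EE t (B v)) := by
  rw [mul_assoc, dbl, ← ENNReal.tsum_mul_left]
  apply tsum_congr; intro u
  rw [← ENNReal.tsum_mul_left]
  apply tsum_congr; intro v
  rw [h, EE_add, EE_add, mul_assoc]

lemma fac' (t : ℝ) (A B : ℤ → ℝ) :
    (∑' u, EE t (A u)) * (∑' v, EE t (B v)) = ∑' u, ∑' v, EE t (A u + B v) := by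
  rw [dbl]; simp_rw [EE_add]

lemma EE_zero (t : ℝ) : EE t 0 = 1 := by simp [EE]

lemma EE_one_scale (t c : ℝ) : EE t c = EE (c * t) 1 := by rw [EE_scale]; simp

/- the rescaled basic series -/
lemma PH_sc (t c : ℝ) : PH (c * t) = ∑' n : ℤ, EE t (c * (n : ℝ) ^ 2) := by
  unfold PH; simp_rw [EE_scale]
lemma DD_sc (t c : ℝ) : DD (c * t) = ∑' n : ℤ, EE t (c * (((n : ℝ) ^ 2 + n) / 2)) := by
  unfold DD; simp_rw [EE_scale]
lemma WW_sc (t c : ℝ) : WW (c * t) = ∑' n : ℤ, EE t (c * (3 * (n : ℝ) ^ 2 + 2 * n)) := by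
  unfold WW; simp_rw [EE_scale]
lemma VV_sc (t c : ℝ) : VV (c * t) = ∑' n : ℤ, EE t (c * ((3 * (n : ℝ) ^ 2 + n) / 2)) := by
  unfold VV; simp_rw [EE_scale]

lemma sumc (t c : ℝ) (F A : ℤ → ℝ) (h : ∀ n, F n = c + A n) :
    ∑' n, EE t (F n) = EE t c * ∑' n, EE t (A n) := by
  rw [← ENNReal.tsum_mul_left]; simp_rw [h, EE_add]

lemma L0 (t : ℝ) : PH t = PH (4 * t) + EE t 1 * DD (8 * t) := by
  rw [PH_sc, DD_sc, PH, par1]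
  congr 1
  · apply tsum_congr; intro n; congr 1; push_cast; ring
  · apply sumc; intro n; push_cast; ring

lemma L2 (t : ℝ) : PH t ^ 2 = PH (2 * t) ^ 2 + EE t 1 * DD (4 * t) ^ 2 := by
  rw [sq (PH t), PH, fac', rot, PH_sc, DD_sc]
  congr 1
  · rw [fac t 0 (fun u => 2 * (u : ℝ) ^ 2) (fun v => 2 * (v : ℝ) ^ 2), EE_zero]; · ring
    intro u v; push_cast; ring
  · rw [fac t 1 (fun u => 4 * (((u : ℝ) ^ 2 + u) / 2)) (fun u => 4 * (((u : ℝ) ^ 2 + u) / 2))]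
    · ring
    intro u v; push_cast; ring

lemma L1 (t : ℝ) : 2 * PH t * DD (2 * t) = DD t ^ 2 := by
  rw [sq (DD t), DD_sc, DD, fac', rot]
  rw [fac t 0 (fun u => 2 * (((u : ℝ) ^ 2 + u) / 2)) (fun v => (v : ℝ) ^ 2), EE_zero,
    fac t 0 (fun u => ((u + 1 : ℤ) : ℝ) ^ 2) (fun u => 2 * (((u : ℝ) ^ 2 + u) / 2)), EE_zero,
    shift (fun u => EE t ((u : ℝ) ^ 2)) 1, PH]
  · ring
  · intro u v; push_cast; ring
  · intro u v; push_cast; ring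

lemma L4 (t : ℝ) : WW t = VV (8 * t) + EE t 1 * WW (4 * t) := by
  rw [WW_sc, VV_sc, WW, par1]
  congr 1
  · apply tsum_congr; intro n; congr 1; push_cast; ring
  · rw [← refl' (fun n => EE t (4 * (3 * (n : ℝ) ^ 2 + 2 * n))) (-1)]
    apply sumc; intro n; push_cast; ring

lemma L5 (t : ℝ) : VV t ^ 2 = PH (3 * t) * VV (2 * t) + EE t 1 * WW t * DD (6 * t) := by
  rw [sq (VV t), VV, fac', rot, PH_sc, VV_sc, DD_sc, WW]
  congr 1
  · rw [fac t 0 (fun u => 2 * ((3 * (u : ℝ) ^ 2 + u) / 2)) (fun v => 3 * (v : ℝ) ^ 2), EE_zero]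
    · ring
    intro u v; push_cast; ring
  · rw [← refl' (fun n => EE t (3 * (n : ℝ) ^ 2 + 2 * n)) (-1)]
    apply fac
    intro u v; push_cast; ring

lemma L6 (t : ℝ) : DD (3 * t) * VV t = 2 * VV (2 * t) * WW t := by
  rw [VV_sc, DD_sc, VV, WW, fac', rot]
  rw [fac t 0 (fun v => 3 * (v : ℝ) ^ 2 + 2 * v) (fun u => 2 * ((3 * (u : ℝ) ^ 2 + u) / 2)), EE_zero,
    fac t 0 (fun u => 2 * ((3 * ((-1 - u : ℤ) : ℝ) ^ 2 + ((-1 - u : ℤ) : ℝ)) / 2))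
     (fun v => 3 * ((-1 - v : ℤ) : ℝ) ^ 2 + 2 * ((-1 - v : ℤ) : ℝ)), EE_zero,
    refl' (fun u => EE t (2 * ((3 * (u : ℝ) ^ 2 + u) / 2))) (-1),
    refl' (fun v => EE t (3 * (v : ℝ) ^ 2 + 2 * v)) (-1)]
  · ring
  · intro u v; push_cast; ring
  · intro u v; push_cast; ring

lemma L7 (t : ℝ) : PH (3 * t) * WW t = VV (4 * t) ^ 2 + EE t 1 * WW (2 * t) ^ 2 := by
  rw [PH_sc, VV_sc, WW_sc, WW, fac', rot]
  congr 1
  · rw [fac t 0 (fun u => 4 * ((3 * (u : ℝ) ^ 2 + u) / 2))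
      (fun u => 4 * ((3 * ((0 - u : ℤ) : ℝ) ^ 2 + ((0 - u : ℤ) : ℝ)) / 2)), EE_zero,
      refl' (fun u => EE t (4 * ((3 * (u : ℝ) ^ 2 + u) / 2))) 0]
    · ring
    · intro u v; push_cast; ring
  · rw [fac t 1 (fun u => 2 * (3 * ((-1 - u : ℤ) : ℝ) ^ 2 + 2 * ((-1 - u : ℤ) : ℝ)))
      (fun v => 2 * (3 * (v : ℝ) ^ 2 + 2 * v)),
      refl' (fun u => EE t (2 * (3 * (u : ℝ) ^ 2 + 2 * u))) (-1)]
    · ring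
    · intro u v; push_cast; ring

lemma L3aux (t : ℝ) : ∑' a : ℤ, ∑' v : ℤ, EE t ((((2 * a - v + 1 : ℤ) : ℝ) ^ 2 + 3 * (v : ℝ) ^ 2 - 1) / 2)
    = DD (4 * t) * PH (6 * t) + EE t 1 * PH (2 * t) * DD (12 * t) := by
  rw [ENNReal.tsum_comm, par1]
  congr 1
  · have : ∀ n : ℤ, ∑' a : ℤ, EE t ((((2 * a - 2 * n + 1 : ℤ) : ℝ) ^ 2 + 3 * ((2 * n : ℤ) : ℝ) ^ 2 - 1) / 2)
        = ∑' a : ℤ, EE t ((4 * (((a : ℝ) ^ 2 + a) / 2)) + 6 * (n : ℝ) ^ 2) := by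
      intro n
      rw [← shift _ n]
      apply tsum_congr; intro a; congr 1; push_cast; ring
    rw [tsum_congr this, ENNReal.tsum_comm, ← fac', DD_sc, PH_sc]
  · have : ∀ n : ℤ, ∑' a : ℤ, EE t ((((2 * a - (2 * n + 1) + 1 : ℤ) : ℝ) ^ 2 + 3 * ((2 * n + 1 : ℤ) : ℝ) ^ 2 - 1) / 2)
        = ∑' a : ℤ, EE t (1 + (2 * (a : ℝ) ^ 2) + (12 * (((n : ℝ) ^ 2 + n) / 2))) := by
      intro n
      rw [← shift _ n]
      apply tsum_congr; intro a; congr 1; push_cast; ring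
    rw [tsum_congr this, ENNReal.tsum_comm, fac t 1 _ _ _ (fun u v => rfl), DD_sc, PH_sc]

lemma L3 (t : ℝ) : DD t * DD (3 * t)
    = 2 * (DD (4 * t) * PH (6 * t) + EE t 1 * PH (2 * t) * DD (12 * t)) := by
  rw [two_mul, DD_sc t 3, DD, fac', rot]
  congr 1
  · rw [← L3aux]
    apply tsum_congr; intro u
    apply tsum_congr; intro v
    congr 1; push_cast; ring
  · rw [← L3aux, ENNReal.tsum_comm, ]
    apply tsum_congr; intro a
    rw [← shift _ (-1)]
    apply tsum_congr; intro v
    congr 1; push_cast; ring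

/-- The tetracode lemma. -/
lemma tetra (w Z : ℤ → ℝ≥0∞) (Th : ℤ → ℝ≥0∞) (c d e f : ℤ)
    (hTh : ∀ r, Th r = ∑' k : ℤ, w (r - 3 * k))
    (K : ℝ≥0∞)
    (hw : ∀ x y z s, K * (Z x * Z y * (Z z * Z s)) =
      w (x + y + z + e) * w (x - y + s + f) *
      (w ((x + y + z + e) + (x - y + s + f) + c - 3 * x) *
        w ((x + y + z + e) - (x - y + s + f) + d - 3 * y))) :
    K * (∑' x, Z x) ^ 4 = ∑' a, ∑' b, w a * w b * (Th (a + b + c) * Th (a - b + d)) := by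
  have h1 : K * (∑' x, Z x) ^ 4 = ∑' x, ∑' y, ∑' z, ∑' s, K * (Z x * Z y * (Z z * Z s)) := by
    have : (∑' x, Z x) ^ 4 = ((∑' x, Z x) * (∑' x, Z x)) * ((∑' x, Z x) * (∑' x, Z x)) := by ring
    rw [this]
    simp_rw [ENNReal.tsum_mul_left, ENNReal.tsum_mul_right]
    rw [dbl Z Z]
  have h2 : ∀ a b, w a * w b * (Th (a + b + c) * Th (a - b + d)) =
      ∑' x, ∑' y, w a * w b * (w (a + b + c - 3 * x) * w (a - b + d - 3 * y)) := by
    intro a b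
    rw [hTh, hTh, dbl]
    simp_rw [ENNReal.tsum_mul_left]
  simp_rw [h2]
  rw [h1]
  have h3 : ∀ F : ℤ → ℤ → ℤ → ℤ → ℝ≥0∞, ∑' a, ∑' b, ∑' x, ∑' y, F a b x y =
      ∑' x, ∑' y, ∑' a, ∑' b, F a b x y := by
    intro F
    calc ∑' a, ∑' b, ∑' x, ∑' y, F a b x y = ∑' a, ∑' x, ∑' b, ∑' y, F a b x y := by
          apply tsum_congr; intro a; rw [ENNReal.tsum_comm]
      _ = ∑' x, ∑' a, ∑' b, ∑' y, F a b x y := ENNReal.tsum_comm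
      _ = ∑' x, ∑' a, ∑' y, ∑' b, F a b x y := by
          apply tsum_congr; intro x; apply tsum_congr; intro a; rw [ENNReal.tsum_comm]
      _ = ∑' x, ∑' y, ∑' a, ∑' b, F a b x y := by
          apply tsum_congr; intro x; rw [ENNReal.tsum_comm]
  conv_rhs => rw [h3]
  apply tsum_congr; intro x
  apply tsum_congr; intro y
  conv_rhs => rw [← shift _ (x + y + e)]
  apply tsum_congr; intro z
  conv_rhs => rw [← shift _ (x - y + f)]
  apply tsum_congr; intro s
  rw [hw]
  have e1 : x + y + z + e = z + (x + y + e) := by ring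
  have e2 : x - y + s + f = s + (x - y + f) := by ring
  rw [e1, e2]

lemma split9 (w : ℤ → ℝ≥0∞) (G : ℤ → ℤ → ℝ≥0∞) (T : ℤ → ℝ≥0∞)
    (hT : ∀ r, T r = ∑' k : ℤ, w (3 * k + r))
    (hG : ∀ a b m n : ℤ, G (3 * m + a) (3 * n + b) = G a b) :
    ∑' a, ∑' b, w a * w b * G a b =
      T 0 * T 0 * G 0 0 + T 0 * T 1 * G 0 1 + T 0 * T 2 * G 0 2 +
      T 1 * T 0 * G 1 0 + T 1 * T 1 * G 1 1 + T 1 * T 2 * G 1 2 +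
      T 2 * T 0 * G 2 0 + T 2 * T 1 * G 2 1 + T 2 * T 2 * G 2 2 := by
  have h : ∀ i j : ℤ, ∑' m, ∑' n, w (3 * m + i) * w (3 * n + j) * G (3 * m + i) (3 * n + j)
      = T i * T j * G i j := by
    intro i j
    simp_rw [hG, hT, dbl, ENNReal.tsum_mul_right]
  have h0 : ∀ g : ℤ → ℝ≥0∞, ∑' n, g (3 * n) = ∑' n, g (3 * n + 0) := by intro g; simp
  rw [par3, h0 (fun a => ∑' b, w a * w b * G a b)]
  have h' : ∀ i : ℤ, ∑' m, ∑' b, w (3 * m + i) * w b * G (3 * m + i) b =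
      T i * T 0 * G i 0 + T i * T 1 * G i 1 + T i * T 2 * G i 2 := by
    intro i
    rw [ENNReal.tsum_comm, par3,
      h0 (fun b => ∑' a : ℤ, w (3 * a + i) * w b * G (3 * a + i) b)]
    rw [← h, ← h, ← h]
    congr 1
    · congr 1 <;> rw [ENNReal.tsum_comm]
    · rw [ENNReal.tsum_comm]
  rw [h', h', h']
  ring

lemma Tper (w T : ℤ → ℝ≥0∞) (hT : ∀ r, T r = ∑' k : ℤ, w (3 * k + r)) (r m : ℤ) :
    T (3 * m + r) = T r := by
  rw [hT, hT, ← shift (fun k => w (3 * k + r)) m]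
  apply tsum_congr; intro k; congr 1; ring

lemma tetra2 (w Z : ℤ → ℝ≥0∞) (T : ℤ → ℝ≥0∞) (c d e f : ℤ)
    (hT : ∀ r, T r = ∑' k : ℤ, w (3 * k + r))
    (K : ℝ≥0∞)
    (hw : ∀ x y z s, K * (Z x * Z y * (Z z * Z s)) =
      w (x + y + z + e) * w (x - y + s + f) *
      (w ((x + y + z + e) + (x - y + s + f) + c - 3 * x) *
        w ((x + y + z + e) - (x - y + s + f) + d - 3 * y))) :
    K * (∑' x, Z x) ^ 4 =
      T 0 * T 0 * (T (0 + 0 + c) * T (0 - 0 + d)) + T 0 * T 1 * (T (0 + 1 + c) * T (0 - 1 + d))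
      + T 0 * T 2 * (T (0 + 2 + c) * T (0 - 2 + d)) +
      T 1 * T 0 * (T (1 + 0 + c) * T (1 - 0 + d)) + T 1 * T 1 * (T (1 + 1 + c) * T (1 - 1 + d))
      + T 1 * T 2 * (T (1 + 2 + c) * T (1 - 2 + d)) +
      T 2 * T 0 * (T (2 + 0 + c) * T (2 - 0 + d)) + T 2 * T 1 * (T (2 + 1 + c) * T (2 - 1 + d))
      + T 2 * T 2 * (T (2 + 2 + c) * T (2 - 2 + d)) := by
  rw [tetra w Z T c d e f _ K hw, split9 w (fun a b => T (a + b + c) * T (a - b + d)) T hT]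
  · intro a b m n
    have e1 : 3 * m + a + (3 * n + b) + c = 3 * (m + n) + (a + b + c) := by ring
    have e2 : 3 * m + a - (3 * n + b) + d = 3 * (m - n) + (a - b + d) := by ring
    rw [e1, e2, Tper w T hT, Tper w T hT]
  · intro r
    rw [hT, ← refl' _ 0]
    apply tsum_congr; intro k; congr 1; ring

lemma T1 (t : ℝ) : PH (3 * t) ^ 4 = PH (9 * t) ^ 4 + 8 * PH (9 * t) * (EE t 1 * WW (3 * t)) ^ 3 := by
  set w : ℤ → ℝ≥0∞ := fun n => EE t ((n : ℝ) ^ 2) with hw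
  set T : ℤ → ℝ≥0∞ := fun r => ∑' k : ℤ, w (3 * k + r) with hT
  have hT' : ∀ r, T r = ∑' k : ℤ, w (3 * k + r) := fun r => rfl
  have key := tetra2 w (fun n => EE t (3 * (n : ℝ) ^ 2)) T 0 0 0 0 hT' 1 (by
    intro x y z s
    simp only [hw, one_mul, ← EE_add]
    congr 1; push_cast; ring)
  have h0 : T 0 = PH (9 * t) := by
    rw [PH_sc, hT']; apply tsum_congr; intro n; simp only [hw]; congr 1; push_cast; ring
  have h1 : T 1 = EE t 1 * WW (3 * t) := by
    rw [WW_sc, hT']; apply sumc; intro n; push_cast; ring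
  have h2 : T 2 = EE t 1 * WW (3 * t) := by
    rw [WW_sc, hT', ← refl' _ (-1)]; apply sumc; intro n; push_cast; ring
  have p : ∀ r m, T (3 * m + r) = T r := fun r m => Tper w T hT' r m
  have hm1 : T (-1) = T 2 := by simpa using p 2 (-1)
  have hm2 : T (-2) = T 1 := by simpa using p 1 (-1)
  have h3 : T 3 = T 0 := by simpa using p 0 1
  have h4 : T 4 = T 1 := by simpa using p 1 1
  norm_num [hm1, hm2, h3, h4, h0, h1, h2] at key
  rw [PH_sc t 3, key]
  ring

lemma T2 (t : ℝ) : EE t 1 * DD (3 * t) ^ 4 =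
    (EE t 1 * DD (9 * t)) ^ 4 + 8 * (EE t 1 * DD (9 * t)) * VV (3 * t) ^ 3 := by
  set w : ℤ → ℝ≥0∞ := fun n => EE t (((n : ℝ) ^ 2 + n) / 2) with hw
  set T : ℤ → ℝ≥0∞ := fun r => ∑' k : ℤ, w (3 * k + r) with hT
  have hT' : ∀ r, T r = ∑' k : ℤ, w (3 * k + r) := fun r => rfl
  have key := tetra2 w (fun n => EE t (3 * (((n : ℝ) ^ 2 + n) / 2))) T (-1) (-2) 1 0 hT' (EE t 1) (by
    intro x y z s
    simp only [hw, ← EE_add]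
    congr 1; push_cast; ring)
  have h0 : T 0 = VV (3 * t) := by
    rw [VV_sc, hT']; apply tsum_congr; intro n; simp only [hw]; congr 1; push_cast; ring
  have h1 : T 1 = EE t 1 * DD (9 * t) := by
    rw [DD_sc, hT']; apply sumc; intro n; push_cast; ring
  have h2 : T 2 = VV (3 * t) := by
    rw [VV_sc, hT', ← refl' _ (-1)]; apply tsum_congr; intro n; simp only [hw]; congr 1; push_cast; ring
  have p : ∀ r m, T (3 * m + r) = T r := fun r m => Tper w T hT' r m
  have hm1 : T (-1) = T 2 := by simpa using p 2 (-1)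
  have hm2 : T (-2) = T 1 := by simpa using p 1 (-1)
  have hm3 : T (-3) = T 0 := by simpa using p 0 (-1)
  have hm4 : T (-4) = T 2 := by simpa using p 2 (-2)
  have h3 : T 3 = T 0 := by simpa using p 0 1
  norm_num [hm1, hm2, hm3, hm4, h3, h0, h1, h2] at key
  rw [DD_sc t 3, key]
  ring

lemma le_geo (t : ℝ) (ht : 5 ≤ t) (f : ℤ → ℝ) (hf : ∀ n : ℤ, |(n : ℝ)| ≤ f n) (h0 : f 0 = 0) :
    1 ≤ ∑' n, EE t (f n) ∧ ∑' n, EE t (f n) < 2 := by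
  constructor
  · calc (1 : ℝ≥0∞) = EE t (f 0) := by rw [h0, EE_zero]
      _ ≤ _ := ENNReal.le_tsum (f := fun n : ℤ => EE t (f n)) 0
  · set r : ℝ≥0∞ := ENNReal.ofReal (Real.exp (-5)) with hr
    have hr1 : r ≤ 1 / 8 := by
      have h : Real.exp (-5) ≤ 1 / 8 := by
        rw [Real.exp_neg]
        have : (8 : ℝ) ≤ Real.exp 5 := by
          have := Real.exp_one_gt_d9
          have h5 : Real.exp 5 = Real.exp 1 ^ 5 := by rw [← Real.exp_nat_mul]; norm_num
          rw [h5]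
          calc (8 : ℝ) ≤ 2 ^ 5 := by norm_num
            _ ≤ _ := by gcongr; linarith
        rw [one_div]; gcongr
      calc r ≤ ENNReal.ofReal (1 / 8) := ENNReal.ofReal_le_ofReal h
        _ = 1 / 8 := by rw [ENNReal.ofReal_div_of_pos (by norm_num)]; norm_num
    have hle : ∀ n : ℤ, EE t (f n) ≤ r ^ n.natAbs := by
      intro n
      rw [hr, ← ENNReal.ofReal_pow (Real.exp_pos _).le, ← Real.exp_nat_mul]
      apply ENNReal.ofReal_le_ofReal
      apply Real.exp_le_exp.mpr
      have h1 : ((n.natAbs : ℕ) : ℝ) = |(n : ℝ)| := by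
        rw [← Int.cast_abs, Int.abs_eq_natAbs]; simp
      rw [h1]
      have := hf n
      nlinarith [abs_nonneg (n : ℝ)]
    have hs : ∑' n : ℤ, r ^ n.natAbs = (∑' n : ℕ, r ^ n) + r * ∑' n : ℕ, r ^ n := by
      rw [tsum_of_nat_of_neg_add_one ENNReal.summable ENNReal.summable]
      congr 1
      rw [← ENNReal.tsum_mul_left]
      apply tsum_congr; intro n
      have : (-((n : ℤ) + 1)).natAbs = n + 1 := by omega
      rw [this, pow_succ']
    have hg : ∑' n : ℕ, r ^ n ≤ 8 / 7 := by
      rw [ENNReal.tsum_geometric]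
      have : (7 / 8 : ℝ≥0∞) ≤ 1 - r := by
        calc (7 / 8 : ℝ≥0∞) = 1 - 1 / 8 := by
              refine ENNReal.eq_sub_of_add_eq (by norm_num) ?_
              rw [ENNReal.div_add_div_same]; norm_num
              exact ENNReal.div_self (by norm_num) (by norm_num)
          _ ≤ 1 - r := by gcongr
      calc (1 - r)⁻¹ ≤ (7 / 8 : ℝ≥0∞)⁻¹ := by gcongr
        _ = 8 / 7 := by rw [ENNReal.inv_div] <;> norm_num
    calc ∑' n, EE t (f n) ≤ ∑' n : ℤ, r ^ n.natAbs := ENNReal.tsum_le_tsum hle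
      _ = (∑' n : ℕ, r ^ n) + r * ∑' n : ℕ, r ^ n := hs
      _ ≤ 8 / 7 + 1 / 8 * (8 / 7) := by gcongr
      _ < 2 := by
        have h1 : (8 / 7 : ℝ≥0∞) = ENNReal.ofReal (8 / 7) := by
          rw [ENNReal.ofReal_div_of_pos (by norm_num)]; norm_num
        have h2 : (1 / 8 : ℝ≥0∞) = ENNReal.ofReal (1 / 8) := by
          rw [ENNReal.ofReal_div_of_pos (by norm_num)]; norm_num
        have h3 : (2 : ℝ≥0∞) = ENNReal.ofReal 2 := by norm_num
        rw [h1, h2, ← ENNReal.ofReal_mul (by norm_num), ← ENNReal.ofReal_add (by norm_num) (by norm_num), h3]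
        apply (ENNReal.ofReal_lt_ofReal_iff (by norm_num)).mpr; norm_num

lemma int_abs_le_sq (n : ℤ) : |(n : ℝ)| ≤ (n : ℝ) ^ 2 := by
  have : |n| ≤ n ^ 2 := by
    rcases eq_or_ne n 0 with rfl | h
    · simp
    · have := Int.one_le_abs h
      rw [← sq_abs]; nlinarith
  exact_mod_cast this

lemma PH_b (t : ℝ) (ht : 5 ≤ t) : 1 ≤ PH t ∧ PH t < 2 :=
  le_geo t ht _ int_abs_le_sq (by simp)
lemma WW_b (t : ℝ) (ht : 5 ≤ t) : 1 ≤ WW t ∧ WW t < 2 :=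
  le_geo t ht _ (fun n => by
    have := int_abs_le_sq n
    have := neg_abs_le (n : ℝ)
    linarith) (by simp)
lemma VV_b (t : ℝ) (ht : 5 ≤ t) : 1 ≤ VV t ∧ VV t < 2 :=
  le_geo t ht _ (fun n => by
    have := int_abs_le_sq n
    have := neg_abs_le (n : ℝ)
    linarith) (by simp)
lemma DD_ge (t : ℝ) : 2 ≤ DD t := by
  have := ENNReal.sum_le_tsum (f := fun n : ℤ => EE t (((n : ℝ) ^ 2 + n) / 2)) {0, -1}
  rw [Finset.sum_pair (by norm_num)] at this
  norm_num [EE_zero] at this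
  exact this

lemma EE_ne_zero (t x : ℝ) : EE t x ≠ 0 := by
  unfold EE; simp [Real.exp_pos]
lemma EE_ne_top (t x : ℝ) : EE t x ≠ ⊤ := ENNReal.ofReal_ne_top

lemma DD_fin (t : ℝ) (ht : 20 ≤ t) : DD t ≠ ⊤ := by
  intro h
  have h1 := L2 (t / 4)
  have : 4 * (t / 4) = t := by ring
  rw [this, h] at h1
  have h2 := (PH_b (t / 4) (by linarith)).2.ne_top
  have h3 : EE (t / 4) 1 * (⊤ : ℝ≥0∞) ^ 2 = ⊤ := by
    simp [ENNReal.mul_top (EE_ne_zero _ _)]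
  rw [h3] at h1
  simp at h1
  exact h2 h1

noncomputable def Q (t : ℝ) : ℝ := Real.exp (-t)
noncomputable def ph (t : ℝ) : ℝ := (PH t).toReal
noncomputable def ps (t : ℝ) : ℝ := (DD t).toReal / 2
noncomputable def ww (t : ℝ) : ℝ := (WW t).toReal
noncomputable def vv (t : ℝ) : ℝ := (VV t).toReal

lemma EE_toReal (t : ℝ) : (EE t 1).toReal = Q t := by
  unfold EE Q; rw [ENNReal.toReal_ofReal (Real.exp_pos _).le]; simp

lemma ps_toReal (t : ℝ) : (DD t).toReal = 2 * ps t := by unfold ps; ring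

lemma Q_mul (n : ℕ) (t : ℝ) : Q (n * t) = Q t ^ n := by
  unfold Q; rw [← Real.exp_nat_mul]; congr 1; ring

lemma bd {x : ℝ≥0∞} (h : 1 ≤ x ∧ x < 2) : 1 ≤ x.toReal ∧ x.toReal < 2 := by
  constructor
  · have := ENNReal.toReal_mono h.2.ne_top h.1
    simpa using this
  · have := (ENNReal.toReal_lt_toReal h.2.ne_top (by norm_num)).mpr h.2
    simpa using this

lemma ph_b (t : ℝ) (ht : 5 ≤ t) : 1 ≤ ph t ∧ ph t < 2 := bd (PH_b t ht)
lemma ww_b (t : ℝ) (ht : 5 ≤ t) : 1 ≤ ww t ∧ ww t < 2 := bd (WW_b t ht)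
lemma vv_b (t : ℝ) (ht : 5 ≤ t) : 1 ≤ vv t ∧ vv t < 2 := bd (VV_b t ht)
lemma ps_b (t : ℝ) (ht : 20 ≤ t) : 1 ≤ ps t := by
  have := ENNReal.toReal_mono (DD_fin t ht) (DD_ge t)
  unfold ps
  norm_num at this
  linarith

lemma l0 (t : ℝ) (ht : 20 ≤ t) : ph t = ph (4 * t) + 2 * Q t * ps (8 * t) := by
  have h := congrArg ENNReal.toReal (L0 t)
  have h1 := (PH_b (4 * t) (by linarith)).2.ne_top
  have h2 := DD_fin (8 * t) (by linarith)
  have h3 := EE_ne_top t 1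
  rw [ENNReal.toReal_add (by finiteness) (by finiteness)] at h
  simp only [ENNReal.toReal_mul, EE_toReal, ps_toReal] at h
  unfold ph; linarith

lemma l1 (t : ℝ) (ht : 20 ≤ t) : ph t * ps (2 * t) = ps t ^ 2 := by
  have h := congrArg ENNReal.toReal (L1 t)
  simp only [ENNReal.toReal_mul, ENNReal.toReal_pow, EE_toReal, ps_toReal, ENNReal.toReal_ofNat] at h
  unfold ph; linarith

lemma l2 (t : ℝ) (ht : 20 ≤ t) : ph t ^ 2 = ph (2 * t) ^ 2 + 4 * Q t * ps (4 * t) ^ 2 := by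
  have h := congrArg ENNReal.toReal (L2 t)
  have h1 := (PH_b (2 * t) (by linarith)).2.ne_top
  have h2 := DD_fin (4 * t) (by linarith)
  have h3 := EE_ne_top t 1
  rw [ENNReal.toReal_add (by finiteness) (by finiteness)] at h
  simp only [ENNReal.toReal_mul, ENNReal.toReal_pow, EE_toReal, ps_toReal] at h
  unfold ph; linarith

lemma l3 (t : ℝ) (ht : 20 ≤ t) : ps t * ps (3 * t)
    = ps (4 * t) * ph (6 * t) + Q t * ph (2 * t) * ps (12 * t) := by
  have h := congrArg ENNReal.toReal (L3 t)
  have h1 := (PH_b (2 * t) (by linarith)).2.ne_top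
  have h1' := (PH_b (6 * t) (by linarith)).2.ne_top
  have h2 := DD_fin (4 * t) (by linarith)
  have h2' := DD_fin (12 * t) (by linarith)
  have h3 := EE_ne_top t 1
  rw [ENNReal.toReal_mul (a := 2), ENNReal.toReal_add (by finiteness) (by finiteness)] at h
  simp only [ENNReal.toReal_mul, EE_toReal, ps_toReal, ENNReal.toReal_ofNat] at h
  unfold ph; linarith

lemma l4 (t : ℝ) (ht : 20 ≤ t) : ww t = vv (8 * t) + Q t * ww (4 * t) := by
  have h := congrArg ENNReal.toReal (L4 t)
  have h1 := (VV_b (8 * t) (by linarith)).2.ne_top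
  have h2 := (WW_b (4 * t) (by linarith)).2.ne_top
  have h3 := EE_ne_top t 1
  rw [ENNReal.toReal_add (by finiteness) (by finiteness)] at h
  simp only [ENNReal.toReal_mul, EE_toReal] at h
  exact h

lemma l5 (t : ℝ) (ht : 20 ≤ t) :
    vv t ^ 2 = ph (3 * t) * vv (2 * t) + 2 * Q t * ww t * ps (6 * t) := by
  have h := congrArg ENNReal.toReal (L5 t)
  have h1 := (VV_b (2 * t) (by linarith)).2.ne_top
  have h2 := (WW_b t (by linarith)).2.ne_top
  have h4 := (PH_b (3 * t) (by linarith)).2.ne_top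
  have h5 := DD_fin (6 * t) (by linarith)
  have h3 := EE_ne_top t 1
  rw [ENNReal.toReal_add (by finiteness) (by finiteness)] at h
  simp only [ENNReal.toReal_mul, ENNReal.toReal_pow, EE_toReal, ps_toReal] at h
  unfold ph vv ww; linarith

lemma l6 (t : ℝ) (ht : 20 ≤ t) : ps (3 * t) * vv t = vv (2 * t) * ww t := by
  have h := congrArg ENNReal.toReal (L6 t)
  simp only [ENNReal.toReal_mul, EE_toReal, ps_toReal, ENNReal.toReal_ofNat] at h
  unfold vv ww; linarith

lemma l7 (t : ℝ) (ht : 20 ≤ t) :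
    ph (3 * t) * ww t = vv (4 * t) ^ 2 + Q t * ww (2 * t) ^ 2 := by
  have h := congrArg ENNReal.toReal (L7 t)
  have h1 := (VV_b (4 * t) (by linarith)).2.ne_top
  have h2 := (WW_b (2 * t) (by linarith)).2.ne_top
  have h3 := EE_ne_top t 1
  rw [ENNReal.toReal_add (by finiteness) (by finiteness)] at h
  simp only [ENNReal.toReal_mul, ENNReal.toReal_pow, EE_toReal] at h
  exact h

lemma t1 (t : ℝ) (ht : 60 ≤ t) : ph t ^ 4 = ph (3 * t) ^ 4 + 8 * Q t * ph (3 * t) * ww t ^ 3 := by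
  have h := congrArg ENNReal.toReal (T1 (t / 3))
  have e1 : 3 * (t / 3) = t := by ring
  have e2 : 9 * (t / 3) = 3 * t := by ring
  rw [e1, e2] at h
  have h1 := (PH_b (3 * t) (by linarith)).2.ne_top
  have h2 := (WW_b t (by linarith)).2.ne_top
  have h3 := EE_ne_top (t / 3) 1
  rw [ENNReal.toReal_add (by finiteness) (by finiteness)] at h
  simp only [ENNReal.toReal_mul, ENNReal.toReal_pow, EE_toReal, ENNReal.toReal_ofNat] at h
  have h4 := Q_mul 3 (t / 3)
  push_cast at h4
  rw [e1] at h4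
  unfold ph ww
  rw [h4, h]; ring

lemma t2 (t : ℝ) (ht : 60 ≤ t) : ps t ^ 4 = Q t * ps (3 * t) ^ 4 + ps (3 * t) * vv t ^ 3 := by
  have h := congrArg ENNReal.toReal (T2 (t / 3))
  have e1 : 3 * (t / 3) = t := by ring
  have e2 : 9 * (t / 3) = 3 * t := by ring
  rw [e1, e2] at h
  have h1 := (VV_b t (by linarith)).2.ne_top
  have h2 := DD_fin (3 * t) (by linarith)
  have h3 := EE_ne_top (t / 3) 1
  rw [ENNReal.toReal_add (by finiteness) (by finiteness)] at h
  simp only [ENNReal.toReal_mul, ENNReal.toReal_pow, EE_toReal, ps_toReal, ENNReal.toReal_ofNat] at h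
  have h4 := Q_mul 3 (t / 3)
  push_cast at h4
  rw [e1] at h4
  have hq : Q (t / 3) ≠ 0 := (Real.exp_pos _).ne'
  unfold vv
  rw [h4]
  apply mul_left_cancel₀ hq
  linarith

/-- The algebraic core, part 1. -/
lemma alg5 (q a b p P U W b1 W1 : ℝ) (hq : 0 < q) (ha : 0 < a) (hb : 0 < b) (hp : 0 < p)
    (hP : 0 < P) (hU : 0 < U) (hW : 0 < W)
    (h11 : U ^ 2 * W ^ 2 = b ^ 2 * P * U + 2 * q * b * P ^ 2 * W)
    (hJ3 : b ^ 4 - 16 * q ^ 3 * P ^ 4 = b1 ^ 4)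
    (h9 : W ^ 4 - 8 * q * P ^ 3 * U = W1 ^ 4)
    (h8 : b ^ 2 * W ^ 2 - 4 * q * P ^ 2 * U ^ 2 = (b1 * W1) ^ 2)
    (hT1 : a ^ 4 = b ^ 4 + 8 * q * b * W ^ 3)
    (hT2 : p ^ 4 = q ^ 2 * P ^ 4 + P * U ^ 3)
    (hne : q * W ^ 3 < b ^ 3) :
    p * b * W ^ 2 = a * P * U ^ 2 := by
  have h12 : W * (b ^ 3 - q * W ^ 3) = U * (U ^ 3 - 8 * q ^ 2 * P ^ 3) := by
    have h : (b ^ 2 * W ^ 2 - 4 * q * P ^ 2 * U ^ 2) ^ 2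
        = (b ^ 4 - 16 * q ^ 3 * P ^ 4) * (W ^ 4 - 8 * q * P ^ 3 * U) := by
      rw [h8, hJ3, h9]; ring
    have h0 : 16 * q ^ 2 * P ^ 4 ≠ 0 := by positivity
    apply mul_left_cancel₀ h0
    linear_combination -(8 * q * P ^ 2 * b ^ 2) * h11 - h
  set X := U ^ 3 - 8 * q ^ 2 * P ^ 3 with hX
  set Y := b ^ 3 - q * W ^ 3 with hY
  have hYp : 0 < Y := by rw [hY]; linarith
  have hXp : 0 < X := by
    have : 0 < U * X := by rw [← h12]; positivity
    exact (pos_iff_pos_of_mul_pos this).mp hU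
  have hc : (U ^ 3 + q ^ 2 * P ^ 3) * b ^ 3 * W ^ 6 * X ^ 2
      = (b ^ 3 + 8 * q * W ^ 3) * P ^ 3 * U ^ 6 * Y ^ 2 := by
    rw [hX, hY]
    linear_combination ((1)*q^0*P^0*U^7*W^4*b^3 + (1)*q^0*P^1*U^6*W^2*b^5 + (1)*q^0*P^2*U^5*W^0*b^7 + (2)*q^1*P^2*U^5*W^3*b^4 + (-2)*q^1*P^3*U^4*W^1*b^6 + (4)*q^2*P^4*U^3*W^2*b^5 + (-8)*q^3*P^3*U^4*W^7*b^0 + (-8)*q^3*P^4*U^3*W^5*b^2 + (-8)*q^3*P^5*U^2*W^3*b^4 + (-16)*q^4*P^5*U^2*W^6*b^1 + (16)*q^4*P^6*U^1*W^4*b^3 + (-32)*q^5*P^7*U^0*W^5*b^2) * h11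
  have h4 : (p * b * W ^ 2) ^ 4 = (a * P * U ^ 2) ^ 4 := by
    have hX2 : X ^ 2 ≠ 0 := by positivity
    apply mul_right_cancel₀ hX2
    have e1 : (p * b * W ^ 2) ^ 4 = (q ^ 2 * P ^ 4 + P * U ^ 3) * b ^ 4 * W ^ 8 := by rw [← hT2]; ring
    have e2 : (a * P * U ^ 2) ^ 4 = (b ^ 4 + 8 * q * b * W ^ 3) * P ^ 4 * U ^ 8 := by rw [← hT1]; ring
    rw [e1, e2]
    linear_combination (P * b * W ^ 2) * hc
      + (b ^ 4 + 8 * q * b * W ^ 3) * P ^ 4 * U ^ 6 * (W * Y + U * X) * h12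
  exact (pow_left_inj₀ (by positivity) (by positivity) (by norm_num)).mp h4

/-- The algebraic core, part 2. -/
lemma alg6 (q a b p P U W g a1 b1 : ℝ) (hq : 0 < q) (ha : 0 < a) (hb : 0 < b) (hp : 0 < p)
    (hP : 0 < P) (hU : 0 < U) (hW : 0 < W) (hg : 0 < g)
    (hg2 : g ^ 2 = a * b * p * P)
    (hJ1 : a ^ 4 - 16 * q * p ^ 4 = a1 ^ 4)
    (hJ3 : b ^ 4 - 16 * q ^ 3 * P ^ 4 = b1 ^ 4)
    (h3 : a1 * b1 = a * b - 4 * q * p * P)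
    (ha1 : 0 < a1) (hb1 : 0 < b1)
    (hT1 : a ^ 4 = b ^ 4 + 8 * q * b * W ^ 3)
    (hT2 : p ^ 4 = q ^ 2 * P ^ 4 + P * U ^ 3)
    (h5 : p * b * W ^ 2 = a * P * U ^ 2)
    (hs : q * a ^ 2 * P ^ 2 < p ^ 2 * b ^ 2) :
    p * a ^ 2 = p * b ^ 2 + 4 * q * g * P ∧ a * p ^ 2 = q * a * P ^ 2 + b * g := by
  have h5' : g * W = a * P * U := by
    refine (pow_left_inj₀ (n := 2) (by positivity) (by positivity) (by norm_num)).mp ?_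
    linear_combination W ^ 2 * hg2 + a * P * h5
  have hE1 : (a ^ 4 - b ^ 4) * p * g = 8 * q * a ^ 2 * P * (p ^ 4 - q ^ 2 * P ^ 4) := by
    rw [hT1, hT2]
    linear_combination 8 * q * p * b * W ^ 2 * h5' + 8 * q * a * P * U * h5
  have hE2 : p ^ 2 * b ^ 2 - q * P ^ 2 * a ^ 2 = g * (a * b - 4 * q * p * P) := by
    have hpos : 0 < a * b - 4 * q * p * P := by rw [← h3]; positivity
    refine (pow_left_inj₀ (n := 2) (by linarith) (by positivity) (by norm_num)).mp ?_
    have hh : (a * b - 4 * q * p * P) ^ 4 = (a ^ 4 - 16 * q * p ^ 4) * (b ^ 4 - 16 * q ^ 3 * P ^ 4) := by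
      rw [← h3, hJ1, hJ3]; ring
    have h16 : (16 * q) ≠ 0 := by positivity
    apply mul_left_cancel₀ h16
    linear_combination (-16 * q * (a * b - 4 * q * p * P) ^ 2) * hg2 + hh
  have hI : p * a ^ 2 = p * b ^ 2 + 4 * q * g * P := by
    have hden : 0 < g * a ^ 2 - 8 * q * p ^ 3 * P := by
      have k1 : 16 * q * p ^ 4 < a ^ 4 := by have := pow_pos ha1 4; linarith
      have k2 : 16 * q ^ 3 * P ^ 4 < b ^ 4 := by have := pow_pos hb1 4; linarith
      suffices h : (8 * q * p ^ 3 * P) ^ 8 < (g * a ^ 2) ^ 8 by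
        have := lt_of_pow_lt_pow_left₀ 8 (by positivity) h
        linarith
      have e : (g * a ^ 2) ^ 8 = (a ^ 4) ^ 5 * b ^ 4 * (p ^ 4 * P ^ 4) := by
        calc (g * a ^ 2) ^ 8 = (g ^ 2) ^ 4 * a ^ 16 := by ring
          _ = _ := by rw [hg2]; ring
      have e' : (8 * q * p ^ 3 * P) ^ 8 = (16 * q * p ^ 4) ^ 5 * (16 * q ^ 3 * P ^ 4) * (p ^ 4 * P ^ 4) := by
        ring
      rw [e, e']
      gcongr
    have hm : (p * a ^ 2) ^ 2 = (p * b ^ 2 + 4 * q * g * P) ^ 2 := by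
      apply mul_left_cancel₀ hden.ne'
      linear_combination a ^ 2 * p * hE1 - (8 * q * p * b ^ 2 * P * a ^ 2 + 16 * q ^ 2 * P ^ 2 * a ^ 2 * g
          - 128 * q ^ 3 * p ^ 3 * P ^ 3) * hg2
        - 8 * q * p * P * (-(p ^ 2 * b ^ 2 + q * P ^ 2 * a ^ 2) * hE2
          - (a ^ 2 * b ^ 2 - 16 * q ^ 2 * p ^ 2 * P ^ 2) * hg2 - g * (a * b + 4 * q * p * P) * hE2)
    exact (pow_left_inj₀ (by positivity) (by positivity) (by norm_num)).mp hm
  refine ⟨hI, ?_⟩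
  apply mul_left_cancel₀ ha.ne'
  linear_combination hE2 + p * hI

lemma Q2 (t : ℝ) : Q (2 * t) = Q t ^ 2 := by simpa using Q_mul 2 t
lemma Q3 (t : ℝ) : Q (3 * t) = Q t ^ 3 := by simpa using Q_mul 3 t
lemma Q4 (t : ℝ) : Q (4 * t) = Q t ^ 4 := by simpa using Q_mul 4 t

lemma jac (t : ℝ) (ht : 60 ≤ t) :
    ph t ^ 4 - 16 * Q t * ps (2 * t) ^ 4 = (ph (4 * t) - 2 * Q t * ps (8 * t)) ^ 4 := by
  have h0 := l0 t (by linarith)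
  have h1 := l1 (4 * t) (by linarith)
  have h2 := l2 (2 * t) (by linarith)
  have h3 := l1 (2 * t) (by linarith)
  rw [show 2 * (4 * t) = 8 * t by ring] at h1
  rw [show 2 * (2 * t) = 4 * t by ring, show 4 * (2 * t) = 8 * t by ring, Q2] at h2
  rw [show 2 * (2 * t) = 4 * t by ring] at h3
  rw [h0]
  have e : ps (2 * t) ^ 4 = (ph (4 * t) ^ 2 + 4 * Q t ^ 2 * ps (8 * t) ^ 2) * (ph (4 * t) * ps (8 * t)) := by
    rw [← h2, h1]
    calc ps (2 * t) ^ 4 = (ps (2 * t) ^ 2) ^ 2 := by ring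
      _ = _ := by rw [← h3]; ring
  rw [e]; ring

lemma alt_pos (t : ℝ) (ht : 60 ≤ t) : 0 < ph (4 * t) - 2 * Q t * ps (8 * t) := by
  have h0 := l0 t (by linarith)
  have h1 := ph_b t (by linarith)
  have h2 := ph_b (4 * t) (by linarith)
  linarith [h1.2, h2.1]

lemma Q_small (t : ℝ) (ht : 60 ≤ t) : Q t ≤ 1 / 64 := by
  unfold Q
  rw [Real.exp_neg, one_div]
  have := Real.add_one_le_exp t
  have h2 : Real.exp t = Real.exp (t / 2) ^ 2 := by rw [← Real.exp_nat_mul]; congr 1; push_cast; ring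
  have h3 := Real.add_one_le_exp (t / 2)
  have : (64 : ℝ) ≤ Real.exp t := by rw [h2]; nlinarith
  gcongr

set_option maxHeartbeats 2000000 in
lemma main_id (t : ℝ) (ht : 60 ≤ t) :
    ps (2 * t) * ph t ^ 2 = ps (2 * t) * ph (3 * t) ^ 2 + 4 * Q t * (ps t * ps (3 * t)) * ps (6 * t) ∧
    ph t * ps (2 * t) ^ 2 = Q t * ph t * ps (6 * t) ^ 2 + ph (3 * t) * (ps t * ps (3 * t)) := by
  have hq : 0 < Q t := Real.exp_pos _
  have hq1 := Q_small t ht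
  obtain ⟨a1, a2⟩ := ph_b t (by linarith)
  obtain ⟨b1, b2⟩ := ph_b (3 * t) (by linarith)
  obtain ⟨W1, W2⟩ := ww_b t (by linarith)
  obtain ⟨U1, U2⟩ := vv_b (2 * t) (by linarith)
  have p1 := ps_b (2 * t) (by linarith)
  have P1 := ps_b (6 * t) (by linarith)
  have s1 := ps_b t (by linarith)
  have S1 := ps_b (3 * t) (by linarith)
  have hs2 := l1 t (by linarith)
  have hS2 := l1 (3 * t) (by linarith)
  rw [show 2 * (3 * t) = 6 * t by ring] at hS2
  have l6t := l6 t (by linarith)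
  have l62 := l6 (2 * t) (by linarith)
  have l64 := l6 (4 * t) (by linarith)
  rw [show 3 * (2 * t) = 6 * t by ring, show 2 * (2 * t) = 4 * t by ring] at l62
  rw [show 3 * (4 * t) = 12 * t by ring, show 2 * (4 * t) = 8 * t by ring] at l64
  have l5t := l5 t (by linarith)
  have l54 := l5 (4 * t) (by linarith)
  rw [show 3 * (4 * t) = 12 * t by ring, show 2 * (4 * t) = 8 * t by ring,
    show 6 * (4 * t) = 24 * t by ring, Q4] at l54
  have l7t := l7 t (by linarith)
  have l72 := l7 (2 * t) (by linarith)
  rw [show 3 * (2 * t) = 6 * t by ring, show 2 * (2 * t) = 4 * t by ring,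
    show 4 * (2 * t) = 8 * t by ring, Q2] at l72
  have l16 := l1 (6 * t) (by linarith)
  rw [show 2 * (6 * t) = 12 * t by ring] at l16
  have l4t := l4 t (by linarith)
  have l0t := l0 t (by linarith)
  have l03 := l0 (3 * t) (by linarith)
  rw [show 4 * (3 * t) = 12 * t by ring, show 8 * (3 * t) = 24 * t by ring, Q3] at l03
  have l32 := l3 (2 * t) (by linarith)
  rw [show 3 * (2 * t) = 6 * t by ring, show 4 * (2 * t) = 8 * t by ring,
    show 6 * (2 * t) = 12 * t by ring, show 2 * (2 * t) = 4 * t by ring,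
    show 12 * (2 * t) = 24 * t by ring, Q2] at l32
  have hJ1 := jac t ht
  have hJ3 := jac (3 * t) (by linarith)
  rw [show 4 * (3 * t) = 12 * t by ring, show 8 * (3 * t) = 24 * t by ring,
    show 2 * (3 * t) = 6 * t by ring, Q3] at hJ3
  have ha1 := alt_pos t ht
  have hb1 := alt_pos (3 * t) (by linarith)
  rw [show 4 * (3 * t) = 12 * t by ring, show 8 * (3 * t) = 24 * t by ring, Q3] at hb1
  have hT1 := t1 t ht
  have hT2 := t2 (2 * t) (by linarith)
  rw [show 3 * (2 * t) = 6 * t by ring, Q2] at hT2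
  have V42 := vv_b (4 * t) (by linarith)
  have W22 := ww_b (2 * t) (by linarith)
  have hPlt : ps (6 * t) < 4 := by
    have h1 : ps (6 * t) ≤ ps (6 * t) * vv (2 * t) := by nlinarith
    have h2 : vv (4 * t) * ww (2 * t) < 2 * 2 :=
      mul_lt_mul'' V42.2 W22.2 (by linarith [V42.1]) (by linarith [W22.1])
    linarith
  have h11 : vv (2 * t) ^ 2 * ww t ^ 2 = ph (3 * t) ^ 2 * ps (6 * t) * vv (2 * t)
      + 2 * Q t * ph (3 * t) * ps (6 * t) ^ 2 * ww t := by
    calc vv (2 * t) ^ 2 * ww t ^ 2 = ps (3 * t) ^ 2 * vv t ^ 2 := by rw [← mul_pow, ← l6t]; ring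
      _ = _ := by rw [← hS2, l5t]; ring
  have h9 : ww t ^ 4 - 8 * Q t * ps (6 * t) ^ 3 * vv (2 * t)
      = (vv (8 * t) - Q t * ww (4 * t)) ^ 4 := by
    have e : ps (6 * t) ^ 3 * vv (2 * t)
        = (vv (8 * t) ^ 2 + Q t ^ 2 * ww (4 * t) ^ 2) * (vv (8 * t) * ww (4 * t)) := by
      rw [← l72, ← l64]
      linear_combination ps (6 * t) ^ 2 * l62 - vv (4 * t) * ww (2 * t) * l16
    rw [l4t]
    linear_combination -8 * Q t * e
  have h8 : ph (3 * t) ^ 2 * ww t ^ 2 - 4 * Q t * ps (6 * t) ^ 2 * vv (2 * t) ^ 2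
      = ((ph (12 * t) - 2 * Q t ^ 3 * ps (24 * t)) * (vv (8 * t) - Q t * ww (4 * t))) ^ 2 := by
    have e : (ph (12 * t) - 2 * Q t ^ 3 * ps (24 * t)) * (vv (8 * t) - Q t * ww (4 * t))
        = vv (4 * t) ^ 2 - Q t * ww (2 * t) ^ 2 := by
      have l7' := l7t
      rw [l03, l4t] at l7'
      linear_combination -2 * l54 - l7'
    rw [e]
    have e2 : ph (3 * t) ^ 2 * ww t ^ 2 = (vv (4 * t) ^ 2 + Q t * ww (2 * t) ^ 2) ^ 2 := by
      rw [← l7t]; ring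
    have e3 : ps (6 * t) ^ 2 * vv (2 * t) ^ 2 = (vv (4 * t) * ww (2 * t)) ^ 2 := by
      rw [← l62]; ring
    linear_combination e2 - 4 * Q t * e3
  have hne : Q t * ww t ^ 3 < ph (3 * t) ^ 3 := by
    have k1 : ww t ^ 3 < 2 ^ 3 := by gcongr
    have k2 : (1 : ℝ) ≤ ph (3 * t) ^ 3 := one_le_pow₀ b1
    nlinarith
  have h5 := alg5 (Q t) (ph t) (ph (3 * t)) (ps (2 * t)) (ps (6 * t)) (vv (2 * t)) (ww t) _ _ hq
    (by linarith) (by linarith) (by linarith) (by linarith) (by linarith) (by linarith)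
    h11 hJ3 h9 h8 hT1 hT2 hne
  refine alg6 (Q t) (ph t) (ph (3 * t)) (ps (2 * t)) (ps (6 * t)) (vv (2 * t)) (ww t)
    (ps t * ps (3 * t)) _ _ hq
    (by linarith) (by linarith) (by linarith) (by linarith) (by linarith) (by linarith)
    (mul_pos (by linarith) (by linarith)) ?_ hJ1 hJ3 ?_ ha1 hb1 hT1 hT2 h5 ?_
  · rw [mul_pow, ← hs2, ← hS2]; ring
  · rw [l0t, l03]
    linear_combination 4 * Q t * l32
  · have k1 : ph t ^ 2 < 2 ^ 2 := by gcongr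
    have k2 : ps (6 * t) ^ 2 < 4 ^ 2 := by gcongr
    have k3 : (1 : ℝ) ≤ ps (2 * t) ^ 2 := one_le_pow₀ p1
    have k4 : (1 : ℝ) ≤ ph (3 * t) ^ 2 := one_le_pow₀ b1
    calc Q t * ph t ^ 2 * ps (6 * t) ^ 2 ≤ 1 / 64 * 2 ^ 2 * ps (6 * t) ^ 2 := by
          gcongr
      _ < 1 / 64 * 2 ^ 2 * 4 ^ 2 := by linarith
      _ = 1 := by norm_num
      _ ≤ ps (2 * t) ^ 2 * ph (3 * t) ^ 2 := one_le_mul_of_one_le_of_one_le k3 k4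

/-- The theta series of one coordinate restricted to a parity class. -/
noncomputable def TH (t a : ℝ) (i : ℤ) : ℝ≥0∞ := ∑' n : ℤ, EE t (a * ((2 * n + i : ℤ) : ℝ) ^ 2)

lemma TH0 (t a : ℝ) : TH t a 0 = PH (4 * a * t) := by
  rw [PH_sc, TH]; apply tsum_congr; intro n; congr 1; push_cast; ring

lemma TH1 (t a : ℝ) : TH t a 1 = EE t a * DD (8 * a * t) := by
  rw [DD_sc, TH]; apply sumc; intro n; push_cast; ring

/-- The generating series of a diagonal form restricted to a class modulo four. -/
noncomputable def SS (a b c r : ℤ) (t : ℝ) : ℝ≥0∞ :=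
  ∑' x : ℤ, ∑' y : ℤ, ∑' z : ℤ, if (a * x ^ 2 + b * y ^ 2 + c * z ^ 2) % 4 = r then
    EE t ((a * x ^ 2 + b * y ^ 2 + c * z ^ 2 : ℤ) : ℝ) else 0

lemma sq_mod (a n i : ℤ) (hi : i = 0 ∨ i = 1) : ∃ k, a * (2 * n + i) ^ 2 = a * i + 4 * k := by
  rcases hi with rfl | rfl
  · exact ⟨a * n ^ 2, by ring⟩
  · exact ⟨a * (n ^ 2 + n), by ring⟩

lemma piece (a b c r : ℤ) (t : ℝ) (i j k : ℤ) (hi : i = 0 ∨ i = 1) (hj : j = 0 ∨ j = 1)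
    (hk : k = 0 ∨ k = 1) :
    (∑' x : ℤ, ∑' y : ℤ, ∑' z : ℤ,
      if (a * (2 * x + i) ^ 2 + b * (2 * y + j) ^ 2 + c * (2 * z + k) ^ 2) % 4 = r then
      EE t ((a * (2 * x + i) ^ 2 + b * (2 * y + j) ^ 2 + c * (2 * z + k) ^ 2 : ℤ) : ℝ) else 0)
    = if (a * i + b * j + c * k) % 4 = r then TH t a i * TH t b j * TH t c k else 0 := by
  have hm : ∀ x y z : ℤ, (a * (2 * x + i) ^ 2 + b * (2 * y + j) ^ 2 + c * (2 * z + k) ^ 2) % 4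
      = (a * i + b * j + c * k) % 4 := by
    intro x y z
    obtain ⟨k1, h1⟩ := sq_mod a x i hi
    obtain ⟨k2, h2⟩ := sq_mod b y j hj
    obtain ⟨k3, h3⟩ := sq_mod c z k hk
    rw [h1, h2, h3]; omega
  simp_rw [hm]
  split_ifs
  · unfold TH
    rw [dbl, ← ENNReal.tsum_mul_right]
    apply tsum_congr; intro x
    rw [← ENNReal.tsum_mul_right]
    apply tsum_congr; intro y
    rw [← ENNReal.tsum_mul_left]
    apply tsum_congr; intro z
    rw [← EE_add, ← EE_add]
    congr 1; push_cast; ring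
  · simp

lemma par8 (g : ℤ → ℤ → ℤ → ℝ≥0∞) : ∑' x, ∑' y, ∑' z, g x y z
    = ((((∑' x, ∑' y, ∑' z, g (2 * x + 0) (2 * y + 0) (2 * z + 0))
      + (∑' x, ∑' y, ∑' z, g (2 * x + 0) (2 * y + 0) (2 * z + 1)))
      + ((∑' x, ∑' y, ∑' z, g (2 * x + 0) (2 * y + 1) (2 * z + 0))
      + (∑' x, ∑' y, ∑' z, g (2 * x + 0) (2 * y + 1) (2 * z + 1))))
      + (((∑' x, ∑' y, ∑' z, g (2 * x + 1) (2 * y + 0) (2 * z + 0))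
      + (∑' x, ∑' y, ∑' z, g (2 * x + 1) (2 * y + 0) (2 * z + 1)))
      + ((∑' x, ∑' y, ∑' z, g (2 * x + 1) (2 * y + 1) (2 * z + 0))
      + (∑' x, ∑' y, ∑' z, g (2 * x + 1) (2 * y + 1) (2 * z + 1))))) := by
  have h1 : ∀ x y, ∑' z, g x y z = (∑' z, g x y (2 * z + 0)) + ∑' z, g x y (2 * z + 1) := by
    intro x y; rw [par1]; simp
  have h2 : ∀ x, ∑' y, ∑' z, g x y z = ((∑' y, ∑' z, g x (2 * y + 0) (2 * z + 0))
      + ∑' y, ∑' z, g x (2 * y + 0) (2 * z + 1)) + ((∑' y, ∑' z, g x (2 * y + 1) (2 * z + 0))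
      + ∑' y, ∑' z, g x (2 * y + 1) (2 * z + 1)) := by
    intro x; rw [par1]
    congr 1
    · rw [← ENNReal.tsum_add]; apply tsum_congr; intro y; rw [h1]; simp
    · rw [← ENNReal.tsum_add]; apply tsum_congr; intro y; rw [h1]
  rw [par1]
  simp_rw [h2]
  simp only [ENNReal.tsum_add, add_zero]

lemma SS_eq (a b c r : ℤ) (t : ℝ) : SS a b c r t =
    (((if (a * 0 + b * 0 + c * 0) % 4 = r then TH t a 0 * TH t b 0 * TH t c 0 else 0)
    + (if (a * 0 + b * 0 + c * 1) % 4 = r then TH t a 0 * TH t b 0 * TH t c 1 else 0))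
    + ((if (a * 0 + b * 1 + c * 0) % 4 = r then TH t a 0 * TH t b 1 * TH t c 0 else 0)
    + (if (a * 0 + b * 1 + c * 1) % 4 = r then TH t a 0 * TH t b 1 * TH t c 1 else 0)))
    + (((if (a * 1 + b * 0 + c * 0) % 4 = r then TH t a 1 * TH t b 0 * TH t c 0 else 0)
    + (if (a * 1 + b * 0 + c * 1) % 4 = r then TH t a 1 * TH t b 0 * TH t c 1 else 0))
    + ((if (a * 1 + b * 1 + c * 0) % 4 = r then TH t a 1 * TH t b 1 * TH t c 0 else 0)
    + (if (a * 1 + b * 1 + c * 1) % 4 = r then TH t a 1 * TH t b 1 * TH t c 1 else 0))) := by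
  unfold SS
  rw [par8]
  congr 1
  · congr 1
    · congr 1 <;> exact piece _ _ _ _ _ _ _ _ (by simp) (by simp) (by simp)
    · congr 1 <;> exact piece _ _ _ _ _ _ _ _ (by simp) (by simp) (by simp)
  · congr 1
    · congr 1 <;> exact piece _ _ _ _ _ _ _ _ (by simp) (by simp) (by simp)
    · congr 1 <;> exact piece _ _ _ _ _ _ _ _ (by simp) (by simp) (by simp)

lemma EE_toReal2 (t c : ℝ) : (EE t c).toReal = Q (c * t) := by
  rw [EE_one_scale, EE_toReal]

lemma SS111_fin (t : ℝ) (ht : 20 ≤ t) (r : ℤ) : SS 1 1 1 r t ≠ ⊤ := by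
  have h1 := (PH_b (4 * t) (by linarith)).2.ne_top
  have h2 := DD_fin (8 * t) (by linarith)
  have h3 := EE_ne_top t 1
  rw [SS_eq]
  push_cast
  simp only [TH0, TH1, mul_one]
  refine ENNReal.add_ne_top.mpr ⟨ENNReal.add_ne_top.mpr ⟨ENNReal.add_ne_top.mpr ⟨?_, ?_⟩,
    ENNReal.add_ne_top.mpr ⟨?_, ?_⟩⟩, ENNReal.add_ne_top.mpr ⟨ENNReal.add_ne_top.mpr ⟨?_, ?_⟩,
    ENNReal.add_ne_top.mpr ⟨?_, ?_⟩⟩⟩ <;> split_ifs <;> finiteness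

lemma id1_s12 (t : ℝ) (ht : 60 ≤ t) : SS 1 1 1 1 t = 3 * SS 1 6 6 1 t + 6 * SS 2 3 6 1 t := by
  have f1 := (PH_b (4 * t) (by linarith)).2.ne_top
  have f2 := (PH_b (8 * t) (by linarith)).2.ne_top
  have f3 := (PH_b (12 * t) (by linarith)).2.ne_top
  have f4 := (PH_b (24 * t) (by linarith)).2.ne_top
  have g1 := DD_fin (8 * t) (by linarith)
  have g2 := DD_fin (16 * t) (by linarith)
  have g3 := DD_fin (24 * t) (by linarith)
  have g4 := DD_fin (48 * t) (by linarith)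
  have e : ∀ c, EE t c ≠ ⊤ := fun c => EE_ne_top t c
  have e1 := e 1
  have e2 := e 2
  have e3 := e 3
  have e6 := e 6
  obtain ⟨hI, -⟩ := main_id (4 * t) (by linarith)
  have hl3 := l3 (4 * t) (by linarith)
  have hl2 := l2 (12 * t) (by linarith)
  rw [SS_eq, SS_eq, SS_eq]
  norm_num [TH0, TH1]
  rw [← ENNReal.toReal_eq_toReal_iff' (by finiteness) (by finiteness)]
  have q2 := Q_mul 2 t
  have q3 := Q_mul 3 t
  have q4 := Q_mul 4 t
  have q6 := Q_mul 6 t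
  have q12 := Q_mul 12 t
  push_cast at q2 q3 q4 q6 q12
  rw [ENNReal.toReal_add (by finiteness) (by finiteness), ENNReal.toReal_add (by finiteness) (by finiteness),
    ENNReal.toReal_add (by finiteness) (by finiteness),
    ENNReal.toReal_mul (a := 3), ENNReal.toReal_mul (a := 6),
    ENNReal.toReal_add (by finiteness) (by finiteness), ENNReal.toReal_add (by finiteness) (by finiteness)]
  simp only [ENNReal.toReal_mul, EE_toReal2, ps_toReal, ENNReal.toReal_ofNat]
  simp only [← ph.eq_1]
  ring_nf at hI hl3 hl2 q2 q3 q4 q6 q12 ⊢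
  rw [q4] at hI hl3
  rw [q12] at hl2
  rw [q2, q3, q6]
  linear_combination 6 * Q t * hI + 6 * Q t * ps (t * 8) * hl2 + 24 * Q t ^ 5 * ps (t * 24) * hl3

lemma id2_s12 (t : ℝ) (ht : 60 ≤ t) : SS 1 1 1 2 t = 3 * SS 1 6 6 2 t + 6 * SS 2 3 6 2 t := by
  have f1 := (PH_b (4 * t) (by linarith)).2.ne_top
  have f2 := (PH_b (8 * t) (by linarith)).2.ne_top
  have f3 := (PH_b (12 * t) (by linarith)).2.ne_top
  have f4 := (PH_b (24 * t) (by linarith)).2.ne_top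
  have g1 := DD_fin (8 * t) (by linarith)
  have g2 := DD_fin (16 * t) (by linarith)
  have g3 := DD_fin (24 * t) (by linarith)
  have g4 := DD_fin (48 * t) (by linarith)
  have e : ∀ c, EE t c ≠ ⊤ := fun c => EE_ne_top t c
  have e1 := e 1
  have e2 := e 2
  have e3 := e 3
  have e6 := e 6
  obtain ⟨-, hI⟩ := main_id (4 * t) (by linarith)
  have hl3 := l3 (4 * t) (by linarith)
  have hl2 := l1 (24 * t) (by linarith)
  rw [SS_eq, SS_eq, SS_eq]
  norm_num [TH0, TH1]
  rw [← ENNReal.toReal_eq_toReal_iff' (by finiteness) (by finiteness)]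
  have q2 := Q_mul 2 t
  have q3 := Q_mul 3 t
  have q4 := Q_mul 4 t
  have q6 := Q_mul 6 t
  push_cast at q2 q3 q4 q6
  rw [ENNReal.toReal_add (by finiteness) (by finiteness), ENNReal.toReal_add (by finiteness) (by finiteness),
    ENNReal.toReal_add (by finiteness) (by finiteness),
    ENNReal.toReal_mul (a := 3), ENNReal.toReal_mul (a := 6),
    ENNReal.toReal_add (by finiteness) (by finiteness), ENNReal.toReal_add (by finiteness) (by finiteness)]
  simp only [ENNReal.toReal_mul, EE_toReal2, ps_toReal, ENNReal.toReal_ofNat]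
  simp only [← ph.eq_1]
  ring_nf at hI hl3 hl2 q2 q3 q4 q6 ⊢
  rw [q4] at hI hl3
  rw [q2, q6]
  linear_combination 12 * Q t ^ 2 * hI + 12 * Q t ^ 2 * ph (t * 12) * hl3 - 12 * Q t ^ 6 * ph (t * 4) * hl2

lemma EE_anti (s x y : ℝ) (hs : 0 ≤ s) (h : x ≤ y) : EE s y ≤ EE s x := by
  unfold EE
  apply ENNReal.ofReal_le_ofReal
  apply Real.exp_le_exp.mpr
  nlinarith

lemma EE_addt (s t x : ℝ) : EE (s + t) x = EE s x * EE t x := by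
  unfold EE
  rw [← ENNReal.ofReal_mul (Real.exp_pos _).le, ← Real.exp_add]
  congr 2; ring

lemma EE_lim : Filter.Tendsto (fun s : ℝ => EE s 1) Filter.atTop (nhds 0) := by
  unfold EE
  have h : Filter.Tendsto (fun s : ℝ => Real.exp (-(s * 1))) Filter.atTop (nhds 0) := by
    simpa using Real.tendsto_exp_neg_atTop_nhds_zero
  simpa using ENNReal.tendsto_ofReal h

lemma spl (f : ℕ → ℝ≥0∞) (n : ℕ) :
    ∑' k, f k = ∑ k ∈ Finset.range n, f k + ∑' k, f (k + n) :=
  (Summable.sum_add_tsum_nat_add' (k := n) ENNReal.summable).symm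

lemma coef_le (a b : ℕ → ℝ≥0∞) (T : ℝ) (n : ℕ)
    (h : ∀ t, T ≤ t → ∑' k : ℕ, a k * EE t k = ∑' k : ℕ, b k * EE t k)
    (hf : ∑' k : ℕ, a k * EE T k ≠ ⊤) (hn : ∀ k < n, a k = b k) : a n ≤ b n := by
  have hbf : ∑' k : ℕ, b k * EE T k ≠ ⊤ := by rw [← h T le_rfl]; exact hf
  set C : ℝ≥0∞ := ∑' k : ℕ, b k * EE T k with hC
  have key : ∀ s : ℝ, 0 ≤ s → a n ≤ b n + EE s 1 * (C / EE T n) := by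
    intro s hs
    have h1 := h (s + T) (by linarith)
    rw [spl _ n, spl (fun k : ℕ => b k * EE (s + T) k) n] at h1
    have hs1 : ∑ k ∈ Finset.range n, a k * EE (s + T) k = ∑ k ∈ Finset.range n, b k * EE (s + T) k :=
      Finset.sum_congr rfl fun k hk => by rw [hn k (Finset.mem_range.mp hk)]
    rw [hs1] at h1
    have hfin : ∑ k ∈ Finset.range n, b k * EE (s + T) k ≠ ⊤ := by
      apply ENNReal.sum_ne_top.mpr
      intro k _
      have : b k * EE T k ≠ ⊤ := ENNReal.ne_top_of_tsum_ne_top hbf k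
      rw [EE_addt, mul_left_comm]
      exact ENNReal.mul_ne_top (EE_ne_top _ _) this
    have h2 := (ENNReal.add_right_inj hfin).mp h1
    have h3 : a n * EE (s + T) n ≤ ∑' k : ℕ, a (k + n) * EE (s + T) ((k + n : ℕ) : ℝ) := by
      have := ENNReal.le_tsum (f := fun k : ℕ => a (k + n) * EE (s + T) ((k + n : ℕ) : ℝ)) 0
      simpa using this
    rw [h2, tsum_eq_zero_add' ENNReal.summable] at h3
    have h4 : ∑' k : ℕ, b (k + 1 + n) * EE (s + T) ((k + 1 + n : ℕ) : ℝ) ≤ EE s (n + 1) * C := by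
      calc _ ≤ ∑' k : ℕ, EE s (n + 1) * (b (k + (1 + n)) * EE T ((k + (1 + n) : ℕ) : ℝ)) := by
            apply ENNReal.tsum_le_tsum; intro k
            rw [add_assoc, EE_addt, mul_left_comm]
            gcongr
            apply EE_anti _ _ _ hs
            push_cast; linarith [(Nat.cast_nonneg k : (0:ℝ) ≤ k)]
        _ = EE s (n + 1) * ∑' k : ℕ, (b (k + (1 + n)) * EE T ((k + (1 + n) : ℕ) : ℝ)) :=
            ENNReal.tsum_mul_left
        _ ≤ _ := by
            gcongr
            exact ENNReal.tsum_comp_le_tsum_of_injective (add_left_injective (1 + n))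
              (fun k : ℕ => b k * EE T k)
    have h5 : a n * EE (s + T) n ≤ b n * EE (s + T) n + EE s (n + 1) * C := by
      refine h3.trans ?_
      simp only [zero_add]
      gcongr
    have hne := EE_ne_zero (s + T) n
    have hnt := EE_ne_top (s + T) n
    rw [← ENNReal.mul_le_mul_iff_left hne hnt]
    refine h5.trans (le_of_eq ?_)
    rw [add_mul]
    congr 1
    rw [EE_addt, EE_add, div_eq_mul_inv]
    calc EE s n * EE s 1 * C = EE s n * EE s 1 * C * ((EE T n)⁻¹ * EE T n) := by
          rw [ENNReal.inv_mul_cancel (EE_ne_zero _ _) (EE_ne_top _ _), mul_one]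
      _ = _ := by ring
  have hfC : C / EE T n ≠ ⊤ := ENNReal.div_ne_top hbf (EE_ne_zero _ _)
  have lim : Filter.Tendsto (fun s : ℝ => b n + EE s 1 * (C / EE T n)) Filter.atTop (nhds (b n + 0 * (C / EE T n))) :=
    tendsto_const_nhds.add (ENNReal.Tendsto.mul_const EE_lim (Or.inr hfC))
  rw [zero_mul, add_zero] at lim
  exact ge_of_tendsto lim (Filter.eventually_atTop.mpr ⟨0, key⟩)

lemma coef (a b : ℕ → ℝ≥0∞) (T : ℝ)
    (h : ∀ t, T ≤ t → ∑' k : ℕ, a k * EE t k = ∑' k : ℕ, b k * EE t k)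
    (hf : ∑' k : ℕ, a k * EE T k ≠ ⊤) (n : ℕ) : a n = b n := by
  induction n using Nat.strong_induction_on with
  | _ n ih =>
    apply le_antisymm
    · exact coef_le a b T n h hf ih
    · exact coef_le b a T n (fun t ht => (h t ht).symm) (by rwa [← h T le_rfl])
        (fun k hk => (ih k hk).symm)

/-- number of representations by a diagonal form, as an extended nonnegative real -/
noncomputable def ct (a b c : ℤ) (M : ℕ) : ℝ≥0∞ :=
  ∑' x : ℤ, ∑' y : ℤ, ∑' z : ℤ, if (M : ℤ) = a * x ^ 2 + b * y ^ 2 + c * z ^ 2 then 1 else 0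

lemma SS_ct (a b c r : ℤ) (ha : 0 ≤ a) (hb : 0 ≤ b) (hc : 0 ≤ c) (t : ℝ) :
    SS a b c r t = ∑' M : ℕ, (if (M : ℤ) % 4 = r then ct a b c M else 0) * EE t M := by
  have h1 : ∀ x y z : ℤ, (if (a * x ^ 2 + b * y ^ 2 + c * z ^ 2) % 4 = r then
      EE t ((a * x ^ 2 + b * y ^ 2 + c * z ^ 2 : ℤ) : ℝ) else 0) =
      ∑' M : ℕ, (if (M : ℤ) = a * x ^ 2 + b * y ^ 2 + c * z ^ 2 then 1 else 0) *
        (if (M : ℤ) % 4 = r then EE t M else 0) := by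
    intro x y z
    have hnn : 0 ≤ a * x ^ 2 + b * y ^ 2 + c * z ^ 2 := by positivity
    obtain ⟨m, hm⟩ := Int.eq_ofNat_of_zero_le hnn
    rw [hm, tsum_eq_single m]
    · simp
    · intro k hk
      have : (k : ℤ) ≠ m := by exact_mod_cast hk
      simp [this]
  unfold SS ct
  simp_rw [h1]
  have h2 : ∀ G : ℤ → ℤ → ℤ → ℕ → ℝ≥0∞, ∑' x, ∑' y, ∑' z, ∑' M, G x y z M
      = ∑' M, ∑' x, ∑' y, ∑' z, G x y z M := by
    intro G
    rw [ENNReal.tsum_comm (α := ℕ)]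
    apply tsum_congr; intro x
    rw [ENNReal.tsum_comm (α := ℕ)]
    apply tsum_congr; intro y
    rw [ENNReal.tsum_comm (α := ℕ)]
  rw [h2]
  apply tsum_congr; intro M
  simp_rw [ENNReal.tsum_mul_right]
  split_ifs <;> simp

lemma rep_ct (a b c : ℤ) (ha : 0 < a) (hb : 0 < b) (hc : 0 < c) (M : ℕ) :
    (rep a b c 0 0 0 M : ℝ≥0∞) = ct a b c M := by
  unfold rep ct
  set s : Set (ℤ × ℤ × ℤ) := {p | (M : ℤ) = a * p.1 ^ 2 + b * p.2.1 ^ 2 + c * p.2.2 ^ 2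
      + 0 * p.2.1 * p.2.2 + 0 * p.2.2 * p.1 + 0 * p.1 * p.2.1} with hs
  have hfin : s.Finite := by
    apply (Set.finite_Icc ((-M, -M, -M) : ℤ × ℤ × ℤ) (M, M, M)).subset
    rintro ⟨x, y, z⟩ h
    simp only [hs, Set.mem_setOf_eq] at h
    have hx : ∀ (d w : ℤ), 0 < d → |w| ≤ d * w ^ 2 := by
      intro d w hd
      rcases eq_or_ne w 0 with rfl | hw
      · simp
      · have := Int.one_le_abs hw
        rw [← sq_abs]; nlinarith [mul_self_nonneg (|w|), mul_nonneg (abs_nonneg w) (abs_nonneg w)]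
    have h1 := hx a x ha
    have h2 := hx b y hb
    have h3 := hx c z hc
    have k1 := abs_nonneg x
    have k2 := abs_nonneg y
    have k3 := abs_nonneg z
    have e1 : |x| ≤ M := by linarith
    have e2 : |y| ≤ M := by linarith
    have e3 : |z| ≤ M := by linarith
    rw [abs_le] at e1 e2 e3
    simp only [Set.mem_Icc, Prod.mk_le_mk]
    tauto
  have h1 : ((s.ncard : ℕ∞) : ℝ≥0∞) = ∑' _ : s, 1 := by
    rw [hfin.cast_ncard_eq, ENNReal.tsum_set_one]
  have h2 : (s.ncard : ℝ≥0∞) = ∑' _ : s, 1 := by rw [← h1]; simp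
  rw [h2, tsum_subtype s (fun _ => (1 : ℝ≥0∞)), ENNReal.tsum_prod']
  apply tsum_congr; intro x
  rw [ENNReal.tsum_prod']
  apply tsum_congr; intro y
  apply tsum_congr; intro z
  simp [hs, Set.indicator_apply]

lemma fin_ct (r : ℤ) (h : ∀ t : ℝ, 60 ≤ t → SS 1 1 1 r t = 3 * SS 1 6 6 r t + 6 * SS 2 3 6 r t)
    (M : ℕ) (hM : (M : ℤ) % 4 = r) : ct 1 1 1 M = 3 * ct 1 6 6 M + 6 * ct 2 3 6 M := by
  have := coef (fun M => if (M : ℤ) % 4 = r then ct 1 1 1 M else 0)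
    (fun M => 3 * (if (M : ℤ) % 4 = r then ct 1 6 6 M else 0)
      + 6 * (if (M : ℤ) % 4 = r then ct 2 3 6 M else 0)) 60 (by
      intro t ht
      have e := h t ht
      rw [SS_ct _ _ _ _ (by norm_num) (by norm_num) (by norm_num),
        SS_ct _ _ _ _ (by norm_num) (by norm_num) (by norm_num),
        SS_ct _ _ _ _ (by norm_num) (by norm_num) (by norm_num)] at e
      rw [e, ← ENNReal.tsum_mul_left, ← ENNReal.tsum_mul_left, ← ENNReal.tsum_add]
      apply tsum_congr; intro k; rw [add_mul, mul_assoc, mul_assoc]) (by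
      rw [← SS_ct _ _ _ _ (by norm_num) (by norm_num) (by norm_num)]
      exact SS111_fin 60 (by norm_num) r) M
  simpa [hM] using this

theorem disc144_identity_extended (M : ℤ) (hM : 0 < M) (h4 : M % 4 = 1 ∨ M % 4 = 2) :
    rep 1 1 1 0 0 0 M = 3 * rep 1 6 6 0 0 0 M + 6 * rep 2 3 6 0 0 0 M := by
  obtain ⟨m, rfl⟩ := Int.eq_ofNat_of_zero_le hM.le
  have h : ct 1 1 1 m = 3 * ct 1 6 6 m + 6 * ct 2 3 6 m := by
    rcases h4 with h4 | h4
    · exact fin_ct 1 id1_s12 m h4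
    · exact fin_ct 2 id2_s12 m h4
  rw [← rep_ct _ _ _ (by norm_num) (by norm_num) (by norm_num),
    ← rep_ct _ _ _ (by norm_num) (by norm_num) (by norm_num),
    ← rep_ct _ _ _ (by norm_num) (by norm_num) (by norm_num)] at h
  exact_mod_cast h
end

section
/- If M is a positive integer with M ≡ 1 (mod 8) and 3 | M, then 3·(1,8,8,0,0,0)(M/3²) = −(1,6,6,0,0,0)(M) + 2·(2,3,6,0,0,0)(M), where (1,8,8,0,0,0)(M/3²) is understood to be 0 when 3² does not divide M. -/
noncomputable def thE (c s : ℝ) (n : ℤ) : ℝ := Real.exp (-(s * ((n : ℝ) + c) ^ 2))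

noncomputable def Th (c s : ℝ) : ℝ := ∑' n : ℤ, thE c s n

lemma thE_pos (c s : ℝ) (n : ℤ) : 0 < thE c s n := Real.exp_pos _

lemma thE_summable (c : ℝ) {s : ℝ} (hs : 0 < s) : Summable (thE c s) := by
  have hpi := Real.pi_pos
  have h := summable_pow_mul_jacobiTheta₂_term_bound (s * |c| / Real.pi)
    (T := s / Real.pi) (by positivity) 0
  refine Summable.of_nonneg_of_le (fun n => (thE_pos c s n).le) (fun n => ?_) h
  simp only [pow_zero, one_mul, thE]
  apply Real.exp_le_exp.mpr
  have e : -Real.pi * (s / Real.pi * (n : ℝ) ^ 2 - 2 * (s * |c| / Real.pi) * ((|n| : ℤ) : ℝ))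
      = - s * (n : ℝ) ^ 2 + 2 * s * (|c| * |(n : ℝ)|) := by
    push_cast
    field_simp
    ring
  rw [e, ← abs_mul]
  have h1 := neg_abs_le (c * (n : ℝ))
  nlinarith [mul_nonneg hs.le (sq_nonneg c), mul_le_mul_of_nonneg_left h1 hs.le]

lemma Th_pos (c : ℝ) {s : ℝ} (hs : 0 < s) : 0 < Th c s :=
  (thE_summable c hs).tsum_pos (fun n => (thE_pos c s n).le) 0 (thE_pos c s 0)

lemma Th_neg (c s : ℝ) : Th (-c) s = Th c s := by
  unfold Th
  rw [← (Equiv.neg ℤ).tsum_eq]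
  congr 1; ext n
  simp only [thE, Equiv.neg_apply]
  push_cast
  congr 1; ring

lemma Th_add_one (c s : ℝ) : Th (c + 1) s = Th c s := by
  unfold Th
  rw [← (Equiv.addRight (1 : ℤ)).tsum_eq (thE c s)]
  congr 1; ext n
  simp only [thE, Equiv.coe_addRight]
  push_cast
  congr 1; ring

lemma mul_summable {K L : Type*} {f : K → ℝ} {g : L → ℝ} (hf : Summable f) (hg : Summable g) :
    Summable (fun p : K × L => f p.1 * g p.2) :=
  summable_mul_of_summable_norm hf.norm hg.norm

lemma mul_tsum {K L : Type*} {f : K → ℝ} {g : L → ℝ} (hf : Summable f) (hg : Summable g) :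
    (∑' k, f k) * (∑' l, g l) = ∑' p : K × L, f p.1 * g p.2 :=
  tsum_mul_tsum_of_summable_norm hf.norm hg.norm

lemma reidx {J K L : Type*} [Fintype J] (e : J → K → L)
    (he : Function.Bijective (fun p : J × K => e p.1 p.2)) (f : L → ℝ) (hf : Summable f) :
    ∑' l, f l = ∑ j, ∑' k, f (e j k) := by
  rw [← (Equiv.ofBijective _ he).tsum_eq f]
  have h2 : Summable (fun p : J × K => f (e p.1 p.2)) :=
    (Equiv.ofBijective _ he).summable_iff.mpr hf
  have := h2.tsum_prod
  simp only [Equiv.ofBijective_apply]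
  rw [this, tsum_fintype]

lemma Th_rot (a b : ℝ) {s : ℝ} (hs : 0 < s) : Th a s * Th b s =
    Th ((a + b) / 2) (2 * s) * Th ((a - b) / 2) (2 * s)
    + Th ((a + b + 1) / 2) (2 * s) * Th ((a - b + 1) / 2) (2 * s) := by
  have h2 : 0 < 2 * s := by linarith
  unfold Th
  rw [mul_tsum (thE_summable _ hs) (thE_summable _ hs),
    mul_tsum (thE_summable _ h2) (thE_summable _ h2),
    mul_tsum (thE_summable _ h2) (thE_summable _ h2),
    reidx (fun (j : Fin 2) (p : ℤ × ℤ) => (p.1 + p.2 + (j : ℕ), p.1 - p.2)) ?_ _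
      (mul_summable (thE_summable _ hs) (thE_summable _ hs)), Fin.sum_univ_two]
  · congr 1
    all_goals
      congr 1; ext p
      simp only [thE, ← Real.exp_add, Fin.val_zero, Fin.val_one]
      push_cast
      congr 1; ring
  · constructor
    · rintro ⟨i, k, l⟩ ⟨j, m, n⟩ h
      simp only [Prod.mk.injEq] at h
      have := i.2
      have := j.2
      simp only [Prod.mk.injEq, Fin.ext_iff]
      omega
    · rintro ⟨m, n⟩
      refine ⟨(⟨((m + n) % 2).toNat, by omega⟩, (m + n) / 2, (m + n) / 2 - n), ?_⟩
      simp only [Prod.mk.injEq]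
      omega

lemma Th_v {s : ℝ} (hs : 0 < s) : Th (1 / 2) (s / 2) * Th (1 / 2) s =
    2 * (Th (1 / 3) (3 * s) * Th (1 / 6) (3 * s / 2)) + Th (1 / 2) (3 * s / 2) * Th 0 (3 * s) := by
  have h2 : 0 < s / 2 := by linarith
  have h3 : 0 < 3 * s := by linarith
  have h4 : 0 < 3 * s / 2 := by linarith
  have key : Th (1 / 2) (s / 2) * Th (1 / 2) s =
    Th (1 / 2) (3 * s / 2) * Th 0 (3 * s) + Th (5 / 6) (3 * s / 2) * Th (1 / 3) (3 * s)
    + Th (7 / 6) (3 * s / 2) * Th (2 / 3) (3 * s) := by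
    unfold Th
    rw [mul_tsum (thE_summable _ h2) (thE_summable _ hs),
      mul_tsum (thE_summable _ h4) (thE_summable _ h3),
      mul_tsum (thE_summable _ h4) (thE_summable _ h3),
      mul_tsum (thE_summable _ h4) (thE_summable _ h3),
      reidx (fun (j : Fin 3) (p : ℤ × ℤ) =>
        (p.1 + 2 * p.2 + (j : ℕ), p.2 - p.1 - 1)) ?_ _
        (mul_summable (thE_summable _ h2) (thE_summable _ hs)), Fin.sum_univ_three]
    · congr 1
      · congr 1
        all_goals
          congr 1; ext p
          simp only [thE, ← Real.exp_add, Fin.val_zero, Fin.val_one]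
          push_cast
          congr 1; ring
      · congr 1; ext p
        simp only [thE, ← Real.exp_add, Fin.val_two]
        push_cast
        congr 1; ring
    · constructor
      · rintro ⟨i, k, l⟩ ⟨j, m, n⟩ h
        simp only [Prod.mk.injEq] at h
        have := i.2
        have := j.2
        simp only [Prod.mk.injEq, Fin.ext_iff]
        omega
      · rintro ⟨m, n⟩
        refine ⟨(⟨((m + n + 1) % 3).toNat, by omega⟩, (m + n + 1) / 3 - n - 1, (m + n + 1) / 3), ?_⟩
        simp only [Prod.mk.injEq]
        constructor <;> push_cast <;> omega
  rw [key, show (7 / 6 : ℝ) = 1 / 6 + 1 by norm_num, Th_add_one,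
    show (5 / 6 : ℝ) = -(1 / 6) + 1 by norm_num, Th_add_one, Th_neg,
    show (2 / 3 : ℝ) = -(1 / 3) + 1 by norm_num, Th_add_one, Th_neg]
  ring

lemma Th_quad {s : ℝ} (hs : 0 < s) : Th 0 s ^ 4 =
    Th 0 (3 * s) ^ 4 + 8 * Th (1 / 3) (3 * s) ^ 3 * Th 0 (3 * s) := by
  have h3 : 0 < 3 * s := by linarith
  have S2 := fun a b => mul_summable (thE_summable a h3) (thE_summable b h3)
  have T2 := mul_summable (thE_summable 0 hs) (thE_summable 0 hs)
  have e4 : ∀ a b c d : ℝ, Th a (3 * s) * Th b (3 * s) * (Th c (3 * s) * Th d (3 * s)) =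
      ∑' p : (ℤ × ℤ) × (ℤ × ℤ), (thE a (3 * s) p.1.1 * thE b (3 * s) p.1.2) *
        (thE c (3 * s) p.2.1 * thE d (3 * s) p.2.2) := by
    intro a b c d
    unfold Th
    rw [mul_tsum (thE_summable _ h3) (thE_summable _ h3),
      mul_tsum (thE_summable _ h3) (thE_summable _ h3), mul_tsum (S2 a b) (S2 c d)]
  have key : Th 0 s * Th 0 s * (Th 0 s * Th 0 s) = ∑ j : Fin 3 × Fin 3,
      Th (((j.1 : ℕ) : ℝ) / 3) (3 * s) * Th (((j.2 : ℕ) : ℝ) / 3) (3 * s) *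
      (Th ((((j.1 : ℕ) : ℝ) + ((j.2 : ℕ) : ℝ)) / 3) (3 * s) *
        Th ((((j.1 : ℕ) : ℝ) - ((j.2 : ℕ) : ℝ)) / 3) (3 * s)) := by
    simp only [e4]
    unfold Th
    rw [mul_tsum (thE_summable _ hs) (thE_summable _ hs), mul_tsum T2 T2,
      reidx (fun (j : Fin 3 × Fin 3) (p : (ℤ × ℤ) × (ℤ × ℤ)) =>
        ((p.1.1 + p.2.1 + p.2.2 + (j.1 : ℕ), p.1.2 + p.2.1 - p.2.2 + (j.2 : ℕ)),
          (p.1.1 + p.1.2 - p.2.1, p.1.1 - p.1.2 - p.2.2))) ?_ _ (mul_summable T2 T2)]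
    · apply Finset.sum_congr rfl
      intro j _
      congr 1; ext p
      simp only [thE, ← Real.exp_add]
      push_cast
      congr 1; ring
    · constructor
      · rintro ⟨⟨i, i'⟩, ⟨k, l⟩, ⟨k', l'⟩⟩ ⟨⟨j, j'⟩, ⟨m, n⟩, ⟨m', n'⟩⟩ h
        simp only [Prod.mk.injEq] at h
        have := i.2
        have := j.2
        have := i'.2
        have := j'.2
        simp only [Prod.mk.injEq, Fin.ext_iff]
        omega
      · rintro ⟨⟨m, n⟩, ⟨m', n'⟩⟩
        refine ⟨((⟨((m + m' + n') % 3).toNat, by omega⟩, ⟨((n + m' - n') % 3).toNat, by omega⟩),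
          ((m + m' + n') / 3, (n + m' - n') / 3),
          ((m + m' + n') / 3 + (n + m' - n') / 3 - m', (m + m' + n') / 3 - (n + m' - n') / 3 - n')), ?_⟩
        simp only [Prod.mk.injEq]
        refine ⟨⟨?_, ?_⟩, ?_, ?_⟩ <;> push_cast <;> omega
  have key2 := key
  rw [Fintype.sum_prod_type] at key2
  simp only [Fin.sum_univ_three] at key2
  norm_num at key2
  have a1 : Th (2 / 3) (3 * s) = Th (1 / 3) (3 * s) := by
    rw [show (2 / 3 : ℝ) = -(1 / 3) + 1 by norm_num, Th_add_one, Th_neg]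
  have a2 : Th (4 / 3) (3 * s) = Th (1 / 3) (3 * s) := by
    rw [show (4 / 3 : ℝ) = (1 / 3) + 1 by norm_num, Th_add_one]
  have a3 : Th 1 (3 * s) = Th 0 (3 * s) := by
    rw [show (1 : ℝ) = 0 + 1 by norm_num, Th_add_one]
  have a4 : Th (-1 / 3) (3 * s) = Th (1 / 3) (3 * s) := by
    rw [show (-1 / 3 : ℝ) = -(1 / 3) by norm_num, Th_neg]
  have a5 : Th (-2 / 3) (3 * s) = Th (1 / 3) (3 * s) := by
    rw [show (-2 / 3 : ℝ) = -(2 / 3) by norm_num, Th_neg, a1]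
  have a6 : Th (-(1 / 3)) (3 * s) = Th (1 / 3) (3 * s) := Th_neg _ _
  have a7 : Th (-(2 / 3)) (3 * s) = Th (1 / 3) (3 * s) := by rw [Th_neg, a1]
  simp only [a1, a2, a3, a4, a5, a6, a7] at key2
  linear_combination key2

lemma Th_main {s : ℝ} (hs : 0 < s) : 2 * (Th (1 / 2) (s / 2) * Th (1 / 2) s * Th 0 (3 * s)) =
    Th (1 / 2) (3 * s / 2) * Th 0 s ^ 2 + 3 * (Th (1 / 2) (3 * s / 2) * Th 0 (3 * s) ^ 2) := by
  have h2 : 0 < 3 * s := by linarith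
  have h4 : 0 < 3 * s / 2 := by linarith
  have i1 := Th_quad hs
  have i2 := Th_rot (1 / 6) (1 / 6) h4
  have i3 := Th_rot (1 / 6) (1 / 2) h4
  have i4 := Th_rot (1 / 2) (1 / 2) h4
  have i5 := Th_v hs
  have e1 : Th (2 / 3) (3 * s) = Th (1 / 3) (3 * s) := by
    rw [show (2 / 3 : ℝ) = -(1 / 3) + 1 by norm_num, Th_add_one, Th_neg]
  have e2 : Th (5 / 6) (3 * s) = Th (1 / 6) (3 * s) := by
    rw [show (5 / 6 : ℝ) = -(1 / 6) + 1 by norm_num, Th_add_one, Th_neg]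
  have e3 : Th 1 (3 * s) = Th 0 (3 * s) := by
    rw [show (1 : ℝ) = 0 + 1 by norm_num, Th_add_one]
  have e4 : Th (-1 / 6) (3 * s) = Th (1 / 6) (3 * s) := by
    rw [show (-1 / 6 : ℝ) = -(1 / 6) by norm_num, Th_neg]
  have e5 : Th (-(1 / 6)) (3 * s) = Th (1 / 6) (3 * s) := Th_neg _ _
  rw [show 2 * (3 * s / 2) = 3 * s by ring] at i2 i3 i4
  norm_num at i2 i3 i4
  simp only [e1, e2, e3, e4, e5] at i2 i3 i4
  have pF := Th_pos 0 hs
  have pF3 := Th_pos 0 h2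
  have pP3 := Th_pos (1 / 2) h4
  have pP6 := Th_pos (1 / 2) h2
  have pO := Th_pos (1 / 3) h2
  have pA := Th_pos (1 / 6) h4
  have pA' := Th_pos (1 / 6) h2
  generalize Th 0 s = F at *
  generalize Th 0 (3 * s) = F3 at *
  generalize Th (1 / 2) (3 * s / 2) = P3 at *
  generalize Th (1 / 2) (3 * s) = P6 at *
  generalize Th (1 / 3) (3 * s) = O at *
  generalize Th (1 / 6) (3 * s / 2) = A at *
  generalize Th (1 / 6) (3 * s) = A' at *
  have hX : (4 * F3 * O * A - P3 * F3 ^ 2 - P3 * F ^ 2) *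
      (4 * F3 * O * A - P3 * F3 ^ 2 + P3 * F ^ 2) = 0 := by
    linear_combination 16 * F3 ^ 2 * O ^ 2 * i2 - 8 * F3 ^ 3 * O * i3 - 8 * O ^ 3 * F3 * i4
      - P3 ^ 2 * i1
  have hF : F3 ^ 2 < F ^ 2 := by
    have : 0 < 8 * O ^ 3 * F3 := by positivity
    nlinarith [sq_nonneg F, sq_nonneg F3, pow_pos pF 2, pow_pos pF3 2]
  have hpos : 0 < 4 * F3 * O * A - P3 * F3 ^ 2 + P3 * F ^ 2 := by
    have : 0 < 4 * F3 * O * A := by positivity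
    nlinarith [mul_lt_mul_of_pos_left hF pP3]
  have hC := (mul_eq_zero.mp hX).resolve_right hpos.ne'
  rw [i5]
  linear_combination hC

lemma HasSum.congr_fun' {f g : ℕ → ℝ} {a : ℝ} (h : HasSum f a) (e : ∀ n, g n = f n) :
    HasSum g a := by
  rw [show g = f from funext e]
  exact h

lemma fib {K : Type*} (f : K → ℕ) (q : ℝ) (h : Summable (fun k => q ^ f k)) :
    HasSum (fun n : ℕ => (Nat.card {k // f k = n} : ℝ) * q ^ n) (∑' k, q ^ f k) := by
  have h1 := h.hasSum.tsum_fiberwise f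
  refine HasSum.congr_fun' h1 (fun n => ?_)
  have : ∀ b : f ⁻¹' {n}, q ^ f b = q ^ n := fun b => by rw [b.2]
  simp only [this, tsum_const, nsmul_eq_mul]
  rfl

lemma pow_uniq (D : ℕ → ℝ) (h : ∀ q : ℝ, 0 < q → q < 1 → HasSum (fun n => D n * q ^ n) 0) :
    ∀ n, D n = 0 := by
  set p := FormalMultilinearSeries.ofScalars ℝ D with hp
  have hr : ((1 / 2 : NNReal) : ENNReal) ≤ p.radius := by
    apply p.le_radius_of_summable
    have := (h (1 / 2) (by norm_num) (by norm_num)).summable.norm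
    refine this.congr (fun n => ?_)
    rw [hp, FormalMultilinearSeries.ofScalars_norm]
    simp
  have hr0 : 0 < p.radius := lt_of_lt_of_le (by norm_num) hr
  have hb := (p.hasFPowerSeriesOnBall hr0).hasFPowerSeriesAt
  have hz : ∀ q : ℝ, 0 < q → q < 1 → p.sum q = 0 := by
    intro q h0 h1
    rw [← (h q h0 h1).tsum_eq]
    simp only [FormalMultilinearSeries.sum, hp, FormalMultilinearSeries.ofScalars_apply_eq,
      smul_eq_mul]
  have hfr : ∃ᶠ z in nhdsWithin (0 : ℝ) {0}ᶜ, p.sum z = 0 := by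
    have hle : nhdsWithin (0 : ℝ) (Set.Ioi 0) ≤ nhdsWithin (0 : ℝ) {0}ᶜ :=
      nhdsWithin_mono _ (fun x hx => ne_of_gt hx)
    refine Filter.Frequently.filter_mono (Filter.Eventually.frequently ?_) hle
    filter_upwards [Ioo_mem_nhdsGT (show (0 : ℝ) < 1 by norm_num)] with z hz'
    exact hz z hz'.1 hz'.2
  have hev := hb.analyticAt.frequently_zero_iff_eventually_zero.mp hfr
  have hp0 : p = 0 := hb.eq_zero_of_eventually hev
  have := (FormalMultilinearSeries.ofScalars_series_eq_zero (E := ℝ) (c := D)).mp hp0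
  intro n
  rw [this]; rfl

lemma extract {K : Type*} (f g h : K → ℕ)
    (hf : ∀ q : ℝ, 0 < q → q < 1 → Summable (fun k => q ^ f k))
    (hg : ∀ q : ℝ, 0 < q → q < 1 → Summable (fun k => q ^ g k))
    (hh : ∀ q : ℝ, 0 < q → q < 1 → Summable (fun k => q ^ h k))
    (e : ∀ q : ℝ, 0 < q → q < 1 →
      2 * ∑' k, q ^ f k = ∑' k, q ^ g k + 3 * ∑' k, q ^ h k) (n : ℕ) :
    2 * (Nat.card {k // f k = n} : ℤ) = Nat.card {k // g k = n} + 3 * Nat.card {k // h k = n} := by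
  have key := pow_uniq (fun n => 2 * (Nat.card {k // f k = n} : ℝ) - (Nat.card {k // g k = n}
      + 3 * Nat.card {k // h k = n})) (by
    intro q h0 h1
    have := ((fib f q (hf q h0 h1)).mul_left 2).sub
      ((fib g q (hg q h0 h1)).add ((fib h q (hh q h0 h1)).mul_left 3))
    rw [e q h0 h1, sub_self] at this
    refine HasSum.congr_fun' this (fun n => ?_)
    ring) n
  have k2 := sub_eq_zero.mp key
  exact_mod_cast k2

lemma cvt (f : ℤ × ℤ × ℤ → ℤ) (hf : ∀ k, 0 ≤ f k) (a b c : ℝ) (u v w : ℝ) (hu : 0 < u) (hv : 0 < v)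
    (hw : 0 < w) (he : ∀ x y z : ℤ, (f (x, y, z) : ℝ) = u * (x + a) ^ 2 + v * (y + b) ^ 2
      + w * (z + c) ^ 2) (q : ℝ) (h0 : 0 < q) (h1 : q < 1) :
    HasSum (fun k => q ^ (f k).toNat) (Th a (u * (-Real.log q)) *
      (Th b (v * (-Real.log q)) * Th c (w * (-Real.log q)))) := by
  have ht : 0 < - Real.log q := by linarith [Real.log_neg h0 h1]
  have su := thE_summable a (mul_pos hu ht)
  have sv := thE_summable b (mul_pos hv ht)
  have sw := thE_summable c (mul_pos hw ht)
  unfold Th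
  rw [mul_tsum sv sw, mul_tsum su (mul_summable sv sw)]
  convert (mul_summable su (mul_summable sv sw)).hasSum using 1
  ext ⟨x, y, z⟩
  simp only [thE, ← Real.exp_add]
  rw [← Real.exp_log (pow_pos h0 _), Real.log_pow]
  have : (((f (x, y, z)).toNat : ℕ) : ℝ) = ((f (x, y, z) : ℤ) : ℝ) := by
    exact_mod_cast congrArg (Int.cast : ℤ → ℝ) (Int.toNat_of_nonneg (hf (x, y, z)))
  rw [this, he]
  congr 1; ring

def g1 (k : ℤ × ℤ × ℤ) : ℤ := (2 * k.1 + 1) ^ 2 + 2 * (2 * k.2.1 + 1) ^ 2 + 24 * k.2.2 ^ 2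
def g2 (k : ℤ × ℤ × ℤ) : ℤ := 3 * (2 * k.1 + 1) ^ 2 + 8 * k.2.1 ^ 2 + 8 * k.2.2 ^ 2
def g3 (k : ℤ × ℤ × ℤ) : ℤ := 3 * (2 * k.1 + 1) ^ 2 + 24 * k.2.1 ^ 2 + 24 * k.2.2 ^ 2

lemma card_cvt (g : ℤ × ℤ × ℤ → ℤ) (hg : ∀ k, 0 ≤ g k) (N : ℤ) (hN : 0 ≤ N) :
    Nat.card {k // (g k).toNat = N.toNat} = {k | g k = N}.ncard := by
  have : {k | g k = N} = {k | (g k).toNat = N.toNat} := by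
    ext k
    have := hg k
    simp only [Set.mem_ofPred_eq]
    omega
  rw [this]; rfl

lemma counts (N : ℤ) (hN : 0 ≤ N) : 2 * ({k | g1 k = N}.ncard : ℤ) =
    {k | g2 k = N}.ncard + 3 * {k | g3 k = N}.ncard := by
  have p1 : ∀ k, 0 ≤ g1 k := fun k => by unfold g1; positivity
  have p2 : ∀ k, 0 ≤ g2 k := fun k => by unfold g2; positivity
  have p3 : ∀ k, 0 ≤ g3 k := fun k => by unfold g3; positivity
  have c1 := cvt g1 p1 (1 / 2) (1 / 2) 0 4 8 24 (by norm_num) (by norm_num) (by norm_num)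
    (fun x y z => by simp only [g1]; push_cast; ring)
  have c2 := cvt g2 p2 (1 / 2) 0 0 12 8 8 (by norm_num) (by norm_num) (by norm_num)
    (fun x y z => by simp only [g2]; push_cast; ring)
  have c3 := cvt g3 p3 (1 / 2) 0 0 12 24 24 (by norm_num) (by norm_num) (by norm_num)
    (fun x y z => by simp only [g3]; push_cast; ring)
  have := extract (fun k => (g1 k).toNat) (fun k => (g2 k).toNat) (fun k => (g3 k).toNat)
    (fun q h0 h1 => (c1 q h0 h1).summable) (fun q h0 h1 => (c2 q h0 h1).summable)
    (fun q h0 h1 => (c3 q h0 h1).summable) (fun q h0 h1 => by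
      rw [(c1 q h0 h1).tsum_eq, (c2 q h0 h1).tsum_eq, (c3 q h0 h1).tsum_eq]
      have ht : 0 < - Real.log q := by linarith [Real.log_neg h0 h1]
      have m := Th_main (s := 8 * (- Real.log q)) (by linarith)
      rw [show 8 * (- Real.log q) / 2 = 4 * (- Real.log q) by ring,
        show 3 * (8 * (- Real.log q)) = 24 * (- Real.log q) by ring,
        show 24 * (- Real.log q) / 2 = 12 * (- Real.log q) by ring] at m
      linear_combination m) N.toNat
  rw [card_cvt g1 p1 N hN, card_cvt g2 p2 N hN, card_cvt g3 p3 N hN] at this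
  exact this

lemma sq8 (x : ℤ) : (x % 2 = 0 ∧ ((x ^ 2) % 8 = 0 ∨ (x ^ 2) % 8 = 4)) ∨ (x % 2 = 1 ∧ (x ^ 2) % 8 = 1) := by
  have h : x % 8 = 0 ∨ x % 8 = 1 ∨ x % 8 = 2 ∨ x % 8 = 3 ∨ x % 8 = 4 ∨ x % 8 = 5 ∨ x % 8 = 6
    ∨ x % 8 = 7 := by omega
  rcases h with h | h | h | h | h | h | h | h <;>
    simp [pow_two, Int.mul_emod, h] <;> omega

lemma sq3 (x : ℤ) : (x % 3 = 0 ∧ (x ^ 2) % 3 = 0) ∨ (x % 3 ≠ 0 ∧ (x ^ 2) % 3 = 1) := by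
  have h : x % 3 = 0 ∨ x % 3 = 1 ∨ x % 3 = 2 := by omega
  rcases h with h | h | h <;> simp [pow_two, Int.mul_emod, h]

theorem disc144_companion (M : ℤ) (hM : 0 < M) (h8 : M % 8 = 1) (h3 : 3 ∣ M) :
    3 * (if (3 ^ 2 : ℤ) ∣ M then (rep 1 8 8 0 0 0 (M / 3 ^ 2) : ℤ) else 0) =
      -(rep 1 6 6 0 0 0 M : ℤ) + 2 * rep 2 3 6 0 0 0 M := by
  obtain ⟨N, rfl⟩ := h3
  have hN8 : N % 8 = 3 := by omega
  have hN : 0 ≤ N := by omega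
  have r1 : rep 2 3 6 0 0 0 (3 * N) = {k | g1 k = N}.ncard := by
    unfold rep
    rw [← Set.ncard_image_of_injective {k | g1 k = N}
      (f := fun k : ℤ × ℤ × ℤ => ((6 * k.2.2, 2 * k.1 + 1, 2 * k.2.1 + 1) : ℤ × ℤ × ℤ))]
    · congr 1
      ext ⟨x, y, z⟩
      simp only [Set.mem_ofPred_eq, Set.mem_image, Prod.mk.injEq, Prod.exists, g1]
      constructor
      · intro h
        have hx : x % 3 = 0 := by
          rcases sq3 x with h | h <;> omega
        obtain ⟨u, rfl⟩ := Int.dvd_of_emod_eq_zero hx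
        have h' : N = 6 * u ^ 2 + y ^ 2 + 2 * z ^ 2 := by linarith
        have hu := sq8 u
        have hy := sq8 y
        have hz := sq8 z
        have : u % 2 = 0 ∧ y % 2 = 1 ∧ z % 2 = 1 := by omega
        refine ⟨y / 2, z / 2, u / 2, ?_, by omega, by omega, by omega⟩
        have e1 : 2 * (y / 2) + 1 = y := by omega
        have e2 : 2 * (z / 2) + 1 = z := by omega
        have e3 : 2 * (u / 2) = u := by omega
        rw [e1, e2]
        have : 24 * (u / 2) ^ 2 = 6 * u ^ 2 := by
          conv_rhs => rw [← e3]
          ring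
        linarith
      · rintro ⟨a, b, c, h, rfl, rfl, rfl⟩
        rw [← h]; ring
    · rintro ⟨a, b, c⟩ ⟨a', b', c'⟩ h
      simp only [Prod.mk.injEq] at h ⊢
      omega
  have r2 : rep 1 6 6 0 0 0 (3 * N) = {k | g2 k = N}.ncard := by
    unfold rep
    rw [← Set.ncard_image_of_injective {k | g2 k = N}
      (f := fun k : ℤ × ℤ × ℤ => ((3 * (2 * k.1 + 1), 2 * k.2.1, 2 * k.2.2) : ℤ × ℤ × ℤ))]
    · congr 1
      ext ⟨x, y, z⟩
      simp only [Set.mem_ofPred_eq, Set.mem_image, Prod.mk.injEq, Prod.exists, g2]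
      constructor
      · intro h
        have hx : x % 3 = 0 := by
          rcases sq3 x with h | h <;> omega
        obtain ⟨u, rfl⟩ := Int.dvd_of_emod_eq_zero hx
        have h' : N = 3 * u ^ 2 + 2 * y ^ 2 + 2 * z ^ 2 := by linarith
        have hu := sq8 u
        have hy := sq8 y
        have hz := sq8 z
        have : u % 2 = 1 ∧ y % 2 = 0 ∧ z % 2 = 0 := by omega
        refine ⟨u / 2, y / 2, z / 2, ?_, by omega, by omega, by omega⟩
        have e1 : 2 * (u / 2) + 1 = u := by omega
        have e2 : 2 * (y / 2) = y := by omega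
        have e3 : 2 * (z / 2) = z := by omega
        rw [e1]
        have a1 : 8 * (y / 2) ^ 2 = 2 * y ^ 2 := by
          conv_rhs => rw [← e2]
          ring
        have a2 : 8 * (z / 2) ^ 2 = 2 * z ^ 2 := by
          conv_rhs => rw [← e3]
          ring
        linarith
      · rintro ⟨a, b, c, h, rfl, rfl, rfl⟩
        rw [← h]; ring
    · rintro ⟨a, b, c⟩ ⟨a', b', c'⟩ h
      simp only [Prod.mk.injEq] at h ⊢
      omega
  have r3 : (if (3 ^ 2 : ℤ) ∣ 3 * N then (rep 1 8 8 0 0 0 (3 * N / 3 ^ 2) : ℤ) else 0)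
      = ({k | g3 k = N}.ncard : ℤ) := by
    split_ifs with hd
    · obtain ⟨L, hL⟩ := hd
      have hL' : N = 3 * L := by omega
      have hdiv : 3 * N / 3 ^ 2 = L := by omega
      rw [hdiv]
      norm_cast
      unfold rep
      rw [← Set.ncard_image_of_injective {k | g3 k = N}
        (f := fun k : ℤ × ℤ × ℤ => ((2 * k.1 + 1, k.2.1, k.2.2) : ℤ × ℤ × ℤ))]
      · congr 1
        ext ⟨x, y, z⟩
        simp only [Set.mem_ofPred_eq, Set.mem_image, Prod.mk.injEq, Prod.exists, g3]
        constructor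
        · intro h
          have hx := sq8 x
          have : x % 2 = 1 := by omega
          refine ⟨x / 2, y, z, ?_, by omega, rfl, rfl⟩
          have e1 : 2 * (x / 2) + 1 = x := by omega
          rw [e1]
          linarith
        · rintro ⟨a, b, c, h, rfl, rfl, rfl⟩
          linarith
      · rintro ⟨a, b, c⟩ ⟨a', b', c'⟩ h
        simp only [Prod.mk.injEq] at h ⊢
        omega
    · have : {k | g3 k = N} = ∅ := by
        ext ⟨x, y, z⟩
        simp only [Set.mem_ofPred_eq, g3, Set.mem_empty_iff_false, iff_false]
        intro h
        apply hd
        exact ⟨(2 * x + 1) ^ 2 + 8 * y ^ 2 + 8 * z ^ 2, by rw [← h]; ring⟩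
      rw [this]; simp
  rw [r1, r2, r3]
  linarith [counts N hN]
end
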